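/- Let 2 < p, q, r' < ∞ be exponents with 1/r = 1/p + 1/q (so r' = r/(r−1)). Then there exists a constant C = C(p,q,r), depending only on p, q, r, such that for every pair of real sequences (a_n)_{n∈ℤ}, (b_n)_{n∈ℤ} satisfying a_n < b_n ≤ a_{n+1} for all n, b_n − a_n = b_0 − a_0 for all n, and a_{n+1} − b_n = a_1 − b_0 for all n (i.e. all intervals [a_n,b_n] have the same length and consecutive intervals are separated by the same gap), and for all Schwartz functions f, g on ℝ, ‖ ( Σ_{n∈ℤ} |π_{[a_n,b_n]}(f,g)|² )^{1/2} ‖_{L^r(ℝ)} ≤ C ‖f‖_{L^p(ℝ)} ‖g‖_{L^q(ℝ)}. -/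

import Mathlib

open MeasureTheory Real Set
open scoped ENNReal

/-- The Fourier transform `f̂(ξ) = ∫ f(t) e^{-2πitξ} dt`. -/
noncomputable def FT (f : ℝ → ℂ) (ξ : ℝ) : ℂ :=
  ∫ t : ℝ, Complex.exp (((-2 * Real.pi * t * ξ : ℝ) : ℂ) * Complex.I) * f t

/-- The bilinear multiplier
`π_A(f,g)(x) = ∫∫ e^{2πix(ξ₁+ξ₂)} f̂(ξ₁) ĝ(ξ₂) 1_A(ξ₂-ξ₁) dξ₁ dξ₂`. -/
noncomputable def biMul (A : Set ℝ) (f g : ℝ → ℂ) (x : ℝ) : ℂ :=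
  ∫ ξ : ℝ × ℝ, Complex.exp (((2 * Real.pi * x * (ξ.1 + ξ.2) : ℝ) : ℂ) * Complex.I) *
    FT f ξ.1 * FT g ξ.2 * A.indicator 1 (ξ.2 - ξ.1)

namespace TF

/-- The total mass of the quadratic weight on the integers. -/
noncomputable def wSum : ℝ := ∑' j : ℤ, ((1 + |(j : ℝ)|) ^ 2)⁻¹

lemma summable_quadratic_weight : Summable fun j : ℤ => ((1 + |(j : ℝ)|) ^ 2)⁻¹ := by
  have h : Summable fun n : ℕ => ((1 + (n : ℝ)) ^ 2)⁻¹ := by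
    have := (summable_nat_add_iff 1).2 (Real.summable_nat_pow_inv.2 (by norm_num : 1 < 2))
    refine this.congr fun n => ?_
    push_cast; rw [add_comm]
  refine Summable.of_nat_of_neg ?_ ?_ <;> simpa using h

lemma wSum_pos : 0 < wSum := by
  have h := summable_quadratic_weight.sum_le_tsum {0} (fun i _ => by positivity)
  have : (1 : ℝ) ≤ wSum := by simpa [wSum] using h
  linarith

lemma sum_quadratic_weight_le (M : Finset ℤ) (y : ℝ) :
    ∑ m ∈ M, ((1 + |(m : ℝ) - y|) ^ 2)⁻¹ ≤ 4 * wSum := by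
  have h1 : ∀ m ∈ M, ((1 + |(m : ℝ) - y|) ^ 2)⁻¹ ≤
      4 * ((1 + |((m - ⌊y⌋ : ℤ) : ℝ)|) ^ 2)⁻¹ := by
    intro m _
    have hf := Int.floor_le y
    have hf' := Int.lt_floor_add_one y
    have h2 : 1 + |((m - ⌊y⌋ : ℤ) : ℝ)| ≤ 2 * (1 + |(m : ℝ) - y|) := by
      push_cast
      rcases abs_cases ((m : ℝ) - ⌊y⌋) with h | h <;> rcases abs_cases ((m : ℝ) - y) with h' | h' <;>
        linarith
    have h3 : (0 : ℝ) < 1 + |((m - ⌊y⌋ : ℤ) : ℝ)| := by positivity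
    rw [inv_le_iff_one_le_mul₀ (by positivity), mul_assoc, ← div_eq_inv_mul, ← mul_div_assoc,
      le_div_iff₀ (by positivity)]
    nlinarith [pow_le_pow_left₀ h3.le h2 2]
  calc _ ≤ ∑ m ∈ M, 4 * ((1 + |((m - ⌊y⌋ : ℤ) : ℝ)|) ^ 2)⁻¹ := Finset.sum_le_sum h1
    _ = 4 * ∑ m ∈ M.map (Equiv.subRight ⌊y⌋).toEmbedding, ((1 + |(m : ℝ)|) ^ 2)⁻¹ := by
        rw [Finset.mul_sum, Finset.sum_map]; simp
    _ ≤ _ := by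
        gcongr
        exact summable_quadratic_weight.sum_le_tsum _ (fun i _ => by positivity)

lemma sum_scaled_weight_le (X : Finset ℤ) (y : ℝ) (k : ℕ) :
    ∑ x ∈ X, ((1 + |(x : ℝ) - y| / 2 ^ k) ^ 2)⁻¹ ≤ 16 * wSum * 2 ^ k := by
  classical
  have hk : (0 : ℝ) < 2 ^ k := by positivity
  have hkz : (0 : ℤ) < 2 ^ k := by positivity
  have h1 : ∀ x ∈ X, ((1 + |(x : ℝ) - y| / 2 ^ k) ^ 2)⁻¹ ≤
      4 * ((1 + |((x / 2 ^ k : ℤ) : ℝ) - y / 2 ^ k|) ^ 2)⁻¹ := by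
    intro x _
    have e : ((2 ^ k : ℤ) : ℝ) * ((x / 2 ^ k : ℤ) : ℝ) + ((x % 2 ^ k : ℤ) : ℝ) = x := by
      exact_mod_cast Int.mul_ediv_add_emod x (2 ^ k)
    have r0 : (0 : ℝ) ≤ ((x % 2 ^ k : ℤ) : ℝ) := by exact_mod_cast Int.emod_nonneg x hkz.ne'
    have r1 : ((x % 2 ^ k : ℤ) : ℝ) ≤ 2 ^ k := by
      exact_mod_cast (Int.emod_lt_of_pos x hkz).le
    push_cast at e r0 r1
    set q : ℝ := ((x / 2 ^ k : ℤ) : ℝ)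
    set r : ℝ := ((x % 2 ^ k : ℤ) : ℝ)
    have h2 : 1 + |q - y / 2 ^ k| ≤ 2 * (1 + |(x : ℝ) - y| / 2 ^ k) := by
      have : |(x : ℝ) - y| / 2 ^ k = |q + r / 2 ^ k - y / 2 ^ k| := by
        rw [← abs_of_pos hk, ← abs_div, abs_of_pos hk, ← e]; congr 1; field_simp
      rw [this]
      have r2 : r / 2 ^ k ≤ 1 := by rw [div_le_one hk]; exact r1
      have r3 : 0 ≤ r / 2 ^ k := by positivity
      rcases abs_cases (q - y / 2 ^ k) with h | h <;>
        rcases abs_cases (q + r / 2 ^ k - y / 2 ^ k) with h' | h' <;> linarith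
    have h3 : (0 : ℝ) < 1 + |q - y / 2 ^ k| := by positivity
    rw [inv_le_iff_one_le_mul₀ (by positivity), mul_assoc, ← div_eq_inv_mul, ← mul_div_assoc,
      le_div_iff₀ (by positivity)]
    nlinarith [pow_le_pow_left₀ h3.le h2 2]
  refine (Finset.sum_le_sum h1).trans ?_
  rw [← Finset.sum_fiberwise_of_maps_to (t := X.image fun x : ℤ => (x / 2 ^ k : ℤ))
    (g := fun x : ℤ => (x / 2 ^ k : ℤ)) (fun x hx => Finset.mem_image_of_mem _ hx)]
  have h4 : ∀ q ∈ X.image (fun x : ℤ => (x / 2 ^ k : ℤ)),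
      ∑ x ∈ X with x / 2 ^ k = q, 4 * ((1 + |((x / 2 ^ k : ℤ) : ℝ) - y / 2 ^ k|) ^ 2)⁻¹ ≤
        4 * 2 ^ k * ((1 + |(q : ℝ) - y / 2 ^ k|) ^ 2)⁻¹ := by
    intro q _
    have h5 : ∀ x ∈ X.filter (fun x => x / 2 ^ k = q),
        4 * ((1 + |((x / 2 ^ k : ℤ) : ℝ) - y / 2 ^ k|) ^ 2)⁻¹ =
          4 * ((1 + |(q : ℝ) - y / 2 ^ k|) ^ 2)⁻¹ := by
      intro x hx; rw [(Finset.mem_filter.1 hx).2]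
    rw [Finset.sum_congr rfl h5, Finset.sum_const, nsmul_eq_mul]
    have hc : (X.filter (fun x => x / 2 ^ k = q)).card ≤ 2 ^ k := by
      have : X.filter (fun x => x / 2 ^ k = q) ⊆ Finset.Ico (q * 2 ^ k) (q * 2 ^ k + 2 ^ k) := by
        intro x hx
        have hq := (Finset.mem_filter.1 hx).2
        have := Int.mul_ediv_add_emod x (2 ^ k)
        have := Int.emod_nonneg x hkz.ne'
        have := Int.emod_lt_of_pos x hkz
        rw [hq] at *
        rw [Finset.mem_Ico]
        constructor <;> linarith
      refine (Finset.card_le_card this).trans ?_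
      simp
    have hc' : ((X.filter (fun x => x / 2 ^ k = q)).card : ℝ) ≤ 2 ^ k := by exact_mod_cast hc
    calc _ ≤ (2 ^ k : ℝ) * (4 * ((1 + |(q : ℝ) - y / 2 ^ k|) ^ 2)⁻¹) := by gcongr
      _ = _ := by ring
  refine (Finset.sum_le_sum h4).trans ?_
  rw [← Finset.mul_sum]
  have := sum_quadratic_weight_le (X.image fun x : ℤ => (x / 2 ^ k : ℤ)) (y / 2 ^ k)
  calc _ ≤ 4 * 2 ^ k * (4 * wSum) := by gcongr
    _ = _ := by ring

/-- Integers whose affine images lie in a short interval are few. -/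
lemma card_le_of_affine (L : Finset ℤ) (σ d : ℤ) (hσ : σ ≠ 0) (r ρ : ℝ) (hρ : 0 ≤ ρ)
    (h : ∀ l ∈ L, |((σ * l + d : ℤ) : ℝ) - r| ≤ ρ) : (L.card : ℝ) ≤ 2 * ρ + 1 := by
  classical
  have hinj : Function.Injective fun l : ℤ => σ * l + d := by
    intro a b hab
    simpa [hσ] using hab
  rw [← Finset.card_image_of_injective L hinj]
  have hsub : L.image (fun l => σ * l + d) ⊆ Finset.Icc ⌈r - ρ⌉ ⌊r + ρ⌋ := by
    intro c hc
    obtain ⟨l, hl, rfl⟩ := Finset.mem_image.1 hc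
    have := abs_le.1 (h l hl)
    rw [Finset.mem_Icc, Int.ceil_le, Int.le_floor]
    constructor <;> linarith
  have h1 : ((L.image fun l => σ * l + d).card : ℝ) ≤ (Finset.Icc ⌈r - ρ⌉ ⌊r + ρ⌋).card := by
    exact_mod_cast Finset.card_le_card hsub
  refine h1.trans ?_
  rw [Int.card_Icc]
  have h2 := Int.floor_le (r + ρ)
  have h3 := Int.le_ceil (r - ρ)
  have h4 : (((⌊r + ρ⌋ + 1 - ⌈r - ρ⌉).toNat : ℤ) : ℝ) ≤ 2 * ρ + 1 := by
    rcases le_total 0 (⌊r + ρ⌋ + 1 - ⌈r - ρ⌉) with h | h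
    · rw [Int.toNat_of_nonneg h]; push_cast; linarith
    · rw [Int.toNat_of_nonpos h]; push_cast; linarith
  exact_mod_cast h4

/-- A time-frequency tile: scale `k`, frequency index `l`, position `m`. -/
@[ext] structure Tile where
  k : ℕ
  l : ℤ
  m : ℤ

/-- The top of a tree: a dyadic interval and a frequency. -/
structure Top where
  k : ℕ
  m : ℤ
  ξ : ℝ

/-- The spatial decay of wave packets at scale `2 ^ k`. -/
noncomputable def wt (y : ℝ) (k : ℕ) : ℝ := ((1 + |y| / 2 ^ k) ^ 4)⁻¹

/-- The left end point of the spatial interval of a tile. -/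
def Tile.pos (P : Tile) : ℝ := P.m * 2 ^ P.k

/-- The central frequency of the component of a tile with parameters `σ`, `d`. -/
def Tile.cen (σ d : ℤ) (P : Tile) : ℝ := ((σ * P.l + d : ℤ) : ℝ)

/-- The frequency intervals of `P` and of the longer tile `Q` overlap. -/
def Near (σ d : ℤ) (P Q : Tile) : Prop :=
  P.k ≤ Q.k ∧ |P.cen σ d - 2 ^ P.k / 2 ^ Q.k * Q.cen σ d| < 1 + 2 ^ P.k / 2 ^ Q.k

/-- Spatial inclusion of a tile in a top interval. -/
def Sub (P : Tile) (T : Top) : Prop :=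
  P.k ≤ T.k ∧ T.m * 2 ^ T.k ≤ P.m * 2 ^ P.k ∧ (P.m + 1) * 2 ^ P.k ≤ (T.m + 1) * 2 ^ T.k

/-- Membership in the tree with a given top. -/
def InTree (P : Tile) (T : Top) : Prop := Sub P T ∧ |(P.l : ℝ) - 2 ^ P.k * T.ξ| ≤ 100

/-- Membership in the one-sided lacunary part of a tree. -/
def Lac (σ d : ℤ) (ε : ℝ) (P : Tile) (T : Top) : Prop :=
  InTree P T ∧ 3 ≤ ε * (P.cen σ d - σ * 2 ^ P.k * T.ξ)

lemma wt_nonneg (y : ℝ) (k : ℕ) : 0 ≤ wt y k := by unfold wt; positivity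

lemma wt_eq_sq (y : ℝ) (k : ℕ) :
    wt y k = ((1 + |y| / 2 ^ k) ^ 2)⁻¹ * ((1 + |y| / 2 ^ k) ^ 2)⁻¹ := by
  unfold wt; rw [← mul_inv]; ring

lemma quad_le_one (y : ℝ) (hy : 0 ≤ y) : ((1 + y) ^ 2)⁻¹ ≤ 1 :=
  inv_le_one_of_one_le₀ (one_le_pow₀ (by linarith))

lemma wt_le_quad (y : ℝ) (k : ℕ) : wt y k ≤ ((1 + |y| / 2 ^ k) ^ 2)⁻¹ := by
  rw [wt_eq_sq]
  exact mul_le_of_le_one_right (by positivity) (quad_le_one _ (by positivity))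

open Classical in
/-- Sums over tiles with frequencies confined to a bounded number of values per scale. -/
lemma sum_tiles_le (σ d : ℤ) (hσ : σ ≠ 0) (S : Finset Tile) (f : ℕ → ℤ → ℝ)
    (hf : ∀ k m, 0 ≤ f k m)
    (K : Finset ℕ) (hK : ∀ P ∈ S, P.k ∈ K) (r : ℕ → ℝ) (ρ : ℝ) (hρ : 0 ≤ ρ)
    (hr : ∀ P ∈ S, |P.cen σ d - r P.k| ≤ ρ) (B : ℕ → ℝ)
    (hB : ∀ k ∈ K, ∑ m ∈ (S.filter fun P => P.k = k).image Tile.m, f k m ≤ B k) :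
    ∑ P ∈ S, f P.k P.m ≤ (2 * ρ + 1) * ∑ k ∈ K, B k := by
  rw [← Finset.sum_fiberwise_of_maps_to hK, Finset.mul_sum]
  refine Finset.sum_le_sum fun k hk => ?_
  refine le_trans ?_ (mul_le_mul_of_nonneg_left (hB k hk) (by linarith))
  rw [← Finset.sum_fiberwise_of_maps_to (t := (S.filter fun P => P.k = k).image Tile.m)
    (g := Tile.m) (fun x hx => Finset.mem_image_of_mem _ hx), Finset.mul_sum]
  refine Finset.sum_le_sum fun m _ => ?_
  set R := (S.filter fun P => P.k = k).filter fun P => P.m = m with hR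
  have hm : ∀ P ∈ R, P ∈ S ∧ P.k = k ∧ P.m = m := by
    intro P hP; simpa [hR, and_assoc] using hP
  have h1 : ∀ P ∈ R, f P.k P.m = f k m := fun P hP => by
    rw [(hm P hP).2.1, (hm P hP).2.2]
  rw [Finset.sum_congr rfl h1, Finset.sum_const, nsmul_eq_mul]
  refine mul_le_mul_of_nonneg_right ?_ (hf k m)
  have h2 : (R.image Tile.l).card = R.card := by
    refine Finset.card_image_of_injOn fun P hP Q hQ h => ?_
    have hP' := hm P hP
    have hQ' := hm Q hQ
    exact Tile.ext (hP'.2.1.trans hQ'.2.1.symm) h (hP'.2.2.trans hQ'.2.2.symm)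
  rw [← h2]
  refine card_le_of_affine _ σ d hσ (r k) ρ hρ fun l hl => ?_
  obtain ⟨P, hP, rfl⟩ := Finset.mem_image.1 hl
  have := hr P (hm P hP).1
  rwa [(hm P hP).2.1] at this

/-- The constant in the comparison of tiles of similar scales. -/
noncomputable def schurC : ℝ := 10 ^ 9 * wSum

open Classical in
lemma near_scale_small (σ d : ℤ) (hσ : σ ≠ 0) (S : Finset Tile) (Q : Tile) :
    ∑ P ∈ S with Near σ d P Q ∧ Q.k < P.k + 9, 2 ^ P.k * wt (P.pos - Q.pos) Q.k ≤
      schurC * 2 ^ Q.k := by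
  have hw := wSum_pos
  have key := sum_tiles_le σ d hσ (S.filter fun P => Near σ d P Q ∧ Q.k < P.k + 9)
    (fun k m => 2 ^ k * wt (m * 2 ^ k - Q.pos) Q.k)
    (fun k m => mul_nonneg (by positivity) (wt_nonneg _ _)) (Finset.Icc (Q.k - 8) Q.k)
    (by
      intro P hP
      have h := (Finset.mem_filter.1 hP).2
      have := h.1.1
      rw [Finset.mem_Icc]; omega)
    (fun k => 2 ^ k / 2 ^ Q.k * Q.cen σ d) 2 (by norm_num)
    (by
      intro P hP
      have h := (Finset.mem_filter.1 hP).2.1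
      have h3 : (2 : ℝ) ^ P.k / 2 ^ Q.k ≤ 1 := by
        rw [div_le_one (by positivity)]
        exact pow_le_pow_right₀ (by norm_num) h.1
      have := h.2
      linarith)
    (fun k => 2 ^ Q.k * (2 ^ 18 * (4 * wSum)))
    (by
      intro k hk
      rw [Finset.mem_Icc] at hk
      have hpk : (0 : ℝ) < 2 ^ k := by positivity
      have hpQ : (0 : ℝ) < 2 ^ Q.k := by positivity
      rw [← Finset.mul_sum]
      have h1 : (2 : ℝ) ^ k ≤ 2 ^ Q.k := pow_le_pow_right₀ (by norm_num) hk.2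
      have h2 : (2 : ℝ) ^ Q.k ≤ 2 ^ 9 * 2 ^ k := by
        rw [← pow_add]; exact pow_le_pow_right₀ (by norm_num) (by omega)
      refine mul_le_mul h1 ?_ (Finset.sum_nonneg fun _ _ => wt_nonneg _ _) hpQ.le
      refine le_trans ?_ (mul_le_mul_of_nonneg_left (sum_quadratic_weight_le
        ((Finset.filter (fun P => P.k = k)
          (S.filter fun P => Near σ d P Q ∧ Q.k < P.k + 9)).image Tile.m) (Q.pos / 2 ^ k))
          (by norm_num))
      rw [Finset.mul_sum]
      refine Finset.sum_le_sum fun m _ => (wt_le_quad _ _).trans ?_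
      have h4 : |(m : ℝ) * 2 ^ k - Q.pos| = 2 ^ k * |(m : ℝ) - Q.pos / 2 ^ k| := by
        rw [← abs_of_pos hpk, ← abs_mul, abs_of_pos hpk]; congr 1; field_simp
      rw [h4]
      set u := |(m : ℝ) - Q.pos / 2 ^ k|
      have hu : 0 ≤ u := abs_nonneg _
      have h5 : 1 + u ≤ 2 ^ 9 * (1 + 2 ^ k * u / 2 ^ Q.k) := by
        have : u ≤ 2 ^ 9 * (2 ^ k * u / 2 ^ Q.k) := by
          rw [← mul_div_assoc, le_div_iff₀ hpQ]
          nlinarith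
        linarith
      rw [inv_le_iff_one_le_mul₀ (by positivity), mul_assoc, ← div_eq_inv_mul, ← mul_div_assoc,
        le_div_iff₀ (by positivity)]
      have := pow_le_pow_left₀ (by positivity) h5 2
      nlinarith)
  refine le_trans (le_of_eq ?_) (key.trans ?_)
  · rfl
  · rw [Finset.sum_const, nsmul_eq_mul]
    have hc : ((Finset.Icc (Q.k - 8) Q.k).card : ℝ) ≤ 9 := by
      rw [Nat.card_Icc]; exact_mod_cast (by omega)
    calc _ ≤ (2 * 2 + 1) * (9 * (2 ^ Q.k * (2 ^ 18 * (4 * wSum)))) := by gcongr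
      _ = (5 * 9 * 2 ^ 18 * 4) * wSum * 2 ^ Q.k := by ring
      _ ≤ _ := by unfold schurC; gcongr; norm_num

open Classical in
lemma near_scale_large (σ d : ℤ) (hσ : σ ≠ 0) (S : Finset Tile) (P : Tile) :
    ∑ Q ∈ S with Near σ d P Q ∧ Q.k < P.k + 9, wt (P.pos - Q.pos) Q.k ≤ schurC := by
  have hw := wSum_pos
  have key := sum_tiles_le σ d hσ (S.filter fun Q => Near σ d P Q ∧ Q.k < P.k + 9)
    (fun k m => wt (P.pos - m * 2 ^ k) k) (fun k m => wt_nonneg _ _)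
    (Finset.Icc P.k (P.k + 8))
    (by
      intro Q hQ
      have h := (Finset.mem_filter.1 hQ).2
      have := h.1.1
      rw [Finset.mem_Icc]; omega)
    (fun k => 2 ^ k / 2 ^ P.k * P.cen σ d) (2 ^ 10) (by norm_num)
    (by
      intro Q hQ
      have h := (Finset.mem_filter.1 hQ).2
      have hpk : (0 : ℝ) < 2 ^ P.k := by positivity
      have hpQ : (0 : ℝ) < 2 ^ Q.k := by positivity
      have h1 : (2 : ℝ) ^ P.k ≤ 2 ^ Q.k := pow_le_pow_right₀ (by norm_num) h.1.1
      have h2 : (2 : ℝ) ^ Q.k ≤ 2 ^ 9 * 2 ^ P.k := by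
        rw [← pow_add]; exact pow_le_pow_right₀ (by norm_num) (by omega)
      have e : Q.cen σ d - 2 ^ Q.k / 2 ^ P.k * P.cen σ d =
          -(2 ^ Q.k / 2 ^ P.k) * (P.cen σ d - 2 ^ P.k / 2 ^ Q.k * Q.cen σ d) := by
        field_simp; ring
      have h3 : (2 : ℝ) ^ P.k / 2 ^ Q.k ≤ 1 := by rw [div_le_one hpQ]; exact h1
      have h4 : (2 : ℝ) ^ Q.k / 2 ^ P.k ≤ 2 ^ 9 := by rw [div_le_iff₀ hpk]; exact h2
      rw [e, abs_mul, abs_neg, abs_of_pos (by positivity : (0 : ℝ) < 2 ^ Q.k / 2 ^ P.k)]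
      calc _ ≤ (2 : ℝ) ^ 9 * 2 := by
            gcongr
            linarith [h.1.2]
        _ = _ := by norm_num)
    (fun _ => 4 * wSum)
    (by
      intro k hk
      have hpk : (0 : ℝ) < 2 ^ k := by positivity
      refine le_trans (Finset.sum_le_sum fun m _ => ?_)
        (sum_quadratic_weight_le _ (P.pos / 2 ^ k))
      refine (wt_le_quad _ _).trans (le_of_eq ?_)
      congr 3
      rw [← abs_of_pos hpk, ← abs_div, abs_of_pos hpk, abs_sub_comm]
      congr 1; field_simp)
  refine le_trans (le_of_eq ?_) (key.trans ?_)
  · rfl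
  · rw [Finset.sum_const, nsmul_eq_mul]
    have hc : ((Finset.Icc P.k (P.k + 8)).card : ℝ) = 9 := by
      rw [Nat.card_Icc]; norm_cast; omega
    rw [hc]
    unfold schurC
    nlinarith

open Classical in
/-- Schur's test for tiles of similar scales. -/
lemma near_scale_schur (σ d : ℤ) (hσ : σ ≠ 0) (S : Finset Tile) (α : Tile → ℝ) :
    ∑ Q ∈ S, ∑ P ∈ S with Near σ d P Q ∧ Q.k < P.k + 9,
      2 ^ P.k * α P * α Q * wt (P.pos - Q.pos) Q.k ≤ schurC * ∑ P ∈ S, 2 ^ P.k * α P ^ 2 := by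
  have h1 : ∀ P Q : Tile, 2 ^ P.k * α P * α Q * wt (P.pos - Q.pos) Q.k ≤
      α Q ^ 2 / 2 * (2 ^ P.k * wt (P.pos - Q.pos) Q.k) +
        2 ^ P.k * α P ^ 2 / 2 * wt (P.pos - Q.pos) Q.k := by
    intro P Q
    have h := wt_nonneg (P.pos - Q.pos) Q.k
    have h2 : (0 : ℝ) ≤ 2 ^ P.k * wt (P.pos - Q.pos) Q.k := by positivity
    nlinarith [mul_nonneg h2 (sq_nonneg (α P - α Q))]
  refine (Finset.sum_le_sum fun Q _ => Finset.sum_le_sum fun P _ => h1 P Q).trans ?_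
  simp only [Finset.sum_add_distrib]
  have e1 : ∑ Q ∈ S, ∑ P ∈ S with Near σ d P Q ∧ Q.k < P.k + 9,
      α Q ^ 2 / 2 * (2 ^ P.k * wt (P.pos - Q.pos) Q.k) ≤
        ∑ Q ∈ S, α Q ^ 2 / 2 * (schurC * 2 ^ Q.k) := by
    refine Finset.sum_le_sum fun Q _ => ?_
    rw [← Finset.mul_sum]
    exact mul_le_mul_of_nonneg_left (near_scale_small σ d hσ S Q) (by positivity)
  have e2 : ∑ Q ∈ S, ∑ P ∈ S with Near σ d P Q ∧ Q.k < P.k + 9,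
      2 ^ P.k * α P ^ 2 / 2 * wt (P.pos - Q.pos) Q.k ≤
        ∑ P ∈ S, 2 ^ P.k * α P ^ 2 / 2 * schurC := by
    rw [Finset.sum_comm' (t' := S)
      (s' := fun P => S.filter fun Q => Near σ d P Q ∧ Q.k < P.k + 9)
      (by intro x y; simp only [Finset.mem_filter]; tauto)]
    refine Finset.sum_le_sum fun P _ => ?_
    rw [← Finset.mul_sum]
    exact mul_le_mul_of_nonneg_left (near_scale_large σ d hσ S P) (by positivity)
  refine (add_le_add e1 e2).trans (le_of_eq ?_)
  rw [← Finset.sum_add_distrib, Finset.mul_sum]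
  exact Finset.sum_congr rfl fun P _ => by ring

/-- The spatial interval of a tile. -/
noncomputable def Tile.I (P : Tile) : Finset ℤ := Finset.Ico (P.m * 2 ^ P.k) ((P.m + 1) * 2 ^ P.k)

/-- The spatial interval of a top. -/
noncomputable def Top.I (T : Top) : Finset ℤ := Finset.Ico (T.m * 2 ^ T.k) ((T.m + 1) * 2 ^ T.k)

lemma sub_or_disjoint (P : Tile) (T : Top) (h : P.k ≤ T.k) : Sub P T ∨ Disjoint P.I T.I := by
  by_contra hcon
  rw [not_or, Finset.not_disjoint_iff] at hcon
  obtain ⟨hs, x, hx, hx'⟩ := hcon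
  simp only [Tile.I, Top.I, Finset.mem_Ico] at hx hx'
  apply hs
  obtain ⟨e, he⟩ := Nat.exists_eq_add_of_le h
  have hp : (0 : ℤ) < 2 ^ P.k := by positivity
  rw [he, pow_add] at hx'
  refine ⟨h, ?_, ?_⟩ <;> rw [he, pow_add]
  · have h1 : T.m * 2 ^ e * 2 ^ P.k < (P.m + 1) * 2 ^ P.k := by linarith
    have h2 := lt_of_mul_lt_mul_right h1 hp.le
    have h3 : T.m * 2 ^ e ≤ P.m := by omega
    nlinarith
  · have h1 : P.m * 2 ^ P.k < (T.m + 1) * 2 ^ e * 2 ^ P.k := by linarith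
    have h2 := lt_of_mul_lt_mul_right h1 hp.le
    have h3 : P.m + 1 ≤ (T.m + 1) * 2 ^ e := by omega
    nlinarith

lemma Sub.subset {P : Tile} {T : Top} (h : Sub P T) : P.I ⊆ T.I :=
  Finset.Ico_subset_Ico h.2.1 h.2.2

lemma cen_sub (σ d : ℤ) (P : Tile) (ξ : ℝ) :
    P.cen σ d - σ * 2 ^ P.k * ξ = σ * (P.l - 2 ^ P.k * ξ) + d := by
  unfold Tile.cen; push_cast; ring

/-- Admissible parameters of the components of a tri-tile. -/
structure Params (σ d : ℤ) : Prop where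
  ne : σ ≠ 0
  le : |σ| ≤ 2
  d_le : |d| ≤ 70

lemma Params.abs_cen_le {σ d : ℤ} (h : Params σ d) {P : Tile} {T : Top} (hP : InTree P T) :
    |P.cen σ d - σ * 2 ^ P.k * T.ξ| ≤ 270 := by
  rw [cen_sub]
  have h1 : |(σ : ℝ)| ≤ 2 := by exact_mod_cast h.le
  have h2 : |(d : ℝ)| ≤ 70 := by exact_mod_cast h.d_le
  calc _ ≤ |(σ : ℝ) * (P.l - 2 ^ P.k * T.ξ)| + |(d : ℝ)| := abs_add_le _ _
    _ = |(σ : ℝ)| * |P.l - 2 ^ P.k * T.ξ| + |(d : ℝ)| := by rw [abs_mul]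
    _ ≤ 2 * 100 + 70 := by gcongr; exact hP.2
    _ = _ := by norm_num

lemma Params.near_top {σ d : ℤ} (h : Params σ d) {P Q : Tile} {T : Top} (hQ : InTree Q T)
    (hk : P.k + 9 ≤ Q.k) (hn : |P.cen σ d - 2 ^ P.k / 2 ^ Q.k * Q.cen σ d| < 2) :
    |P.cen σ d - σ * 2 ^ P.k * T.ξ| < 3 := by
  have h1 := h.abs_cen_le hQ
  have hpk : (0 : ℝ) < 2 ^ P.k := by positivity
  have hpQ : (0 : ℝ) < 2 ^ Q.k := by positivity
  have h2 : (2 : ℝ) ^ P.k * 512 ≤ 2 ^ Q.k := by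
    rw [show (512 : ℝ) = 2 ^ 9 by norm_num, ← pow_add]
    exact pow_le_pow_right₀ (by norm_num) hk
  have h3 : (2 : ℝ) ^ P.k / 2 ^ Q.k ≤ 1 / 512 := by
    rw [div_le_div_iff₀ hpQ (by norm_num)]; linarith
  have e : P.cen σ d - σ * 2 ^ P.k * T.ξ = (P.cen σ d - 2 ^ P.k / 2 ^ Q.k * Q.cen σ d) +
      2 ^ P.k / 2 ^ Q.k * (Q.cen σ d - σ * 2 ^ Q.k * T.ξ) := by
    field_simp; ring
  rw [e]
  refine (abs_add_le _ _).trans_lt ?_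
  rw [abs_mul, abs_of_pos (by positivity : (0 : ℝ) < 2 ^ P.k / 2 ^ Q.k)]
  have : 2 ^ P.k / 2 ^ Q.k * |Q.cen σ d - σ * 2 ^ Q.k * T.ξ| ≤ 1 / 512 * 270 := by gcongr
  linarith

lemma Params.freq_near_top {σ d : ℤ} (h : Params σ d) {P : Tile} {ξ : ℝ}
    (hn : |P.cen σ d - σ * 2 ^ P.k * ξ| < 3) : |(P.l : ℝ) - 2 ^ P.k * ξ| ≤ 100 := by
  rw [cen_sub] at hn
  have h2 : |(d : ℝ)| ≤ 70 := by exact_mod_cast h.d_le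
  have h1 : (1 : ℝ) ≤ |(σ : ℝ)| := by exact_mod_cast Int.one_le_abs h.ne
  have h3 : |(σ : ℝ) * (P.l - 2 ^ P.k * ξ)| ≤ 73 := by
    have := abs_sub_abs_le_abs_sub ((σ : ℝ) * (P.l - 2 ^ P.k * ξ)) (-d)
    rw [abs_neg, sub_neg_eq_add] at this
    linarith
  rw [abs_mul] at h3
  nlinarith [abs_nonneg ((P.l : ℝ) - 2 ^ P.k * ξ)]

/-- A tile lying below a lacunary tile of another tree forces an order of the top frequencies. -/
lemma Params.top_order {σ d : ℤ} (h : Params σ d) {ε : ℝ} (hε : |ε| = 1) {P Q : Tile}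
    {T T' : Top} (hP : Lac σ d ε P T) (hQ : InTree Q T')
    (hk : P.k + 9 ≤ Q.k) (hn : |P.cen σ d - 2 ^ P.k / 2 ^ Q.k * Q.cen σ d| < 2) :
    ε * σ * T.ξ < ε * σ * T'.ξ := by
  have h1 := h.near_top hQ hk hn
  have h2 := hP.2
  have h3 : ε * (P.cen σ d - σ * 2 ^ P.k * T'.ξ) < 3 := by
    refine (le_abs_self _).trans_lt ?_
    rw [abs_mul, hε, one_mul]; exact h1
  have hpk : (0 : ℝ) < 2 ^ P.k := by positivity
  have h4 : 2 ^ P.k * (ε * σ * T.ξ) < 2 ^ P.k * (ε * σ * T'.ξ) := by linarith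
  exact lt_of_mul_lt_mul_left h4 hpk.le

open Classical in
/-- Greedy selection of trees whose one-sided lacunary parts carry a large square sum. -/
theorem select_trees {σ d : ℤ} (hp : Params σ d) {ε : ℝ} (hε : |ε| = 1) (Ξ : Finset ℝ)
    (α : Tile → ℝ) (v : ℝ) (hv : 0 ≤ v) (n : ℕ) : ∀ S : Finset Tile, S.card ≤ n →
    ∃ (𝒯 : Finset Top) (A : Top → Finset Tile),
      (∀ T ∈ 𝒯, T.ξ ∈ Ξ) ∧
      (∀ T ∈ 𝒯, A T ⊆ S.filter fun P => Lac σ d ε P T) ∧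
      (∀ T ∈ 𝒯, v * 2 ^ T.k < ∑ P ∈ A T, 2 ^ P.k * α P ^ 2) ∧
      (∀ T ∈ 𝒯, ∀ T' ∈ 𝒯, T ≠ T' → Disjoint (A T) (A T')) ∧
      (∀ T ∈ 𝒯, ∀ T' ∈ 𝒯, ∀ P ∈ A T, ∀ Q ∈ A T', P.k + 9 ≤ Q.k →
        |P.cen σ d - 2 ^ P.k / 2 ^ Q.k * Q.cen σ d| < 2 → Disjoint P.I T'.I) ∧
      (∀ T : Top, T.ξ ∈ Ξ →
        ∑ P ∈ S with (∀ T' ∈ 𝒯, ¬ InTree P T') ∧ Lac σ d ε P T, 2 ^ P.k * α P ^ 2 ≤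
          v * 2 ^ T.k) := by
  induction n with
  | zero =>
    intro S hS
    have : S = ∅ := by simpa using hS
    subst this
    refine ⟨∅, fun _ => ∅, by simp, by simp, by simp, by simp, by simp, fun T _ => ?_⟩
    simp; positivity
  | succ n ih =>
    intro S hS
    set bad : Top → Prop := fun T =>
      v * 2 ^ T.k < ∑ P ∈ S with Lac σ d ε P T, 2 ^ P.k * α P ^ 2 with hbad
    by_cases hb : ∃ T : Top, T.ξ ∈ Ξ ∧ bad T
    swap
    · push Not at hb
      refine ⟨∅, fun _ => ∅, by simp, by simp, by simp, by simp, by simp, fun T hT => ?_⟩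
      simpa [hbad] using hb T hT
    obtain ⟨ξ₀, hξ₀, hmax⟩ := Finset.exists_max_image
      (Ξ.filter fun ξ => ∃ T : Top, T.ξ = ξ ∧ bad T) (fun ξ => ε * σ * ξ) (by
        obtain ⟨T, hT, hT'⟩ := hb
        exact ⟨T.ξ, Finset.mem_filter.2 ⟨hT, T, rfl, hT'⟩⟩)
    obtain ⟨hξ₀Ξ, T₀, hT₀ξ, hT₀⟩ := Finset.mem_filter.1 hξ₀
    subst hT₀ξ
    have hT₀' : v * 2 ^ T₀.k < ∑ P ∈ S with Lac σ d ε P T₀, 2 ^ P.k * α P ^ 2 := hT₀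
    set S' := S.filter fun P => ¬ InTree P T₀ with hS'
    have hne : ∃ P ∈ S, Lac σ d ε P T₀ := by
      by_contra hcon
      push Not at hcon
      rw [Finset.filter_false_of_mem hcon, Finset.sum_empty] at hT₀'
      have : (0 : ℝ) ≤ v * 2 ^ T₀.k := by positivity
      linarith
    have hcard : S'.card ≤ n := by
      obtain ⟨P, hP, hPl⟩ := hne
      have : S' ⊂ S := Finset.filter_ssubset.2 ⟨P, hP, by simpa using hPl.1⟩
      have := Finset.card_lt_card this
      omega
    obtain ⟨𝒯, A, h1, h2, h3, h4, h5, h6⟩ := ih S' hcard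
    have hT₀n : T₀ ∉ 𝒯 := by
      intro hmem
      have h7 := h3 _ hmem
      have h8 : A T₀ = ∅ := by
        rw [Finset.eq_empty_iff_forall_notMem]
        intro P hP
        have := h2 _ hmem hP
        rw [Finset.mem_filter, hS', Finset.mem_filter] at this
        exact this.1.2 this.2.1
      rw [h8, Finset.sum_empty] at h7
      have : (0 : ℝ) ≤ v * 2 ^ T₀.k := by positivity
      linarith
    have hnew : ∀ T ∈ 𝒯, T ≠ T₀ := fun T hT h => hT₀n (h ▸ hT)
    set A' := Function.update A T₀ (S.filter fun P => Lac σ d ε P T₀) with hA'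
    have hA0 : A' T₀ = S.filter fun P => Lac σ d ε P T₀ := by simp [hA']
    have hA1 : ∀ T ∈ 𝒯, A' T = A T := fun T hT => by
      simp [hA', Function.update_of_ne (hnew T hT)]
    have hold : ∀ T ∈ 𝒯, ∀ P ∈ A T, P ∈ S ∧ ¬ InTree P T₀ ∧ Lac σ d ε P T := by
      intro T hT P hP
      have := h2 T hT hP
      rw [Finset.mem_filter, hS', Finset.mem_filter] at this
      exact ⟨this.1.1, this.1.2, this.2⟩
    have hord : ∀ T ∈ 𝒯, ε * σ * T.ξ ≤ ε * σ * T₀.ξ := by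
      intro T hT
      refine hmax _ (Finset.mem_filter.2 ⟨h1 T hT, T, rfl, ?_⟩)
      refine (h3 T hT).trans_le (Finset.sum_le_sum_of_subset_of_nonneg ?_ ?_)
      · intro P hP
        have := hold T hT P hP
        exact Finset.mem_filter.2 ⟨this.1, this.2.2⟩
      · intros; positivity
    have hd0 : ∀ T ∈ 𝒯, Disjoint (S.filter fun P => Lac σ d ε P T₀) (A T) := by
      intro T hT
      rw [Finset.disjoint_left]
      intro P hP hP'
      exact (hold T hT P hP').2.1 (Finset.mem_filter.1 hP).2.1
    refine ⟨insert T₀ 𝒯, A', ?_, ?_, ?_, ?_, ?_, ?_⟩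
    · intro T hT
      rcases Finset.mem_insert.1 hT with rfl | hT
      · exact hξ₀Ξ
      · exact h1 T hT
    · intro T hT
      rcases Finset.mem_insert.1 hT with rfl | hT
      · rw [hA0]
      · rw [hA1 T hT]
        intro P hP
        have := hold T hT P hP
        exact Finset.mem_filter.2 ⟨this.1, this.2.2⟩
    · intro T hT
      rcases Finset.mem_insert.1 hT with rfl | hT
      · rw [hA0]; exact hT₀'
      · rw [hA1 T hT]; exact h3 T hT
    · intro T hT T' hT' hne'
      rcases Finset.mem_insert.1 hT with hT1 | hT1 <;> rcases Finset.mem_insert.1 hT' with hT2 | hT2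
      · exact absurd (hT1.trans hT2.symm) hne'
      · rw [hT1, hA0, hA1 T' hT2]; exact hd0 T' hT2
      · rw [hT2, hA0, hA1 T hT1]; exact (hd0 T hT1).symm
      · rw [hA1 T hT1, hA1 T' hT2]; exact h4 T hT1 T' hT2 hne'
    · intro T hT T' hT' P hP Q hQ hk hn
      rcases Finset.mem_insert.1 hT with hT1 | hT1 <;> rcases Finset.mem_insert.1 hT' with hT2 | hT2
      · subst hT1
        subst hT2
        rw [hA0] at hP hQ
        have := hp.top_order hε (Finset.mem_filter.1 hP).2 (Finset.mem_filter.1 hQ).2.1 hk hn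
        exact absurd this (lt_irrefl _)
      · subst hT1
        rw [hA0] at hP
        rw [hA1 T' hT2] at hQ
        have := hp.top_order hε (Finset.mem_filter.1 hP).2 (hold T' hT2 Q hQ).2.2.1 hk hn
        exact absurd this (not_lt.2 (hord T' hT2))
      · subst hT2
        rw [hA1 T hT1] at hP
        rw [hA0] at hQ
        have hQt := (Finset.mem_filter.1 hQ).2.1
        have hPn := (hold T hT1 P hP).2.1
        have hfr := hp.freq_near_top (hp.near_top hQt hk hn)
        have hkk : P.k ≤ T'.k := by have := hQt.1.1; omega
        rcases sub_or_disjoint P T' hkk with hs | hs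
        · exact absurd ⟨hs, hfr⟩ hPn
        · exact hs
      · rw [hA1 T hT1] at hP
        rw [hA1 T' hT2] at hQ
        exact h5 T hT1 T' hT2 P hP Q hQ hk hn
    · intro T hT
      refine le_trans (le_of_eq ?_) (h6 T hT)
      refine Finset.sum_congr ?_ fun _ _ => rfl
      ext P
      simp only [hS', Finset.mem_filter, Finset.mem_insert, forall_eq_or_imp]
      tauto

/-- The constant of the tail estimate for trees. -/
noncomputable def tailC : ℝ := 541 * (256 * wSum ^ 2)

lemma tailC_pos : 0 < tailC := by have := wSum_pos; unfold tailC; positivity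

lemma sum_two_pow_le (n : ℕ) : ∑ k ∈ Finset.range (n + 1), (2 : ℝ) ^ k ≤ 2 * 2 ^ n := by
  rw [geom_sum_eq (by norm_num)]
  rw [pow_succ]; linarith [pow_pos (two_pos : (0 : ℝ) < 2) n]

open Classical in
lemma tree_tail {σ d : ℤ} (hp : Params σ d) (A : Finset Tile) (T : Top)
    (hA : ∀ Q ∈ A, InTree Q T) (X : Finset ℤ) (hX : Disjoint X T.I) :
    ∑ Q ∈ A, ∑ x ∈ X, wt (x - Q.pos) Q.k ≤ tailC * 2 ^ T.k := by
  have hw := wSum_pos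
  set a : ℝ := T.m * 2 ^ T.k with ha
  set b : ℝ := (T.m + 1) * 2 ^ T.k with hb
  have hX' : ∀ x ∈ X, (x : ℝ) ≤ a ∨ b ≤ x := by
    intro x hx
    have := Finset.disjoint_left.1 hX hx
    rw [Top.I, Finset.mem_Ico, not_and_or, not_le, not_lt] at this
    rcases this with h | h
    · left; rw [ha]; exact_mod_cast h.le
    · right; rw [hb]; exact_mod_cast h
  have key := sum_tiles_le σ d hp.ne A (fun k m => ∑ x ∈ X, wt (x - m * 2 ^ k) k)
    (fun k m => Finset.sum_nonneg fun _ _ => wt_nonneg _ _) (Finset.range (T.k + 1))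
    (fun Q hQ => by have := (hA Q hQ).1.1; rw [Finset.mem_range]; omega)
    (fun k => σ * 2 ^ k * T.ξ) 270 (by norm_num) (fun Q hQ => hp.abs_cen_le (hA Q hQ))
    (fun k => 128 * wSum ^ 2 * 2 ^ k) (by
      intro k _
      set M := (A.filter fun P => P.k = k).image Tile.m with hM
      have hMm : ∀ m ∈ M, a ≤ m * 2 ^ k ∧ (m : ℝ) * 2 ^ k ≤ b := by
        intro m hm
        obtain ⟨Q, hQ, rfl⟩ := Finset.mem_image.1 hm
        obtain ⟨hQA, rfl⟩ := Finset.mem_filter.1 hQ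
        have h := (hA Q hQA).1
        have h2 : (0 : ℤ) < 2 ^ Q.k := by positivity
        have h3 : Q.m * 2 ^ Q.k ≤ (T.m + 1) * 2 ^ T.k := by nlinarith [h.2.2]
        constructor
        · rw [ha]; exact_mod_cast h.2.1
        · rw [hb]; exact_mod_cast h3
      have hk : (0 : ℝ) < 2 ^ k := by positivity
      have hpt : ∀ m ∈ M, ∀ x ∈ X, wt (x - m * 2 ^ k) k ≤
          (((1 + |(x : ℝ) - a| / 2 ^ k) ^ 2)⁻¹ + ((1 + |(x : ℝ) - b| / 2 ^ k) ^ 2)⁻¹) *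
            ((1 + |(m : ℝ) - x / 2 ^ k|) ^ 2)⁻¹ := by
        intro m hm x hx
        have hm' := hMm m hm
        have e : |(m : ℝ) - x / 2 ^ k| = |(x : ℝ) - m * 2 ^ k| / 2 ^ k := by
          rw [abs_sub_comm, ← abs_of_pos hk, ← abs_div, abs_of_pos hk]
          congr 1; field_simp
        rw [wt_eq_sq, e]
        refine mul_le_mul_of_nonneg_right ?_ (by positivity)
        rcases hX' x hx with h | h
        · refine le_add_of_le_of_nonneg (inv_anti₀ (by positivity) ?_) (by positivity)
          have : |(x : ℝ) - a| ≤ |(x : ℝ) - m * 2 ^ k| := by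
            rw [abs_of_nonpos (by linarith), abs_of_nonpos (by linarith [hm'.1])]
            linarith [hm'.1]
          gcongr
        · refine le_add_of_nonneg_of_le (by positivity) (inv_anti₀ (by positivity) ?_)
          have : |(x : ℝ) - b| ≤ |(x : ℝ) - m * 2 ^ k| := by
            rw [abs_of_nonneg (by linarith), abs_of_nonneg (by linarith [hm'.2])]
            linarith [hm'.2]
          gcongr
      rw [Finset.sum_comm]
      calc ∑ x ∈ X, ∑ m ∈ M, wt (x - m * 2 ^ k) k
          ≤ ∑ x ∈ X, (((1 + |(x : ℝ) - a| / 2 ^ k) ^ 2)⁻¹ +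
              ((1 + |(x : ℝ) - b| / 2 ^ k) ^ 2)⁻¹) * (4 * wSum) := by
            refine Finset.sum_le_sum fun x hx => ?_
            refine (Finset.sum_le_sum fun m hm => hpt m hm x hx).trans ?_
            rw [← Finset.mul_sum]
            exact mul_le_mul_of_nonneg_left (sum_quadratic_weight_le _ _) (by positivity)
        _ ≤ (16 * wSum * 2 ^ k + 16 * wSum * 2 ^ k) * (4 * wSum) := by
            rw [← Finset.sum_mul, Finset.sum_add_distrib]
            refine mul_le_mul_of_nonneg_right ?_ (by positivity)
            exact add_le_add (sum_scaled_weight_le _ _ _) (sum_scaled_weight_le _ _ _)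
        _ = _ := by ring)
  refine key.trans ?_
  rw [← Finset.mul_sum]
  have := sum_two_pow_le T.k
  unfold tailC
  calc _ ≤ (2 * 270 + 1) * (128 * wSum ^ 2 * (2 * 2 ^ T.k)) := by gcongr
    _ = _ := by ring

lemma mem_I_abs_sub_pos {P : Tile} {x : ℤ} (hx : x ∈ P.I) : |(x : ℝ) - P.pos| ≤ 2 ^ P.k := by
  rw [Tile.I, Finset.mem_Ico] at hx
  have h1 : (P.m * 2 ^ P.k : ℝ) ≤ x := by exact_mod_cast hx.1
  have h2 : (x : ℝ) ≤ (P.m + 1) * 2 ^ P.k := by exact_mod_cast hx.2.le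
  unfold Tile.pos
  rw [abs_of_nonneg (by linarith)]; linarith

lemma wt_comparable {P Q : Tile} (hk : P.k ≤ Q.k) {x : ℤ} (hx : x ∈ P.I) :
    wt (P.pos - Q.pos) Q.k ≤ 16 * wt (x - Q.pos) Q.k := by
  have h1 := mem_I_abs_sub_pos hx
  have hQ : (0 : ℝ) < 2 ^ Q.k := by positivity
  have h2 : (2 : ℝ) ^ P.k ≤ 2 ^ Q.k := pow_le_pow_right₀ (by norm_num) hk
  have h3 : |(x : ℝ) - Q.pos| ≤ 2 ^ Q.k + |P.pos - Q.pos| := by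
    have := abs_add_le ((x : ℝ) - P.pos) (P.pos - Q.pos)
    rw [sub_add_sub_cancel] at this
    linarith
  have h4 : 1 + |(x : ℝ) - Q.pos| / 2 ^ Q.k ≤ 2 * (1 + |P.pos - Q.pos| / 2 ^ Q.k) := by
    have : |(x : ℝ) - Q.pos| / 2 ^ Q.k ≤ (2 ^ Q.k + |P.pos - Q.pos|) / 2 ^ Q.k := by gcongr
    rw [add_div, div_self hQ.ne'] at this
    have : 0 ≤ |P.pos - Q.pos| / 2 ^ Q.k := by positivity
    linarith
  unfold wt
  rw [← div_eq_mul_inv, le_div_iff₀ (by positivity), inv_mul_le_iff₀ (by positivity)]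
  calc _ ≤ (2 * (1 + |P.pos - Q.pos| / 2 ^ Q.k)) ^ 4 := by gcongr
    _ = _ := by ring

lemma card_I (P : Tile) : (P.I.card : ℝ) = 2 ^ P.k := by
  rw [Tile.I, Int.card_Ico]
  have : (P.m + 1) * 2 ^ P.k - P.m * 2 ^ P.k = ((2 ^ P.k : ℕ) : ℤ) := by push_cast; ring
  rw [this, Int.toNat_natCast]; push_cast; rfl

open Classical in
/-- Overlap of the separated short tiles whose frequencies are near a given long one. -/
lemma overlap_le {σ d : ℤ} (hp : Params σ d) (R : Finset Tile) (Q : Tile) (x : ℤ)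
    (hR : ∀ P ∈ R, Near σ d P Q ∧ P.k + 9 ≤ Q.k ∧ x ∈ P.I)
    (hsep : ∀ P ∈ R, ∀ P' ∈ R, P.k + 9 ≤ P'.k →
      ¬ |P.cen σ d - 2 ^ P.k / 2 ^ P'.k * P'.cen σ d| < 2) : (R.card : ℝ) ≤ 45 := by
  rcases R.eq_empty_or_nonempty with rfl | hne
  · simp
  obtain ⟨P₀, hP₀, hmin⟩ := Finset.exists_min_image R Tile.k hne
  have ratio : ∀ {i j : ℕ}, i + 9 ≤ j → (2 : ℝ) ^ i / 2 ^ j ≤ 1 / 512 := by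
    intro i j hij
    rw [div_le_div_iff₀ (by positivity) (by norm_num)]
    have : (2 : ℝ) ^ i * 2 ^ 9 ≤ 2 ^ j := by
      rw [← pow_add]; exact pow_le_pow_right₀ (by norm_num) hij
    linarith
  have hf : ∀ P ∈ R, |P.cen σ d - 2 ^ P.k / 2 ^ Q.k * Q.cen σ d| < 1 + 1 / 512 := by
    intro P hP
    have := ratio (hR P hP).2.1
    linarith [(hR P hP).1.2]
  have hup : ∀ P ∈ R, P.k ≤ P₀.k + 8 := by
    intro P hP
    by_contra hcon
    have hk : P₀.k + 9 ≤ P.k := by omega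
    refine hsep P₀ hP₀ P hP hk ?_
    have e : P₀.cen σ d - 2 ^ P₀.k / 2 ^ P.k * P.cen σ d =
        (P₀.cen σ d - 2 ^ P₀.k / 2 ^ Q.k * Q.cen σ d) -
        2 ^ P₀.k / 2 ^ P.k * (P.cen σ d - 2 ^ P.k / 2 ^ Q.k * Q.cen σ d) := by
      field_simp; ring
    rw [e]
    refine (abs_sub _ _).trans_lt ?_
    rw [abs_mul, abs_of_pos (by positivity : (0 : ℝ) < 2 ^ P₀.k / 2 ^ P.k)]
    have h1 := ratio hk
    have h2 := hf P hP
    have : 2 ^ P₀.k / 2 ^ P.k * |P.cen σ d - 2 ^ P.k / 2 ^ Q.k * Q.cen σ d| ≤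
        1 / 512 * (1 + 1 / 512) := by gcongr
    have := hf P₀ hP₀
    linarith
  have key := sum_tiles_le σ d hp.ne R (fun _ _ => 1) (fun _ _ => zero_le_one)
    (Finset.Icc P₀.k (P₀.k + 8)) (fun P hP => Finset.mem_Icc.2 ⟨hmin P hP, hup P hP⟩)
    (fun k => 2 ^ k / 2 ^ Q.k * Q.cen σ d) 2 (by norm_num)
    (fun P hP => by have := hf P hP; linarith) (fun _ => 1) (by
      intro k _
      rw [Finset.sum_const, nsmul_eq_mul, mul_one, ← Nat.cast_one, Nat.cast_le]
      rw [Finset.card_le_one]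
      have hm : ∀ m ∈ (R.filter fun P => P.k = k).image Tile.m, m = x / 2 ^ k := by
        intro m hm
        obtain ⟨P, hP, rfl⟩ := Finset.mem_image.1 hm
        obtain ⟨hPR, rfl⟩ := Finset.mem_filter.1 hP
        have hx := (hR P hPR).2.2
        rw [Tile.I, Finset.mem_Ico] at hx
        have h2 : (0 : ℤ) < 2 ^ P.k := by positivity
        refine le_antisymm ?_ ?_
        · exact (Int.le_ediv_iff_mul_le h2).2 hx.1
        · exact Int.lt_add_one_iff.1 ((Int.ediv_lt_iff_lt_mul h2).2 hx.2)
      intro m hm1 m' hm2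
      rw [hm m hm1, hm m' hm2])
  simp only [Finset.sum_const, nsmul_eq_mul, mul_one, Nat.card_Icc] at key
  rw [show P₀.k + 8 + 1 - P₀.k = 9 by omega] at key
  norm_num at key
  exact_mod_cast key

/-- The constant of the long range interaction estimate. -/
noncomputable def longC : ℝ := 16 * 45 * tailC

lemma longC_pos : 0 < longC := by have := tailC_pos; unfold longC; positivity

open Classical in
lemma long_range {σ d : ℤ} (hp : Params σ d) (𝒯 : Finset Top) (A : Top → Finset Tile)
    (hA : ∀ T ∈ 𝒯, ∀ P ∈ A T, InTree P T)
    (hdisj : ∀ T ∈ 𝒯, ∀ T' ∈ 𝒯, T ≠ T' → Disjoint (A T) (A T'))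
    (hsep : ∀ T ∈ 𝒯, ∀ T' ∈ 𝒯, ∀ P ∈ A T, ∀ Q ∈ A T', P.k + 9 ≤ Q.k →
        |P.cen σ d - 2 ^ P.k / 2 ^ Q.k * Q.cen σ d| < 2 → Disjoint P.I T'.I)
    (α : Tile → ℝ) (μ : ℝ) (hα : ∀ P, 0 ≤ α P) (hμ : ∀ T ∈ 𝒯, ∀ P ∈ A T, α P ≤ μ) :
    ∑ Q ∈ 𝒯.biUnion A, ∑ P ∈ 𝒯.biUnion A with Near σ d P Q ∧ P.k + 9 ≤ Q.k,
      2 ^ P.k * α P * α Q * wt (P.pos - Q.pos) Q.k ≤ longC * μ ^ 2 * ∑ T ∈ 𝒯, 2 ^ T.k := by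
  rw [Finset.sum_biUnion (fun T hT T' hT' h => hdisj T hT T' hT' h), Finset.mul_sum]
  refine Finset.sum_le_sum fun T hT => ?_
  set U := 𝒯.biUnion A with hU
  have hmemU : ∀ P ∈ U, ∃ T' ∈ 𝒯, P ∈ A T' := fun P hP => by simpa [hU] using hP
  set X := (U.biUnion Tile.I).filter fun x => x ∉ T.I with hX
  have hXT : Disjoint X T.I := Finset.disjoint_left.2 fun x hx => (Finset.mem_filter.1 hx).2
  have hμ2 : 0 ≤ μ ^ 2 := sq_nonneg _
  have hQ : ∀ Q ∈ A T, ∑ P ∈ U with Near σ d P Q ∧ P.k + 9 ≤ Q.k,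
      2 ^ P.k * α P * α Q * wt (P.pos - Q.pos) Q.k ≤
        μ ^ 2 * 16 * 45 * ∑ x ∈ X, wt (x - Q.pos) Q.k := by
    intro Q hQ
    set R := U.filter fun P => Near σ d P Q ∧ P.k + 9 ≤ Q.k with hR
    have hRm : ∀ P ∈ R, P ∈ U ∧ Near σ d P Q ∧ P.k + 9 ≤ Q.k := fun P hP => by
      simpa [hR] using hP
    have hsmall : ∀ P ∈ R, |P.cen σ d - 2 ^ P.k / 2 ^ Q.k * Q.cen σ d| < 2 := by
      intro P hP
      have h1 := (hRm P hP).2.1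
      have : (2 : ℝ) ^ P.k / 2 ^ Q.k ≤ 1 :=
        div_le_one_of_le₀ (pow_le_pow_right₀ (by norm_num) h1.1) (by positivity)
      linarith [h1.2]
    have hPI : ∀ P ∈ R, P.I ⊆ X := by
      intro P hP x hx
      obtain ⟨T', hT', hPT'⟩ := hmemU P (hRm P hP).1
      have := hsep T' hT' T hT P hPT' Q hQ (hRm P hP).2.2 (hsmall P hP)
      refine Finset.mem_filter.2 ⟨Finset.mem_biUnion.2 ⟨P, (hRm P hP).1, hx⟩, ?_⟩
      exact Finset.disjoint_left.1 this hx
    have h1 : ∀ P ∈ R, 2 ^ P.k * α P * α Q * wt (P.pos - Q.pos) Q.k ≤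
        ∑ x ∈ X, if x ∈ P.I then μ ^ 2 * 16 * wt (x - Q.pos) Q.k else 0 := by
      intro P hP
      obtain ⟨T', hT', hPT'⟩ := hmemU P (hRm P hP).1
      rw [← Finset.sum_filter, Finset.filter_mem_eq_inter, Finset.inter_eq_right.2 (hPI P hP)]
      have hαα : α P * α Q ≤ μ ^ 2 := by
        rw [sq]
        exact mul_le_mul (hμ T' hT' P hPT') (hμ T hT Q hQ) (hα Q)
          ((hα P).trans (hμ T' hT' P hPT'))
      calc 2 ^ P.k * α P * α Q * wt (P.pos - Q.pos) Q.k
          = ∑ x ∈ P.I, α P * α Q * wt (P.pos - Q.pos) Q.k := by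
            rw [Finset.sum_const, nsmul_eq_mul, card_I]; ring
        _ ≤ ∑ x ∈ P.I, μ ^ 2 * (16 * wt (x - Q.pos) Q.k) := by
            refine Finset.sum_le_sum fun x hx => ?_
            exact mul_le_mul hαα (wt_comparable (hRm P hP).2.1.1 hx) (wt_nonneg _ _) hμ2
        _ = _ := by simp only [mul_assoc]
    refine (Finset.sum_le_sum h1).trans ?_
    rw [Finset.sum_comm, Finset.mul_sum]
    refine Finset.sum_le_sum fun x _ => ?_
    rw [← Finset.sum_filter, Finset.sum_const, nsmul_eq_mul]
    have hov : ((R.filter fun P => x ∈ P.I).card : ℝ) ≤ 45 := by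
      refine overlap_le hp _ Q x (fun P hP => ?_) (fun P hP P' hP' hk hn => ?_)
      · obtain ⟨h, h'⟩ := Finset.mem_filter.1 hP
        exact ⟨(hRm P h).2.1, (hRm P h).2.2, h'⟩
      · obtain ⟨h, h'⟩ := Finset.mem_filter.1 hP
        obtain ⟨g, g'⟩ := Finset.mem_filter.1 hP'
        obtain ⟨T₁, hT₁, hPT₁⟩ := hmemU P (hRm P h).1
        obtain ⟨T₂, hT₂, hPT₂⟩ := hmemU P' (hRm P' g).1
        have := hsep T₁ hT₁ T₂ hT₂ P hPT₁ P' hPT₂ hk hn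
        exact Finset.disjoint_left.1 this h' ((hA T₂ hT₂ P' hPT₂).1.subset g')
    have := wt_nonneg (x - Q.pos) Q.k
    calc _ ≤ 45 * (μ ^ 2 * 16 * wt (x - Q.pos) Q.k) :=
          mul_le_mul_of_nonneg_right hov (by positivity)
      _ = _ := by ring
  refine (Finset.sum_le_sum hQ).trans ?_
  rw [← Finset.mul_sum]
  have := tree_tail hp (A T) T (hA T hT) X hXT
  unfold longC
  calc _ ≤ μ ^ 2 * 16 * 45 * (tailC * 2 ^ T.k) := by gcongr
    _ = _ := by ring

open Classical in
/-- The quadratic almost-orthogonality inequality. -/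
def Bes (σ d : ℤ) (α : Tile → ℝ) (E : ℝ) (R : Finset Tile) : Prop :=
  ∀ S ⊆ R, (∑ P ∈ S, 2 ^ P.k * α P ^ 2) ^ 2 ≤
    E * ∑ Q ∈ S, ∑ P ∈ S with Near σ d P Q,
      2 ^ P.k * α P * α Q * wt (P.pos - Q.pos) Q.k

open Classical in
/-- The size of a collection of tiles is at most `v`. -/
def Sized (σ d : ℤ) (Ξ : Finset ℝ) (α : Tile → ℝ) (v : ℝ) (S : Finset Tile) : Prop :=
  ∀ T : Top, T.ξ ∈ Ξ → ∀ ε : ℝ, |ε| = 1 →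
    ∑ P ∈ S with Lac σ d ε P T, 2 ^ P.k * α P ^ 2 ≤ v ^ 2 * 2 ^ T.k

/-- The set of frequencies is large enough for single tiles to be trees. -/
def Rich (Ξ : Finset ℝ) (S : Finset Tile) : Prop :=
  ∀ P ∈ S, ((P.l : ℝ) - 73) / 2 ^ P.k ∈ Ξ ∧ ((P.l : ℝ) + 73) / 2 ^ P.k ∈ Ξ

open Classical in
lemma Sized.mono {σ d : ℤ} {Ξ : Finset ℝ} {α : Tile → ℝ} {v : ℝ} {S S' : Finset Tile}
    (h : Sized σ d Ξ α v S) (hs : S' ⊆ S) : Sized σ d Ξ α v S' := fun T hT ε hε =>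
  (Finset.sum_le_sum_of_subset_of_nonneg (Finset.filter_subset_filter _ hs)
    (fun _ _ _ => by positivity)).trans (h T hT ε hε)

lemma Sized.le {σ d : ℤ} (hp : Params σ d) {Ξ : Finset ℝ} {α : Tile → ℝ} {v : ℝ} (hv : 0 ≤ v)
    {S : Finset Tile} (h : Sized σ d Ξ α v S) (hr : Rich Ξ S) (P : Tile) (hP : P ∈ S) :
    α P ≤ v := by
  classical
  have hk : (0 : ℝ) < 2 ^ P.k := by positivity
  have hd : -(70 : ℝ) ≤ d := by
    have := neg_le_of_abs_le hp.d_le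
    exact_mod_cast this
  have main : ∀ s : ℝ, ((P.l : ℝ) - s) / 2 ^ P.k ∈ Ξ → |s| ≤ 100 → 3 ≤ σ * s + d → α P ≤ v := by
    intro s hs hs1 hs2
    have h1 := h ⟨P.k, P.m, ((P.l : ℝ) - s) / 2 ^ P.k⟩ hs 1 (by simp)
    have e : (P.l : ℝ) - 2 ^ P.k * (((P.l : ℝ) - s) / 2 ^ P.k) = s := by field_simp; ring
    have hl : Lac σ d 1 P ⟨P.k, P.m, ((P.l : ℝ) - s) / 2 ^ P.k⟩ := by
      refine ⟨⟨⟨le_rfl, le_rfl, le_rfl⟩, ?_⟩, ?_⟩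
      · dsimp only; rw [e]; exact hs1
      · rw [cen_sub, e, one_mul]; exact hs2
    have h2 : 2 ^ P.k * α P ^ 2 ≤ v ^ 2 * 2 ^ P.k :=
      (Finset.single_le_sum (f := fun P : Tile => 2 ^ P.k * α P ^ 2)
        (fun _ _ => by positivity) (Finset.mem_filter.2 ⟨hP, hl⟩)).trans h1
    rw [mul_comm] at h2
    exact le_of_sq_le_sq (le_of_mul_le_mul_right h2 hk) hv
  rcases lt_or_gt_of_ne hp.ne with hσ | hσ
  · refine main (-73) ?_ (by norm_num) ?_
    · rw [sub_neg_eq_add]; exact (hr P hP).2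
    · have : (σ : ℝ) ≤ -1 := by exact_mod_cast (by omega : σ ≤ -1)
      linarith
  · refine main 73 (hr P hP).1 (by norm_num) ?_
    have : (1 : ℝ) ≤ σ := by exact_mod_cast hσ
    linarith

/-- The constant of the tree counting estimate. -/
noncomputable def countC : ℝ := schurC + 4 * longC

lemma countC_pos : 0 < countC := by
  have := longC_pos
  have := wSum_pos
  unfold countC schurC; positivity

open Classical in
lemma size_half_step {σ d : ℤ} (hp : Params σ d) (Ξ : Finset ℝ) (α : Tile → ℝ)
    (hα : ∀ P, 0 ≤ α P) (S : Finset Tile) {E v : ℝ} (hE : 0 ≤ E) (hv : 0 < v)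
    (hB : Bes σ d α E S) (hs : ∀ P ∈ S, α P ≤ 2 * v) {ε : ℝ} (hε : |ε| = 1) :
    ∃ 𝒯 : Finset Top, (∀ T ∈ 𝒯, T.ξ ∈ Ξ) ∧ v ^ 2 * ∑ T ∈ 𝒯, 2 ^ T.k ≤ countC * E ∧
      ∀ T : Top, T.ξ ∈ Ξ →
        ∑ P ∈ S with (∀ T' ∈ 𝒯, ¬ InTree P T') ∧ Lac σ d ε P T, 2 ^ P.k * α P ^ 2 ≤
          v ^ 2 * 2 ^ T.k := by
  obtain ⟨𝒯, A, h1, h2, h3, h4, h5, h6⟩ :=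
    select_trees hp hε Ξ α (v ^ 2) (by positivity) S.card S le_rfl
  refine ⟨𝒯, h1, ?_, h6⟩
  set U := 𝒯.biUnion A with hU
  have hUS : U ⊆ S := by
    rw [hU, Finset.biUnion_subset]
    exact fun T hT => (h2 T hT).trans (Finset.filter_subset _ _)
  set X := ∑ P ∈ U, 2 ^ P.k * α P ^ 2 with hX
  have hcount : v ^ 2 * ∑ T ∈ 𝒯, 2 ^ T.k ≤ X := by
    rw [hX, hU, Finset.sum_biUnion (fun T hT T' hT' h => h4 T hT T' hT' h), Finset.mul_sum]
    exact Finset.sum_le_sum fun T hT => (h3 T hT).le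
  have hlong := long_range hp 𝒯 A (fun T hT P hP => (Finset.mem_filter.1 (h2 T hT hP)).2.1)
    h4 h5 α (2 * v) hα (fun T hT P hP => hs P (Finset.mem_filter.1 (h2 T hT hP)).1)
  have hshort := near_scale_schur σ d hp.ne U α
  have hsplit : ∑ Q ∈ U, ∑ P ∈ U with Near σ d P Q,
      2 ^ P.k * α P * α Q * wt (P.pos - Q.pos) Q.k =
      ∑ Q ∈ U, ∑ P ∈ U with Near σ d P Q ∧ Q.k < P.k + 9,
        2 ^ P.k * α P * α Q * wt (P.pos - Q.pos) Q.k +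
      ∑ Q ∈ U, ∑ P ∈ U with Near σ d P Q ∧ P.k + 9 ≤ Q.k,
        2 ^ P.k * α P * α Q * wt (P.pos - Q.pos) Q.k := by
    rw [← Finset.sum_add_distrib]
    refine Finset.sum_congr rfl fun Q _ => ?_
    rw [← Finset.sum_filter_add_sum_filter_not _ (fun P => Q.k < P.k + 9), Finset.filter_filter,
      Finset.filter_filter]
    simp only [not_lt]
  have hb := hB U hUS
  rw [hsplit] at hb
  have hX0 : 0 ≤ X := Finset.sum_nonneg fun _ _ => by positivity
  have hl := longC_pos
  have h7 : X ^ 2 ≤ E * (countC * X) := by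
    refine hb.trans (mul_le_mul_of_nonneg_left ?_ hE)
    unfold countC
    nlinarith [mul_le_mul_of_nonneg_left hcount hl.le]
  have h8 : X ≤ countC * E := by
    rcases hX0.eq_or_lt with h | h
    · rw [← h]; exact mul_nonneg countC_pos.le hE
    · refine le_of_mul_le_mul_right ?_ h
      nlinarith
  exact hcount.trans h8

open Classical in
lemma size_step {σ d : ℤ} (hp : Params σ d) (Ξ : Finset ℝ) (α : Tile → ℝ)
    (hα : ∀ P, 0 ≤ α P) (S : Finset Tile) {E v : ℝ} (hE : 0 ≤ E) (hv : 0 < v)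
    (hB : Bes σ d α E S) (hs : ∀ P ∈ S, α P ≤ 2 * v) :
    ∃ 𝒯 : Finset Top, (∀ T ∈ 𝒯, T.ξ ∈ Ξ) ∧ v ^ 2 * ∑ T ∈ 𝒯, 2 ^ T.k ≤ 2 * countC * E ∧
      Sized σ d Ξ α v (S.filter fun P => ∀ T ∈ 𝒯, ¬ InTree P T) := by
  obtain ⟨𝒯, h1, h2, h3⟩ := size_half_step hp Ξ α hα S hE hv hB hs (ε := 1) (by simp)
  set S' := S.filter fun P => ∀ T ∈ 𝒯, ¬ InTree P T with hS'
  have hS'S : S' ⊆ S := Finset.filter_subset _ _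
  obtain ⟨𝒯', h1', h2', h3'⟩ := size_half_step hp Ξ α hα S' hE hv
    (fun R hR => hB R (hR.trans hS'S)) (fun P hP => hs P (hS'S hP)) (ε := -1) (by simp)
  refine ⟨𝒯 ∪ 𝒯', ?_, ?_, ?_⟩
  · intro T hT
    exact (Finset.mem_union.1 hT).elim (h1 T) (h1' T)
  · have : ∑ T ∈ 𝒯 ∪ 𝒯', (2 : ℝ) ^ T.k ≤ ∑ T ∈ 𝒯, (2 : ℝ) ^ T.k + ∑ T ∈ 𝒯', (2 : ℝ) ^ T.k := by
      rw [← Finset.sum_union_inter]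
      exact le_add_of_nonneg_right (Finset.sum_nonneg fun _ _ => by positivity)
    nlinarith [mul_le_mul_of_nonneg_left this (sq_nonneg v)]
  · intro T hT ε hε
    rcases eq_or_eq_neg_of_abs_eq hε with rfl | rfl
    · refine le_trans (Finset.sum_le_sum_of_subset_of_nonneg ?_ fun _ _ _ => by positivity)
        (h3 T hT)
      intro P
      simp only [Finset.mem_filter, Finset.mem_union]
      exact fun h => ⟨h.1.1, fun T' hT' => h.1.2 T' (Or.inl hT'), h.2⟩
    · refine le_trans (Finset.sum_le_sum_of_subset_of_nonneg ?_ fun _ _ _ => by positivity)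
        (h3' T hT)
      intro P
      simp only [hS', Finset.mem_filter, Finset.mem_union]
      exact fun h => ⟨⟨h.1.1, fun T' hT' => h.1.2 T' (Or.inl hT')⟩,
        fun T' hT' => h.1.2 T' (Or.inr hT'), h.2⟩

open Classical in
/-- Removing few trees reduces the size of a collection of tiles. -/
theorem size_decomposition {σ d : ℤ} (hp : Params σ d) (Ξ : Finset ℝ) (α : Tile → ℝ)
    (hα : ∀ P, 0 ≤ α P) (S : Finset Tile) (hr : Rich Ξ S) {E v : ℝ} (hE : 0 ≤ E) (hv : 0 < v)
    (hB : Bes σ d α E S) :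
    ∃ 𝒯 : Finset Top, (∀ T ∈ 𝒯, T.ξ ∈ Ξ) ∧ v ^ 2 * ∑ T ∈ 𝒯, 2 ^ T.k ≤ 6 * countC * E ∧
      Sized σ d Ξ α v (S.filter fun P => ∀ T ∈ 𝒯, ¬ InTree P T) := by
  have hc := countC_pos
  have main : ∀ (n : ℕ) (R : Finset Tile), R ⊆ S → (∀ P ∈ R, α P ≤ 2 ^ n * (2 * v)) →
      ∃ 𝒯 : Finset Top, (∀ T ∈ 𝒯, T.ξ ∈ Ξ) ∧
        v ^ 2 * ∑ T ∈ 𝒯, 2 ^ T.k ≤ (3 - 2 * (1 / 2) ^ n) * (2 * countC * E) ∧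
        Sized σ d Ξ α v (R.filter fun P => ∀ T ∈ 𝒯, ¬ InTree P T) := by
    intro n
    induction n with
    | zero =>
      intro R hR hs
      obtain ⟨𝒯, h1, h2, h3⟩ := size_step hp Ξ α hα R hE hv (fun Q hQ => hB Q (hQ.trans hR))
        (by simpa using hs)
      exact ⟨𝒯, h1, by norm_num; linarith, h3⟩
    | succ n ih =>
      intro R hR hs
      have hv' : (0 : ℝ) < 2 ^ (n + 1) * v := by positivity
      obtain ⟨𝒯, h1, h2, h3⟩ := size_step hp Ξ α hα R hE hv' (fun Q hQ => hB Q (hQ.trans hR))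
        (fun P hP => by have := hs P hP; linarith)
      set R' := R.filter fun P => ∀ T ∈ 𝒯, ¬ InTree P T with hR'
      have hR'R : R' ⊆ R := Finset.filter_subset _ _
      obtain ⟨𝒯', h1', h2', h3'⟩ := ih R' (hR'R.trans hR) (fun P hP => by
        have := h3.le hp hv'.le (fun Q hQ => hr Q (hR (hR'R hQ))) P hP
        rw [pow_succ] at this; linarith)
      refine ⟨𝒯 ∪ 𝒯', ?_, ?_, ?_⟩
      · intro T hT
        exact (Finset.mem_union.1 hT).elim (h1 T) (h1' T)
      · have h4 : ∑ T ∈ 𝒯 ∪ 𝒯', (2 : ℝ) ^ T.k ≤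
            ∑ T ∈ 𝒯, (2 : ℝ) ^ T.k + ∑ T ∈ 𝒯', (2 : ℝ) ^ T.k := by
          rw [← Finset.sum_union_inter]
          exact le_add_of_nonneg_right (Finset.sum_nonneg fun _ _ => by positivity)
        have h5 := mul_le_mul_of_nonneg_left h4 (sq_nonneg v)
        set x := ∑ T ∈ 𝒯, (2 : ℝ) ^ T.k
        have hq : (0 : ℝ) ≤ (1 / 2) ^ (n + 1) := by positivity
        have hq1 : ((1 / 2 : ℝ)) ^ (n + 1) ≤ 1 := pow_le_one₀ (by norm_num) (by norm_num)
        have h6 : v ^ 2 * x ≤ (1 / 2) ^ (n + 1) * (2 * countC * E) := by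
          have e : ((1 / 2 : ℝ) ^ (n + 1)) * 2 ^ (n + 1) = 1 := by
            rw [← mul_pow]; norm_num
          have h7 : v ^ 2 * x = ((1 / 2 : ℝ) ^ (n + 1)) ^ 2 * ((2 ^ (n + 1) * v) ^ 2 * x) := by
            rw [mul_pow (2 ^ (n + 1)), ← mul_assoc, ← mul_assoc, ← mul_pow, e]; ring
          rw [h7]
          have h8 : ((1 / 2 : ℝ) ^ (n + 1)) ^ 2 * ((2 ^ (n + 1) * v) ^ 2 * x) ≤
              ((1 / 2 : ℝ) ^ (n + 1)) ^ 2 * (2 * countC * E) := by gcongr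
          refine h8.trans (mul_le_mul_of_nonneg_right ?_ (by positivity))
          nlinarith
        have e2 : (1 / 2 : ℝ) ^ n = 2 * (1 / 2) ^ (n + 1) := by rw [pow_succ]; ring
        rw [e2] at h2'
        have h9 : 0 ≤ (1 / 2) ^ (n + 1) * (2 * countC * E) := by positivity
        rw [mul_add] at h5
        linarith
      · refine h3'.mono fun P => ?_
        simp only [hR', Finset.mem_filter, Finset.mem_union]
        exact fun h => ⟨⟨h.1, fun T hT => h.2 T (Or.inl hT)⟩, fun T hT => h.2 T (Or.inr hT)⟩
  obtain ⟨n, hn⟩ := pow_unbounded_of_one_lt ((∑ P ∈ S, α P) / (2 * v)) (one_lt_two (α := ℝ))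
  obtain ⟨𝒯, h1, h2, h3⟩ := main n S le_rfl (fun P hP => by
    rw [div_lt_iff₀ (by positivity)] at hn
    exact (Finset.single_le_sum (fun Q _ => hα Q) hP).trans hn.le)
  refine ⟨𝒯, h1, h2.trans ?_, h3⟩
  have : (0 : ℝ) ≤ (1 / 2) ^ n := by positivity
  have : 0 ≤ 2 * countC * E := by positivity
  nlinarith

/-- A family of wave packets adapted to the components of tiles. -/
structure IsPacket (σ d : ℤ) (B : ℝ) (R : Finset Tile) (φ : Tile → ℤ → ℂ) : Prop where
  decay : ∀ P ∈ R, ∀ x : ℤ, ‖φ P x‖ ≤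
    B * (2 ^ P.k)⁻¹ * (wt (x - P.pos) P.k * ((1 + |x - P.pos| / 2 ^ P.k) ^ 2)⁻¹)
  orth : ∀ P ∈ R, ∀ Q ∈ R, ¬ Near σ d P Q → ¬ Near σ d Q P →
    ∑' x : ℤ, φ P x * starRingEnd ℂ (φ Q x) = 0

lemma wt_mul_le {p q x : ℝ} {i j : ℕ} (h : i ≤ j) :
    wt (x - p) i * wt (x - q) j ≤ wt (p - q) j := by
  have h2 : (2 : ℝ) ^ i ≤ 2 ^ j := pow_le_pow_right₀ (by norm_num) h
  have hi : (0 : ℝ) < 2 ^ i := by positivity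
  have hj : (0 : ℝ) < 2 ^ j := by positivity
  unfold wt
  rw [← mul_inv, ← mul_pow]
  refine inv_anti₀ (by positivity) (pow_le_pow_left₀ (by positivity) ?_ 4)
  have h3 : |p - q| ≤ |x - p| + |x - q| := by
    have := abs_sub_le p x q
    rw [abs_sub_comm p x] at this; exact this
  have h4 : |p - q| / 2 ^ j ≤ |x - p| / 2 ^ i + |x - q| / 2 ^ j := by
    calc |p - q| / 2 ^ j ≤ (|x - p| + |x - q|) / 2 ^ j := by gcongr
      _ = |x - p| / 2 ^ j + |x - q| / 2 ^ j := add_div _ _ _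
      _ ≤ _ := by gcongr
  have h5 : 0 ≤ |x - p| / 2 ^ i * (|x - q| / 2 ^ j) := by positivity
  nlinarith

lemma IsPacket.gram {σ d : ℤ} {B : ℝ} (hB : 0 ≤ B) {R : Finset Tile} {φ : Tile → ℤ → ℂ}
    (h : IsPacket σ d B R φ) {P Q : Tile} (hP : P ∈ R) (hQ : Q ∈ R) (hk : P.k ≤ Q.k) :
    Summable (fun x : ℤ => ‖φ P x‖ * ‖φ Q x‖) ∧
    ∑' x : ℤ, ‖φ P x‖ * ‖φ Q x‖ ≤
      16 * wSum * B ^ 2 * ((2 ^ Q.k)⁻¹ * wt (P.pos - Q.pos) Q.k) := by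
  have hpt : ∀ x : ℤ, ‖φ P x‖ * ‖φ Q x‖ ≤
      B ^ 2 * (2 ^ P.k)⁻¹ * ((2 ^ Q.k)⁻¹ * wt (P.pos - Q.pos) Q.k) *
        ((1 + |x - P.pos| / 2 ^ P.k) ^ 2)⁻¹ := by
    intro x
    have h1 := h.decay P hP x
    have h2 : ‖φ Q x‖ ≤ B * (2 ^ Q.k)⁻¹ * wt (x - Q.pos) Q.k := by
      refine (h.decay Q hQ x).trans (mul_le_mul_of_nonneg_left ?_ (by positivity))
      exact mul_le_of_le_one_right (wt_nonneg _ _) (quad_le_one _ (by positivity))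
    have h3 := wt_mul_le (p := P.pos) (q := Q.pos) (x := x) hk
    have w1 := wt_nonneg (x - P.pos) P.k
    calc ‖φ P x‖ * ‖φ Q x‖ ≤ (B * (2 ^ P.k)⁻¹ * (wt (x - P.pos) P.k *
          ((1 + |x - P.pos| / 2 ^ P.k) ^ 2)⁻¹)) * (B * (2 ^ Q.k)⁻¹ * wt (x - Q.pos) Q.k) := by
          gcongr
      _ = B ^ 2 * (2 ^ P.k)⁻¹ * (2 ^ Q.k)⁻¹ * ((1 + |x - P.pos| / 2 ^ P.k) ^ 2)⁻¹ *
          (wt (x - P.pos) P.k * wt (x - Q.pos) Q.k) := by ring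
      _ ≤ B ^ 2 * (2 ^ P.k)⁻¹ * (2 ^ Q.k)⁻¹ * ((1 + |x - P.pos| / 2 ^ P.k) ^ 2)⁻¹ *
          wt (P.pos - Q.pos) Q.k := by gcongr
      _ = _ := by ring
  have hsum : ∀ X : Finset ℤ, ∑ x ∈ X, ‖φ P x‖ * ‖φ Q x‖ ≤
      16 * wSum * B ^ 2 * ((2 ^ Q.k)⁻¹ * wt (P.pos - Q.pos) Q.k) := by
    intro X
    refine (Finset.sum_le_sum fun x _ => hpt x).trans ?_
    rw [← Finset.mul_sum]
    have := wt_nonneg (P.pos - Q.pos) Q.k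
    refine (mul_le_mul_of_nonneg_left (sum_scaled_weight_le X P.pos P.k) (by positivity)).trans
      (le_of_eq ?_)
    field_simp
  have hs := summable_of_sum_le (fun x => by positivity) hsum
  exact ⟨hs, hs.tsum_le_of_sum_le hsum⟩

section

variable {H : Type*} [NormedAddCommGroup H] [InnerProductSpace ℂ H]

/-- The size of a wave packet coefficient. -/
noncomputable def coef (φ : Tile → ℤ → ℂ) (s : Finset ℤ) (f : ℤ → H) (P : Tile) : ℝ :=
  ‖∑ x ∈ s, φ P x • f x‖

lemma coef_nonneg (φ : Tile → ℤ → ℂ) (s : Finset ℤ) (f : ℤ → H) (P : Tile) :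
    0 ≤ coef φ s f P := norm_nonneg _

/-- The constant of the Bessel inequality. -/
noncomputable def besC (B : ℝ) : ℝ := 32 * wSum * B ^ 2

lemma besC_nonneg (B : ℝ) : 0 ≤ besC B := by have := wSum_pos; unfold besC; positivity

open Classical in
theorem IsPacket.bes {σ d : ℤ} {B : ℝ} (hB : 0 ≤ B) {R : Finset Tile} {φ : Tile → ℤ → ℂ}
    (h : IsPacket σ d B R φ) (s : Finset ℤ) (f : ℤ → H) :
    Bes σ d (coef φ s f) (besC B * ∑ x ∈ s, ‖f x‖ ^ 2) R := by
  intro S hS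
  set α := coef φ s f with hα
  have hα0 : ∀ P, 0 ≤ α P := coef_nonneg φ s f
  have hw := wSum_pos
  set v : Tile → H := fun P => ∑ x ∈ s, φ P x • f x with hv
  set u : Tile → H := fun P => ((‖v P‖ : ℂ)⁻¹) • v P with hu
  have hu1 : ∀ P, ‖u P‖ ≤ 1 := by
    intro P
    rw [hu]; simp only [norm_smul, norm_inv, Complex.norm_real, norm_norm]
    exact inv_mul_le_one
  have huv : ∀ P, inner ℂ (u P) (v P) = (α P : ℂ) := by
    intro P
    simp only [hu, inner_smul_left, inner_self_eq_norm_sq_to_K, map_inv₀, Complex.conj_ofReal]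
    change _ = ((‖v P‖ : ℝ) : ℂ)
    by_cases hz : ‖v P‖ = 0
    · simp [hz]
    · have : ((‖v P‖ : ℝ) : ℂ) ≠ 0 := by exact_mod_cast hz
      simp only [Complex.coe_algebraMap]
      field_simp
  set w : ℤ → H := fun x => ∑ P ∈ S, ((2 ^ P.k * α P : ℝ) * starRingEnd ℂ (φ P x)) • u P with hw'
  set X := ∑ P ∈ S, 2 ^ P.k * α P ^ 2 with hX
  have hX0 : 0 ≤ X := Finset.sum_nonneg fun _ _ => by positivity
  have hXeq : ((X : ℝ) : ℂ) = ∑ x ∈ s, inner ℂ (w x) (f x) := by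
    have e1 : ∀ x, inner ℂ (w x) (f x) = ∑ P ∈ S, (2 ^ P.k * α P : ℝ) *
        inner ℂ (u P) (φ P x • f x) := by
      intro x
      rw [hw']; simp only [sum_inner, inner_smul_left, inner_smul_right, map_mul,
        Complex.conj_ofReal, Complex.conj_conj]
      exact Finset.sum_congr rfl fun P _ => by ring
    simp only [e1]
    rw [Finset.sum_comm]
    simp only [← Finset.mul_sum, ← inner_sum]
    rw [hX]; push_cast
    refine Finset.sum_congr rfl fun P _ => ?_
    have := huv P
    rw [hv] at this
    simp only at this
    rw [this]; ring
  have hCS : X ^ 2 ≤ (∑ x ∈ s, ‖w x‖ ^ 2) * ∑ x ∈ s, ‖f x‖ ^ 2 := by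
    have h1 : X ≤ ∑ x ∈ s, ‖w x‖ * ‖f x‖ := by
      calc X = ‖((X : ℝ) : ℂ)‖ := by rw [Complex.norm_real, Real.norm_of_nonneg hX0]
        _ ≤ ∑ x ∈ s, ‖inner ℂ (w x) (f x)‖ := by rw [hXeq]; exact norm_sum_le _ _
        _ ≤ _ := Finset.sum_le_sum fun x _ => norm_inner_le_norm _ _
    calc X ^ 2 ≤ (∑ x ∈ s, ‖w x‖ * ‖f x‖) ^ 2 := by gcongr
      _ ≤ _ := Finset.sum_mul_sq_le_sq_mul_sq _ _ _
  have hsumm : ∀ P ∈ S, ∀ Q ∈ S, Summable fun x : ℤ => ‖φ P x‖ * ‖φ Q x‖ := by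
    intro P hP Q hQ
    rcases le_total P.k Q.k with hk | hk
    · exact (h.gram hB (hS hP) (hS hQ) hk).1
    · refine (h.gram hB (hS hQ) (hS hP) hk).1.congr fun x => mul_comm _ _
  have hsummC : ∀ P ∈ S, ∀ Q ∈ S, Summable fun x : ℤ => φ P x * starRingEnd ℂ (φ Q x) := by
    intro P hP Q hQ
    refine Summable.of_norm ((hsumm P hP Q hQ).congr fun x => ?_)
    rw [norm_mul, RCLike.norm_conj]
  have hwx : ∀ x, ((‖w x‖ ^ 2 : ℝ) : ℂ) = ∑ P ∈ S, ∑ Q ∈ S,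
      ((2 ^ P.k * α P : ℝ) * (2 ^ Q.k * α Q : ℝ) * inner ℂ (u P) (u Q)) *
        (φ P x * starRingEnd ℂ (φ Q x)) := by
    intro x
    have : ((‖w x‖ ^ 2 : ℝ) : ℂ) = inner ℂ (w x) (w x) := by
      rw [inner_self_eq_norm_sq_to_K]; push_cast; rfl
    rw [this, hw']
    simp only [sum_inner, inner_sum, inner_smul_left, inner_smul_right, map_mul,
        Complex.conj_ofReal, Complex.conj_conj]
    rw [Finset.sum_comm]
    refine Finset.sum_congr rfl fun P _ => ?_
    rw [Finset.mul_sum]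
    exact Finset.sum_congr rfl fun Q _ => by ring
  have hHS : HasSum (fun x => ((‖w x‖ ^ 2 : ℝ) : ℂ)) (∑ P ∈ S, ∑ Q ∈ S,
      ((2 ^ P.k * α P : ℝ) * (2 ^ Q.k * α Q : ℝ) * inner ℂ (u P) (u Q)) *
        ∑' x, (φ P x * starRingEnd ℂ (φ Q x))) := by
    simp only [hwx]
    exact hasSum_sum fun P hP => hasSum_sum fun Q hQ => (hsummC P hP Q hQ).hasSum.mul_left _
  have hsw : Summable fun x => ‖w x‖ ^ 2 := Complex.summable_ofReal.1 hHS.summable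
  set c : Tile → Tile → ℝ := fun P Q => 2 ^ P.k * α P * α Q * wt (P.pos - Q.pos) Q.k with hc
  have hc0 : ∀ P Q, 0 ≤ c P Q := fun P Q => mul_nonneg (mul_nonneg (mul_nonneg (by positivity)
    (hα0 P)) (hα0 Q)) (wt_nonneg _ _)
  have hone : ∀ P ∈ S, ∀ Q ∈ S, Near σ d P Q → 2 ^ P.k * α P * (2 ^ Q.k * α Q) *
      ∑' x : ℤ, ‖φ P x‖ * ‖φ Q x‖ ≤ 16 * wSum * B ^ 2 * c P Q := by
    intro P hP Q hQ hn
    have h1 := (h.gram hB (hS hP) (hS hQ) hn.1).2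
    have := hα0 P
    have := hα0 Q
    calc _ ≤ 2 ^ P.k * α P * (2 ^ Q.k * α Q) * (16 * wSum * B ^ 2 *
          ((2 ^ Q.k)⁻¹ * wt (P.pos - Q.pos) Q.k)) := by gcongr
      _ = _ := by rw [hc]; field_simp
  have hterm : ∀ P ∈ S, ∀ Q ∈ S, ‖((2 ^ P.k * α P : ℝ) * (2 ^ Q.k * α Q : ℝ) *
      inner ℂ (u P) (u Q) : ℂ) * ∑' x, (φ P x * starRingEnd ℂ (φ Q x))‖ ≤
      16 * wSum * B ^ 2 * ((if Near σ d P Q then c P Q else 0) +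
        (if Near σ d Q P then c Q P else 0)) := by
    intro P hP Q hQ
    have hpQ : 0 ≤ 2 ^ P.k * α P * (2 ^ Q.k * α Q) := by
      have := hα0 P
      have := hα0 Q
      positivity
    have hb : ‖((2 ^ P.k * α P : ℝ) * (2 ^ Q.k * α Q : ℝ) *
        inner ℂ (u P) (u Q) : ℂ) * ∑' x, (φ P x * starRingEnd ℂ (φ Q x))‖ ≤
        2 ^ P.k * α P * (2 ^ Q.k * α Q) * ∑' x : ℤ, ‖φ P x‖ * ‖φ Q x‖ := by
      rw [norm_mul, norm_mul, ← Complex.ofReal_mul, Complex.norm_real,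
        Real.norm_of_nonneg hpQ, mul_assoc]
      refine mul_le_mul_of_nonneg_left ?_ hpQ
      have h1 : ‖inner ℂ (u P) (u Q)‖ ≤ 1 := (norm_inner_le_norm _ _).trans
        (mul_le_one₀ (hu1 P) (norm_nonneg _) (hu1 Q))
      refine (mul_le_of_le_one_left (norm_nonneg _) h1).trans ?_
      have h2 : ∀ x, ‖φ P x * starRingEnd ℂ (φ Q x)‖ = ‖φ P x‖ * ‖φ Q x‖ := fun x => by
        rw [norm_mul, RCLike.norm_conj]
      refine (norm_tsum_le_tsum_norm ?_).trans (le_of_eq (tsum_congr h2))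
      exact (hsumm P hP Q hQ).congr fun x => (h2 x).symm
    by_cases h1 : Near σ d P Q
    · rw [if_pos h1]
      refine (hb.trans (hone P hP Q hQ h1)).trans (mul_le_mul_of_nonneg_left ?_ (by positivity))
      refine le_add_of_nonneg_right ?_
      split_ifs
      · exact hc0 _ _
      · exact le_rfl
    · by_cases h2 : Near σ d Q P
      · rw [if_neg h1, if_pos h2, zero_add]
        refine hb.trans (le_trans (le_of_eq ?_) (hone Q hQ P hP h2))
        simp only [mul_comm ‖φ P _‖]; ring
      · rw [h.orth P (hS hP) Q (hS hQ) h1 h2, if_neg h1, if_neg h2]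
        simp
  have hsum_w : ∑ x ∈ s, ‖w x‖ ^ 2 ≤ besC B * ∑ Q ∈ S, ∑ P ∈ S with Near σ d P Q, c P Q := by
    have h1 : ∑ x ∈ s, ‖w x‖ ^ 2 ≤ ∑' x, ‖w x‖ ^ 2 :=
      hsw.sum_le_tsum s fun _ _ => by positivity
    have h2 : ∑' x, ‖w x‖ ^ 2 = ‖∑' x, ((‖w x‖ ^ 2 : ℝ) : ℂ)‖ := by
      rw [← Complex.ofReal_tsum, Complex.norm_real, Real.norm_of_nonneg]
      exact tsum_nonneg fun _ => by positivity
    rw [h2, hHS.tsum_eq] at h1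
    refine h1.trans ((norm_sum_le _ _).trans ?_)
    refine (Finset.sum_le_sum fun P hP => (norm_sum_le _ _).trans
      (Finset.sum_le_sum fun Q hQ => hterm P hP Q hQ)).trans (le_of_eq ?_)
    simp only [← Finset.mul_sum, Finset.sum_add_distrib]
    have e1 : ∑ P ∈ S, ∑ Q ∈ S, (if Near σ d P Q then c P Q else 0) =
        ∑ Q ∈ S, ∑ P ∈ S with Near σ d P Q, c P Q := by
      rw [Finset.sum_comm]; simp only [Finset.sum_filter]
    have e2 : ∑ P ∈ S, ∑ Q ∈ S, (if Near σ d Q P then c Q P else 0) =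
        ∑ Q ∈ S, ∑ P ∈ S with Near σ d P Q, c P Q := by
      simp only [Finset.sum_filter]
    rw [e1, e2]; unfold besC; ring
  refine hCS.trans ?_
  calc _ ≤ (besC B * ∑ Q ∈ S, ∑ P ∈ S with Near σ d P Q, c P Q) * ∑ x ∈ s, ‖f x‖ ^ 2 := by
        gcongr
    _ = _ := by ring

/-- The constant of the size estimate for bounded functions. -/
noncomputable def sizeC (B : ℝ) : ℝ := 1 + 2 * (besC B * schurC + 16 * wSum * B ^ 2 * tailC)

lemma sizeC_pos (B : ℝ) : 0 < sizeC B := by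
  have := wSum_pos
  have := besC_nonneg B
  have := tailC_pos
  unfold sizeC schurC; positivity

lemma coef_split [DecidableEq ℤ] (φ : Tile → ℤ → ℂ) (s : Finset ℤ) (p : ℤ → Prop)
    [DecidablePred p] (f : ℤ → H) (P : Tile) :
    coef φ s f P ^ 2 ≤ 2 * coef φ (s.filter p) f P ^ 2 +
      2 * coef φ (s.filter fun x => ¬ p x) f P ^ 2 := by
  unfold coef
  rw [← Finset.sum_filter_add_sum_filter_not s p]
  have := norm_add_le (∑ x ∈ s.filter p, φ P x • f x) (∑ x ∈ s.filter fun x => ¬ p x, φ P x • f x)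
  have h2 := pow_le_pow_left₀ (norm_nonneg _) this 2
  nlinarith [sq_nonneg (‖∑ x ∈ s.filter p, φ P x • f x‖ -
    ‖∑ x ∈ s.filter fun x => ¬ p x, φ P x • f x‖)]

open Classical in
theorem IsPacket.sized_of_bounded {σ d : ℤ} (hp : Params σ d) {B : ℝ} (hB : 0 ≤ B)
    {R : Finset Tile} {φ : Tile → ℤ → ℂ} (h : IsPacket σ d B R φ) (s : Finset ℤ) (f : ℤ → H)
    {Λ : ℝ} (hf : ∀ x ∈ s, ‖f x‖ ≤ Λ) (Ξ : Finset ℝ) :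
    Sized σ d Ξ (coef φ s f) (√(sizeC B) * Λ) R := by
  intro T _ ε hε
  have hw := wSum_pos
  have hbC := besC_nonneg B
  set A := R.filter fun P => Lac σ d ε P T with hA
  have hAm : ∀ P ∈ A, P ∈ R ∧ Lac σ d ε P T := fun P hP => by simpa [hA] using hP
  set α₁ := coef φ (s.filter fun x => x ∈ T.I) f with hα₁
  set α₂ := coef φ (s.filter fun x => ¬ x ∈ T.I) f with hα₂
  have h1 : ∑ P ∈ A, 2 ^ P.k * α₁ P ^ 2 ≤ besC B * schurC * Λ ^ 2 * 2 ^ T.k := by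
    have hb := h.bes hB (s.filter fun x => x ∈ T.I) f A (Finset.filter_subset _ _)
    have hE : ∑ x ∈ s.filter fun x => x ∈ T.I, ‖f x‖ ^ 2 ≤ 2 ^ T.k * Λ ^ 2 := by
      have hc : ((s.filter fun x => x ∈ T.I).card : ℝ) ≤ 2 ^ T.k := by
        rw [← card_I ⟨T.k, 0, T.m⟩]
        refine Nat.cast_le.2 (Finset.card_le_card fun x hx => (Finset.mem_filter.1 hx).2)
      calc _ ≤ ∑ x ∈ s.filter fun x => x ∈ T.I, Λ ^ 2 := Finset.sum_le_sum fun x hx =>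
            pow_le_pow_left₀ (norm_nonneg _) (hf x (Finset.mem_filter.1 hx).1) 2
        _ ≤ _ := by rw [Finset.sum_const, nsmul_eq_mul]; gcongr
    have hnear : ∑ Q ∈ A, ∑ P ∈ A with Near σ d P Q,
        2 ^ P.k * α₁ P * α₁ Q * wt (P.pos - Q.pos) Q.k ≤
        schurC * ∑ P ∈ A, 2 ^ P.k * α₁ P ^ 2 := by
      refine le_trans (le_of_eq ?_) (near_scale_schur σ d hp.ne A α₁)
      refine Finset.sum_congr rfl fun Q hQ => ?_
      refine Finset.sum_congr (Finset.filter_congr fun P hP => ?_) fun _ _ => rfl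
      refine (and_iff_left_of_imp fun hn => ?_).symm
      by_contra hcon
      have hlt : |P.cen σ d - 2 ^ P.k / 2 ^ Q.k * Q.cen σ d| < 2 := by
        have : (2 : ℝ) ^ P.k / 2 ^ Q.k ≤ 1 :=
          div_le_one_of_le₀ (pow_le_pow_right₀ (by norm_num) hn.1) (by positivity)
        linarith [hn.2]
      have h3 := hp.near_top (hAm Q hQ).2.1 (by omega) hlt
      have h4 := (hAm P hP).2.2
      have h5 := le_abs_self (ε * (P.cen σ d - σ * 2 ^ P.k * T.ξ))
      rw [abs_mul, hε, one_mul] at h5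
      linarith
    set X := ∑ P ∈ A, 2 ^ P.k * α₁ P ^ 2 with hX
    have hX0 : 0 ≤ X := Finset.sum_nonneg fun _ _ => by positivity
    have hs : 0 ≤ schurC := by unfold schurC; positivity
    have h6 : X ^ 2 ≤ besC B * (2 ^ T.k * Λ ^ 2) * (schurC * X) := by
      refine hb.trans (mul_le_mul (by gcongr) hnear ?_ (by positivity))
      exact Finset.sum_nonneg fun Q _ => Finset.sum_nonneg fun P _ =>
        mul_nonneg (mul_nonneg (mul_nonneg (by positivity) (coef_nonneg _ _ _ _))
          (coef_nonneg _ _ _ _)) (wt_nonneg _ _)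
    rcases hX0.eq_or_lt with h0 | h0
    · rw [← h0]; positivity
    · refine le_of_mul_le_mul_right ?_ h0
      nlinarith
  have h2 : ∑ P ∈ A, 2 ^ P.k * α₂ P ^ 2 ≤ 16 * wSum * B ^ 2 * tailC * Λ ^ 2 * 2 ^ T.k := by
    set X := s.filter fun x => ¬ x ∈ T.I with hX
    have hXT : Disjoint X T.I := Finset.disjoint_left.2 fun x hx => (Finset.mem_filter.1 hx).2
    have ht := tree_tail hp A T (fun Q hQ => (hAm Q hQ).2.1) X hXT
    have hpt : ∀ P ∈ A, 2 ^ P.k * α₂ P ^ 2 ≤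
        16 * wSum * B ^ 2 * Λ ^ 2 * ∑ x ∈ X, wt (x - P.pos) P.k := by
      intro P hP
      have hw0 : 0 ≤ ∑ x ∈ X, wt (x - P.pos) P.k := Finset.sum_nonneg fun _ _ => wt_nonneg _ _
      have ha : α₂ P ≤ B * (2 ^ P.k)⁻¹ * Λ * ∑ x ∈ X, wt (x - P.pos) P.k := by
        rw [hα₂, coef, Finset.mul_sum]
        refine (norm_sum_le _ _).trans (Finset.sum_le_sum fun x hx => ?_)
        rw [norm_smul]
        have h3 : ‖φ P x‖ ≤ B * (2 ^ P.k)⁻¹ * wt (x - P.pos) P.k := by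
          refine (h.decay P (hAm P hP).1 x).trans (mul_le_mul_of_nonneg_left ?_ (by positivity))
          exact mul_le_of_le_one_right (wt_nonneg _ _) (quad_le_one _ (by positivity))
        have h4 := hf x (Finset.mem_filter.1 hx).1
        have := wt_nonneg (x - P.pos) P.k
        calc _ ≤ B * (2 ^ P.k)⁻¹ * wt (x - P.pos) P.k * Λ := by gcongr
          _ = _ := by ring
      have hb : ∑ x ∈ X, wt (x - P.pos) P.k ≤ 16 * wSum * 2 ^ P.k :=
        (Finset.sum_le_sum fun x _ => wt_le_quad _ _).trans (sum_scaled_weight_le X P.pos P.k)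
      set W := ∑ x ∈ X, wt (x - P.pos) P.k
      calc 2 ^ P.k * α₂ P ^ 2 ≤ 2 ^ P.k * (B * (2 ^ P.k)⁻¹ * Λ * W) ^ 2 := by
            have := coef_nonneg φ X f P
            gcongr
        _ = B ^ 2 * Λ ^ 2 * (2 ^ P.k)⁻¹ * W * W := by field_simp
        _ ≤ B ^ 2 * Λ ^ 2 * (2 ^ P.k)⁻¹ * (16 * wSum * 2 ^ P.k) * W := by gcongr
        _ = _ := by field_simp
    refine (Finset.sum_le_sum hpt).trans ?_
    rw [← Finset.mul_sum]
    calc _ ≤ 16 * wSum * B ^ 2 * Λ ^ 2 * (tailC * 2 ^ T.k) := by gcongr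
      _ = _ := by ring
  have h3 : ∑ P ∈ A, 2 ^ P.k * coef φ s f P ^ 2 ≤
      2 * ∑ P ∈ A, 2 ^ P.k * α₁ P ^ 2 + 2 * ∑ P ∈ A, 2 ^ P.k * α₂ P ^ 2 := by
    rw [Finset.mul_sum, Finset.mul_sum, ← Finset.sum_add_distrib]
    refine Finset.sum_le_sum fun P _ => ?_
    have := coef_split φ s (fun x => x ∈ T.I) f P
    have h2k : (0 : ℝ) < 2 ^ P.k := by positivity
    nlinarith
  rw [mul_pow, Real.sq_sqrt (sizeC_pos B).le]
  unfold sizeC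
  have : 0 ≤ Λ ^ 2 * 2 ^ T.k := by positivity
  nlinarith

open Classical in
/-- The generalized Carleson embedding: good tiles away from few trees. -/
theorem IsPacket.embedding {σ d : ℤ} (hp : Params σ d) {B : ℝ} (hB : 0 ≤ B)
    {R : Finset Tile} {φ : Tile → ℤ → ℂ} (h : IsPacket σ d B R φ) (s : Finset ℤ) (f : ℤ → H)
    (Ξ : Finset ℝ) (hr : Rich Ξ R) {v : ℝ} (hv : 0 < v) :
    ∃ 𝒯 : Finset Top, (∀ T ∈ 𝒯, T.ξ ∈ Ξ) ∧
      v ^ 2 * ∑ T ∈ 𝒯, 2 ^ T.k ≤ 24 * countC * besC B *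
        ∑ x ∈ s with v / (2 * √(sizeC B)) < ‖f x‖, ‖f x‖ ^ 2 ∧
      Sized σ d Ξ (coef φ s f) v (R.filter fun P => ∀ T ∈ 𝒯, ¬ InTree P T) := by
  have hsq : 0 < √(sizeC B) := Real.sqrt_pos.2 (sizeC_pos B)
  set Λ := v / (2 * √(sizeC B)) with hΛ
  have hΛ0 : 0 < Λ := by positivity
  set s₁ := s.filter fun x => Λ < ‖f x‖ with hs₁
  set s₂ := s.filter fun x => ¬ Λ < ‖f x‖ with hs₂
  have hE : 0 ≤ besC B * ∑ x ∈ s₁, ‖f x‖ ^ 2 :=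
    mul_nonneg (besC_nonneg B) (Finset.sum_nonneg fun _ _ => by positivity)
  obtain ⟨𝒯, h1, h2, h3⟩ := size_decomposition hp Ξ (coef φ s₁ f) (coef_nonneg _ _ _) R hr hE
    (half_pos hv) (h.bes hB s₁ f)
  refine ⟨𝒯, h1, by rw [div_pow] at h2; linarith, ?_⟩
  have h4 := (h.sized_of_bounded hp hB s₂ f
    (fun x hx => not_lt.1 (Finset.mem_filter.1 hx).2) Ξ).mono
    (Finset.filter_subset (fun P => ∀ T ∈ 𝒯, ¬ InTree P T) R)
  have e : √(sizeC B) * Λ = v / 2 := by rw [hΛ]; field_simp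
  rw [e] at h4
  intro T hT ε hε
  have h5 := h3 T hT ε hε
  have h6 := h4 T hT ε hε
  set A := (R.filter fun P => ∀ T ∈ 𝒯, ¬ InTree P T).filter fun P => Lac σ d ε P T
  have h7 : ∑ P ∈ A, 2 ^ P.k * coef φ s f P ^ 2 ≤
      2 * ∑ P ∈ A, 2 ^ P.k * coef φ s₁ f P ^ 2 + 2 * ∑ P ∈ A, 2 ^ P.k * coef φ s₂ f P ^ 2 := by
    rw [Finset.mul_sum, Finset.mul_sum, ← Finset.sum_add_distrib]
    refine Finset.sum_le_sum fun P _ => ?_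
    have := coef_split φ s (fun x => Λ < ‖f x‖) f P
    have h2k : (0 : ℝ) < 2 ^ P.k := by positivity
    nlinarith
  rw [div_pow] at h5 h6
  linarith

end

lemma exists_geom_bound (θ : ℝ) (hθ : 0 < θ) : ∃ C : ℝ, 0 < C ∧ ∀ Y : ℝ, 0 < Y →
    ∀ N : Finset ℤ, (∀ n ∈ N, (2 : ℝ) ^ (n : ℝ) < Y) →
      ∑ n ∈ N, (2 : ℝ) ^ ((n : ℝ) * θ) ≤ C * Y ^ θ := by
  set r : ℝ := (2 : ℝ) ^ (-θ) with hr
  have hr0 : 0 < r := by positivity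
  have hr1 : r < 1 := Real.rpow_lt_one_of_one_lt_of_neg one_lt_two (by linarith)
  refine ⟨(1 - r)⁻¹, inv_pos.2 (by linarith), fun Y hY N hN => ?_⟩
  rcases N.eq_empty_or_nonempty with rfl | hne
  · have : 0 < 1 - r := by linarith
    simp; positivity
  obtain ⟨m, hm, hmax⟩ := Finset.exists_max_image N id hne
  simp only [id] at hmax
  have h1 : ∀ n ∈ N, (2 : ℝ) ^ ((n : ℝ) * θ) = (2 : ℝ) ^ ((m : ℝ) * θ) * r ^ (m - n).toNat := by
    intro n hn
    have hnn : ((m - n).toNat : ℝ) = m - n := by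
      have := Int.toNat_of_nonneg (sub_nonneg.2 (hmax n hn))
      exact_mod_cast congrArg (Int.cast : ℤ → ℝ) this
    rw [← Real.rpow_natCast r, hnn, hr, ← Real.rpow_mul (by norm_num),
      ← Real.rpow_add (by norm_num)]
    congr 1; ring
  rw [Finset.sum_congr rfl h1, ← Finset.mul_sum]
  have h2 : ∑ n ∈ N, r ^ (m - n).toNat ≤ (1 - r)⁻¹ := by
    rw [← Finset.sum_image (f := fun i => r ^ i) (g := fun n : ℤ => (m - n).toNat)]
    · rw [← tsum_geometric_of_lt_one hr0.le hr1]
      exact (summable_geometric_of_lt_one hr0.le hr1).sum_le_tsum _ fun _ _ => by positivity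
    · intro a ha b hb hab
      have := hmax a ha
      have := hmax b hb
      simp only at hab
      omega
  have h3 : (2 : ℝ) ^ ((m : ℝ) * θ) ≤ Y ^ θ := by
    rw [Real.rpow_mul (by norm_num)]
    exact Real.rpow_le_rpow (by positivity) (hN m hm).le hθ.le
  rw [mul_comm]
  exact mul_le_mul h2 h3 (by positivity) (inv_nonneg.2 (by linarith))

open Classical in
/-- At every level, the coefficients have small size away from few trees. -/
def Embeds (σ d : ℤ) (Ξ : Finset ℝ) (R : Finset Tile) (K c : ℝ) (α : Tile → ℝ)
    (s : Finset ℤ) (a : ℤ → ℝ) : Prop :=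
  ∀ v : ℝ, 0 < v → ∃ 𝒯 : Finset Top, (∀ T ∈ 𝒯, T.ξ ∈ Ξ) ∧
    v ^ 2 * ∑ T ∈ 𝒯, 2 ^ T.k ≤ K * ∑ x ∈ s with c * v < a x, a x ^ 2 ∧
    Sized σ d Ξ α v (R.filter fun P => ∀ T ∈ 𝒯, ¬ InTree P T)

/-- The frequency dilations of the components of tri-tiles. -/
def sg : Fin 3 → ℤ := ![1, 1, -2]

/-- The frequency shifts of the components of tri-tiles. -/
def sh (d e : ℤ) : Fin 3 → ℤ := ![0, d, -d + e]

lemma params_tri {d e : ℤ} (hd : |d| ≤ 66) (he : |e| ≤ 3) (j : Fin 3) :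
    Params (sg j) (sh d e j) := by
  rw [abs_le] at hd he
  fin_cases j
  · exact ⟨by decide, by decide, by simp [sh]⟩
  · exact ⟨by decide, by decide, by simp [sh]; rw [abs_le]; omega⟩
  · exact ⟨by decide, by decide, by simp [sh]; rw [abs_le]; omega⟩

/-- At most one component of a tri-tile in a tree is not lacunary. -/
lemma exists_two_lac {d e : ℤ} (hd : 14 ≤ |d|) (he : |e| ≤ 3) {P : Tile} {T : Top}
    (h : InTree P T) : ∃ i j : Fin 3, i ≠ j ∧ (∃ ε : ℝ, |ε| = 1 ∧ Lac (sg i) (sh d e i) ε P T) ∧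
      (∃ ε : ℝ, |ε| = 1 ∧ Lac (sg j) (sh d e j) ε P T) := by
  have key : ∀ i : Fin 3, 3 ≤ |P.cen (sg i) (sh d e i) - sg i * 2 ^ P.k * T.ξ| →
      ∃ ε : ℝ, |ε| = 1 ∧ Lac (sg i) (sh d e i) ε P T := by
    intro i hi
    rcases le_abs.1 hi with h1 | h1
    · exact ⟨1, by simp, h, by linarith⟩
    · exact ⟨-1, by simp, h, by linarith⟩
  simp only [cen_sub] at key
  set z : ℝ := P.l - 2 ^ P.k * T.ξ
  have hd' : (14 : ℝ) ≤ |(d : ℝ)| := by exact_mod_cast hd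
  have he' : |(e : ℝ)| ≤ 3 := by exact_mod_cast he
  have k0 := key 0
  have k1 := key 1
  have k2 := key 2
  simp only [sg, sh, Matrix.cons_val_zero, Matrix.cons_val_one, Matrix.cons_val, Int.cast_one,
    Int.cast_zero, Int.cast_neg, Int.cast_add, Int.cast_ofNat, one_mul, add_zero] at k0 k1 k2
  rw [abs_le] at he'
  by_cases h0 : 3 ≤ |z|
  · by_cases h1 : 3 ≤ |z + d|
    · exact ⟨0, 1, by decide, k0 h0, k1 h1⟩
    · refine ⟨0, 2, by decide, k0 h0, k2 ?_⟩
      rw [not_le, abs_lt] at h1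
      rw [le_abs]
      rcases le_abs.1 hd' with h | h
      · left; linarith
      · right; linarith
  · rw [not_le, abs_lt] at h0
    refine ⟨1, 2, by decide, k1 ?_, k2 ?_⟩
    · rw [le_abs]
      rcases le_abs.1 hd' with h | h
      · left; linarith
      · right; linarith
    · rw [le_abs]
      rcases le_abs.1 hd' with h | h
      · right; linarith
      · left; linarith

open Classical in
lemma tree_estimate {d e : ℤ} (hd : 14 ≤ |d|) (he : |e| ≤ 3) (Ξ : Finset ℝ)
    (α : Fin 3 → Tile → ℝ) (hα : ∀ j P, 0 ≤ α j P) (v : Fin 3 → ℝ) (hv : ∀ j, 0 < v j)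
    (S : Finset Tile) (hs : ∀ j, Sized (sg j) (sh d e j) Ξ (α j) (v j) S)
    (hle : ∀ j, ∀ P ∈ S, α j P ≤ v j) (T : Top) (hT : T.ξ ∈ Ξ) :
    ∑ P ∈ S with InTree P T, 2 ^ P.k * ∏ j, α j P ≤ 6 * (∏ j, v j) * 2 ^ T.k := by
  set β : Fin 3 → Tile → ℝ := fun j P => α j P / v j with hβ
  have hβ0 : ∀ j P, 0 ≤ β j P := fun j P => div_nonneg (hα j P) (hv j).le
  have hβ1 : ∀ j, ∀ P ∈ S, β j P ≤ 1 := fun j P hP => div_le_one_of_le₀ (hle j P hP) (hv j).le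
  have hV : 0 < ∏ j, v j := Finset.prod_pos fun j _ => hv j
  set E : Finset ℝ := {1, -1} with hE
  have hEm : ∀ ε : ℝ, |ε| = 1 ↔ ε ∈ E := by
    intro ε; simp [hE, abs_eq (zero_le_one' ℝ)]
  have hEc : E.card = 2 := by
    rw [hE, Finset.card_pair]; norm_num
  have hpt : ∀ P ∈ S.filter fun P => InTree P T, 2 ^ P.k * ∏ j, α j P ≤
      (∏ j, v j) * ∑ j, ∑ ε ∈ E, if Lac (sg j) (sh d e j) ε P T then 2 ^ P.k * β j P ^ 2
        else 0 := by
    intro P hP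
    obtain ⟨hPS, hPT⟩ := Finset.mem_filter.1 hP
    have e1 : ∏ j, α j P = (∏ j, v j) * ∏ j, β j P := by
      rw [← Finset.prod_mul_distrib]
      refine Finset.prod_congr rfl fun j _ => ?_
      rw [hβ]; field_simp [(hv j).ne']
    rw [e1, mul_left_comm]
    refine mul_le_mul_of_nonneg_left ?_ hV.le
    obtain ⟨i, j, hij, ⟨ε, hε, hi⟩, ⟨ε', hε', hj⟩⟩ := exists_two_lac hd he hPT
    have hprod : ∏ j, β j P ≤ β i P * β j P := by
      rw [← Finset.mul_prod_erase _ _ (Finset.mem_univ i), ← Finset.mul_prod_erase _ _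
        (Finset.mem_erase.2 ⟨hij.symm, Finset.mem_univ j⟩)]
      refine mul_le_mul_of_nonneg_left ?_ (hβ0 i P)
      exact mul_le_of_le_one_right (hβ0 j P)
        (Finset.prod_le_one (fun j _ => hβ0 j P) (fun j _ => hβ1 j P hPS))
    set g : Fin 3 → ℝ := fun j => ∑ ε ∈ E, if Lac (sg j) (sh d e j) ε P T then
      2 ^ P.k * β j P ^ 2 else 0 with hg
    have hg0 : ∀ j, 0 ≤ g j := fun j => Finset.sum_nonneg fun ε _ => by
      split_ifs <;> positivity
    have hgl : ∀ i ε, |ε| = 1 → Lac (sg i) (sh d e i) ε P T → 2 ^ P.k * β i P ^ 2 ≤ g i := by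
      intro i ε hε hi
      have := Finset.single_le_sum (f := fun ε => if Lac (sg i) (sh d e i) ε P T then
        2 ^ P.k * β i P ^ 2 else 0) (fun ε _ => by split_ifs <;> positivity) ((hEm ε).1 hε)
      simpa [hi] using this
    have h2 : g i + g j ≤ ∑ j, g j := by
      rw [← Finset.sum_pair hij]
      exact Finset.sum_le_sum_of_subset_of_nonneg (Finset.subset_univ _) fun j _ _ => hg0 j
    refine le_trans ?_ h2
    have h3 := hgl i ε hε hi
    have h4 := hgl j ε' hε' hj
    have hk : (0 : ℝ) < 2 ^ P.k := by positivity
    calc 2 ^ P.k * ∏ j, β j P ≤ 2 ^ P.k * (β i P * β j P) := by gcongr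
      _ ≤ 2 ^ P.k * (β i P ^ 2 + β j P ^ 2) := by
        refine mul_le_mul_of_nonneg_left ?_ hk.le
        nlinarith [sq_nonneg (β i P - β j P), sq_nonneg (β i P + β j P)]
      _ ≤ _ := by linarith
  refine (Finset.sum_le_sum hpt).trans ?_
  rw [← Finset.mul_sum, Finset.sum_comm]
  have hj : ∀ j : Fin 3, ∑ P ∈ S with InTree P T, ∑ ε ∈ E,
      (if Lac (sg j) (sh d e j) ε P T then 2 ^ P.k * β j P ^ 2 else 0) ≤ 2 * 2 ^ T.k := by
    intro j
    rw [Finset.sum_comm]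
    have : ∀ ε ∈ E, ∑ P ∈ S with InTree P T,
        (if Lac (sg j) (sh d e j) ε P T then 2 ^ P.k * β j P ^ 2 else 0) ≤ 2 ^ T.k := by
      intro ε hε
      have h1 := hs j T hT ε ((hEm ε).2 hε)
      rw [← Finset.sum_filter, Finset.filter_filter]
      have h2 : ∑ P ∈ S with InTree P T ∧ Lac (sg j) (sh d e j) ε P T, 2 ^ P.k * β j P ^ 2 ≤
          ∑ P ∈ S with Lac (sg j) (sh d e j) ε P T, 2 ^ P.k * β j P ^ 2 := by
        refine Finset.sum_le_sum_of_subset_of_nonneg ?_ fun _ _ _ => by positivity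
        intro P hP
        simp only [Finset.mem_filter] at hP ⊢
        exact ⟨hP.1, hP.2.2⟩
      refine h2.trans ?_
      have h3 : ∑ P ∈ S with Lac (sg j) (sh d e j) ε P T, 2 ^ P.k * β j P ^ 2 =
          (∑ P ∈ S with Lac (sg j) (sh d e j) ε P T, 2 ^ P.k * α j P ^ 2) / v j ^ 2 := by
        rw [Finset.sum_div]
        refine Finset.sum_congr rfl fun P _ => ?_
        rw [hβ]; simp only [div_pow]; ring
      rw [h3, div_le_iff₀ (pow_pos (hv j) 2)]
      linarith
    refine (Finset.sum_le_sum this).trans (le_of_eq ?_)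
    rw [Finset.sum_const, hEc]; simp
  calc _ ≤ (∏ j, v j) * ∑ j : Fin 3, (2 * 2 ^ T.k : ℝ) :=
        mul_le_mul_of_nonneg_left (Finset.sum_le_sum fun j _ => hj j) hV.le
    _ = _ := by simp; ring

lemma sum_le_sum_of_cover {ι κ : Type*} [DecidableEq κ] (S : Finset κ) (I : Finset ι)
    (A : ι → Finset κ) (F : κ → ℝ) (hF : ∀ x, 0 ≤ F x) (h : ∀ x ∈ S, ∃ i ∈ I, x ∈ A i) :
    ∑ x ∈ S, F x ≤ ∑ i ∈ I, ∑ x ∈ A i, F x := by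
  have h1 : ∀ x ∈ S, F x ≤ ∑ i ∈ I, if x ∈ A i then F x else 0 := by
    intro x hx
    obtain ⟨i, hi, hxi⟩ := h x hx
    have := Finset.single_le_sum (f := fun i => if x ∈ A i then F x else 0)
      (fun i _ => by split_ifs; exacts [hF x, le_rfl]) hi
    simpa [hxi] using this
  refine (Finset.sum_le_sum h1).trans ?_
  rw [Finset.sum_comm]
  refine Finset.sum_le_sum fun i _ => ?_
  rw [← Finset.sum_filter]
  exact Finset.sum_le_sum_of_subset_of_nonneg
    (fun x hx => (Finset.mem_filter.1 hx).2) fun x _ _ => hF x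

lemma exists_level_lt (p : ℝ) (hp : 0 < p) (y : ℝ) (hy : 0 < y) :
    ∃ n : ℤ, ∀ m : ℤ, m ≤ n → (2 : ℝ) ^ ((m : ℝ) / p) < y := by
  obtain ⟨n, hn⟩ := exists_int_lt (p * Real.logb 2 y)
  refine ⟨n, fun m hm => ?_⟩
  rw [← Real.lt_logb_iff_rpow_lt one_lt_two hy, div_lt_iff₀ hp]
  have : (m : ℝ) ≤ n := by exact_mod_cast hm
  linarith

lemma exists_level_gt (p : ℝ) (hp : 0 < p) (y : ℝ) (hy : 0 < y) :
    ∃ n : ℤ, ∀ m : ℤ, n ≤ m → y < (2 : ℝ) ^ ((m : ℝ) / p) := by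
  obtain ⟨n, hn⟩ := exists_int_gt (p * Real.logb 2 y)
  refine ⟨n, fun m hm => ?_⟩
  rw [← Real.logb_lt_iff_lt_rpow one_lt_two hy, lt_div_iff₀ hp]
  have : (n : ℝ) ≤ m := by exact_mod_cast hm
  linarith

open Classical in
lemma level_sum_le (p : ℝ) (hp : 2 < p) (c : ℝ) (hc : 0 < c) : ∃ C : ℝ, 0 < C ∧
    ∀ (N : Finset ℤ) (s : Finset ℤ) (a : ℤ → ℝ), (∀ x, 0 ≤ a x) →
      ∑ n ∈ N, (2 : ℝ) ^ (n : ℝ) * (((2 : ℝ) ^ ((n : ℝ) / p)) ^ 2)⁻¹ *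
        ∑ x ∈ s with c * (2 : ℝ) ^ ((n : ℝ) / p) < a x, a x ^ 2 ≤ C * ∑ x ∈ s, a x ^ p := by
  have hp0 : 0 < p := by linarith
  have hθ : 0 < 1 - 2 / p := by
    have : 2 / p < 1 := (div_lt_one hp0).2 hp
    linarith
  obtain ⟨C, hC, hgeo⟩ := exists_geom_bound (1 - 2 / p) hθ
  refine ⟨C * (c⁻¹) ^ (p - 2), by positivity, fun N s a ha => ?_⟩
  have e1 : ∀ n : ℤ, (2 : ℝ) ^ (n : ℝ) * (((2 : ℝ) ^ ((n : ℝ) / p)) ^ 2)⁻¹ =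
      (2 : ℝ) ^ ((n : ℝ) * (1 - 2 / p)) := by
    intro n
    rw [← Real.rpow_natCast, ← Real.rpow_mul (by norm_num), ← Real.rpow_neg (by norm_num),
      ← Real.rpow_add (by norm_num)]
    congr 1; push_cast; ring
  simp only [e1, Finset.sum_filter, Finset.mul_sum]
  rw [Finset.sum_comm]
  refine Finset.sum_le_sum fun x _ => ?_
  simp only [mul_ite, mul_zero]
  rw [← Finset.sum_filter, ← Finset.sum_mul]
  rcases (ha x).eq_or_lt with h0 | h0
  · rw [← h0, Real.zero_rpow hp0.ne']; simp
  have hY : 0 < (a x / c) ^ p := by positivity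
  have h1 := hgeo _ hY (N.filter fun n : ℤ => c * (2 : ℝ) ^ ((n : ℝ) / p) < a x) (by
    intro n hn
    have h2 := (Finset.mem_filter.1 hn).2
    have h3 : (2 : ℝ) ^ ((n : ℝ) / p) < a x / c := by rw [lt_div_iff₀ hc]; linarith
    have h4 := Real.rpow_lt_rpow (by positivity) h3 hp0
    rwa [← Real.rpow_mul (by norm_num), div_mul_cancel₀ _ hp0.ne'] at h4)
  refine (mul_le_mul_of_nonneg_right h1 (sq_nonneg _)).trans (le_of_eq ?_)
  rw [← Real.rpow_mul (by positivity), div_eq_mul_inv (a x) c,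
    Real.mul_rpow h0.le (by positivity)]
  have e2 : p * (1 - 2 / p) = p - 2 := by field_simp
  have e3 : a x ^ (p - 2) * a x ^ 2 = a x ^ p := by
    rw [← Real.rpow_natCast, ← Real.rpow_add h0]; congr 1; push_cast; ring
  rw [e2, ← e3]; ring

open Classical in
/-- The model sum over tri-tiles. -/
theorem trilinear_tiles (p : Fin 3 → ℝ) (hp : ∀ j, 2 < p j) (hsum : ∑ j, 1 / p j = 1)
    (K c : ℝ) (hK : 0 ≤ K) (hc : 0 < c) : ∃ C : ℝ, 0 < C ∧ ∀ d e : ℤ, 14 ≤ |d| → |d| ≤ 66 →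
      |e| ≤ 3 → ∀ (Ξ : Finset ℝ) (R : Finset Tile) (α : Fin 3 → Tile → ℝ)
      (s : Fin 3 → Finset ℤ) (a : Fin 3 → ℤ → ℝ), Rich Ξ R → (∀ j P, 0 ≤ α j P) →
      (∀ j x, 0 ≤ a j x) → (∀ j, ∑ x ∈ s j, a j x ^ p j ≤ 1) →
      (∀ j, Embeds (sg j) (sh d e j) Ξ R K c (α j) (s j) (a j)) →
      ∑ P ∈ R, 2 ^ P.k * ∏ j, α j P ≤ C := by
  have hp0 : ∀ j, 0 < p j := fun j => by linarith [hp j]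
  choose L hL hLs using fun j => level_sum_le (p j) (hp j) c hc
  refine ⟨1 + 12 * ∑ j, K * L j, ?_, ?_⟩
  · have : 0 ≤ ∑ j, K * L j := Finset.sum_nonneg fun j _ => mul_nonneg hK (hL j).le
    linarith
  intro d e hd hd' he Ξ R α s a hr hα ha hnorm hemb
  set v : Fin 3 → ℤ → ℝ := fun j n => (2 : ℝ) ^ ((n : ℝ) / p j) with hv
  have hv0 : ∀ j n, 0 < v j n := fun j n => by positivity
  choose 𝒯 h1 h2 h3 using fun j n => hemb j (v j n) (hv0 j n)
  set G : ℤ → Finset Tile := fun n => R.filter fun P => ∀ j, ∀ T ∈ 𝒯 j n, ¬ InTree P T with hG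
  have hGR : ∀ n, G n ⊆ R := fun n => Finset.filter_subset _ _
  have hGs : ∀ n j, Sized (sg j) (sh d e j) Ξ (α j) (v j n) (G n) := by
    intro n j
    refine (h3 j n).mono fun P hP => ?_
    simp only [hG, Finset.mem_filter] at hP ⊢
    exact ⟨hP.1, hP.2 j⟩
  have hGle : ∀ n j, ∀ P ∈ G n, α j P ≤ v j n := fun n j P hP =>
    (hGs n j).le (params_tri hd' he j) (hv0 j n).le (fun Q hQ => hr Q (hGR n hQ)) P hP
  have hF : ∀ P : Tile, 0 ≤ 2 ^ P.k * ∏ j, α j P := fun P =>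
    mul_nonneg (by positivity) (Finset.prod_nonneg fun j _ => hα j P)
  -- large levels
  have htop : ∃ M : ℤ, ∀ n, M ≤ n → G n = R := by
    choose M hM using fun j => exists_level_gt (p j) (hp0 j) (c⁻¹) (inv_pos.2 hc)
    refine ⟨∑ j, |M j|, fun n hn => ?_⟩
    refine Finset.filter_true_of_mem fun P _ j T hT => ?_
    exfalso
    have hMn : M j ≤ n := (le_abs_self _).trans ((Finset.single_le_sum (f := fun j => |M j|)
      (fun j _ => abs_nonneg _) (Finset.mem_univ j)).trans hn)
    have h4 := hM j n hMn
    have h5 : ∑ x ∈ s j with c * v j n < a j x, a j x ^ 2 = 0 := by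
      refine Finset.sum_eq_zero fun x hx => ?_
      exfalso
      obtain ⟨hx, hx'⟩ := Finset.mem_filter.1 hx
      have h6 : a j x ^ p j ≤ 1 := (Finset.single_le_sum (f := fun x => a j x ^ p j)
        (fun x _ => Real.rpow_nonneg (ha j x) _) hx).trans (hnorm j)
      have h7 : a j x ≤ 1 := by
        by_contra hcon
        exact absurd h6 (not_le.2 (Real.one_lt_rpow (not_le.1 hcon) (hp0 j)))
      rw [inv_lt_iff_one_lt_mul₀ hc] at h4
      have : 1 < c * v j n := by rw [mul_comm]; exact h4
      linarith
    have h8 := h2 j n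
    rw [h5, mul_zero] at h8
    have h9 : (2 : ℝ) ^ T.k ≤ ∑ T ∈ 𝒯 j n, (2 : ℝ) ^ T.k :=
      Finset.single_le_sum (f := fun T : Top => (2 : ℝ) ^ T.k) (fun _ _ => by positivity) hT
    have : 0 < v j n ^ 2 * ∑ T ∈ 𝒯 j n, (2 : ℝ) ^ T.k :=
      mul_pos (pow_pos (hv0 j n) 2) (lt_of_lt_of_le (by positivity) h9)
    linarith
  have hlevel : ∀ P : Tile, ∃ n : ℤ, P ∈ R → 0 < ∏ j, α j P → P ∉ G n ∧ P ∈ G (n + 1) := by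
    intro P
    by_cases hP : P ∈ R ∧ 0 < ∏ j, α j P
    · obtain ⟨M, hM⟩ := htop
      have hα0 : 0 < α 0 P := by
        refine (hα 0 P).lt_of_ne fun h => ?_
        exact hP.2.ne' (Finset.prod_eq_zero (Finset.mem_univ 0) h.symm)
      obtain ⟨m, hm⟩ := exists_level_lt (p 0) (hp0 0) _ hα0
      obtain ⟨n, hn, hn'⟩ := Int.exists_greatest_of_bdd (P := fun n => P ∉ G n)
        ⟨M, fun z hz => by
          by_contra hcon
          exact hz (by rw [hM z (by omega)]; exact hP.1)⟩
        ⟨m, fun h => absurd (hm m le_rfl) (not_lt.2 (hGle m 0 P h))⟩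
      refine ⟨n, fun _ _ => ⟨hn, ?_⟩⟩
      by_contra hcon
      have := hn' (n + 1) hcon
      omega
    · exact ⟨0, fun h h' => absurd ⟨h, h'⟩ hP⟩
  choose ν hν using hlevel
  set R' := R.filter fun P => 0 < ∏ j, α j P with hR'
  have hRR' : ∑ P ∈ R, 2 ^ P.k * ∏ j, α j P = ∑ P ∈ R', 2 ^ P.k * ∏ j, α j P := by
    refine (Finset.sum_filter_of_ne fun P _ hne => ?_).symm
    exact (Finset.prod_nonneg fun j _ => hα j P).lt_of_ne fun h => hne (by rw [← h, mul_zero])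
  set N := R'.image ν with hN
  have hcover := sum_le_sum_of_cover R' ((N ×ˢ (Finset.univ : Finset (Fin 3))).sigma
    fun q => 𝒯 q.2 q.1) (fun i => (G (i.1.1 + 1)).filter fun P => InTree P i.2)
    (fun P => 2 ^ P.k * ∏ j, α j P) hF (by
      intro P hP
      obtain ⟨hPR, hP0⟩ := Finset.mem_filter.1 hP
      obtain ⟨g1, g2⟩ := hν P hPR hP0
      have : ∃ j, ∃ T ∈ 𝒯 j (ν P), InTree P T := by
        by_contra hcon
        push Not at hcon
        exact g1 (Finset.mem_filter.2 ⟨hPR, hcon⟩)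
      obtain ⟨j, T, hT, hPT⟩ := this
      exact ⟨⟨(ν P, j), T⟩, by simp [hT]; exact Finset.mem_image_of_mem ν hP,
        Finset.mem_filter.2 ⟨g2, hPT⟩⟩)
  have hprodv : ∀ n : ℤ, ∏ j, v j (n + 1) = 2 * (2 : ℝ) ^ (n : ℝ) := by
    intro n
    have : ∏ j, v j (n + 1) = (2 : ℝ) ^ (∑ j, ((n + 1 : ℤ) : ℝ) / p j) := by
      rw [Real.rpow_sum_of_pos (by norm_num)]
    rw [this]
    have e1 : ∑ j, ((n + 1 : ℤ) : ℝ) / p j = (n : ℝ) + 1 := by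
      simp only [div_eq_mul_one_div ((n + 1 : ℤ) : ℝ), ← Finset.mul_sum, hsum]
      push_cast; ring
    rw [e1, Real.rpow_add (by norm_num), Real.rpow_one]; ring
  rw [hRR']
  refine hcover.trans ?_
  rw [Finset.sum_sigma, Finset.sum_product, Finset.sum_comm]
  have hj : ∀ j : Fin 3, ∑ n ∈ N, ∑ T ∈ 𝒯 j n, ∑ P ∈ G (n + 1) with InTree P T,
      2 ^ P.k * ∏ j, α j P ≤ 12 * (K * L j) := by
    intro j
    have h4 : ∀ n ∈ N, ∑ T ∈ 𝒯 j n, ∑ P ∈ G (n + 1) with InTree P T, 2 ^ P.k * ∏ j, α j P ≤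
        12 * K * ((2 : ℝ) ^ (n : ℝ) * (((2 : ℝ) ^ ((n : ℝ) / p j)) ^ 2)⁻¹ *
        ∑ x ∈ s j with c * (2 : ℝ) ^ ((n : ℝ) / p j) < a j x, a j x ^ 2) := by
      intro n _
      have h5 : ∀ T ∈ 𝒯 j n, ∑ P ∈ G (n + 1) with InTree P T, 2 ^ P.k * ∏ j, α j P ≤
          12 * (2 : ℝ) ^ (n : ℝ) * 2 ^ T.k := by
        intro T hT
        refine (tree_estimate hd he Ξ α hα (fun j => v j (n + 1)) (fun j => hv0 j _) (G (n + 1))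
          (hGs (n + 1)) (hGle (n + 1)) T (h1 j n T hT)).trans (le_of_eq ?_)
        rw [hprodv]; ring
      refine (Finset.sum_le_sum h5).trans ?_
      rw [← Finset.mul_sum]
      have h6 := h2 j n
      have hv2 : 0 < v j n ^ 2 := pow_pos (hv0 j n) 2
      rw [mul_comm, ← le_div_iff₀ hv2] at h6
      calc _ ≤ 12 * (2 : ℝ) ^ (n : ℝ) *
          ((K * ∑ x ∈ s j with c * v j n < a j x, a j x ^ 2) / v j n ^ 2) := by gcongr
        _ = _ := by rw [hv]; simp only [div_eq_mul_inv]; ring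
    refine (Finset.sum_le_sum h4).trans ?_
    rw [← Finset.mul_sum]
    have h7 := hLs j N (s j) (a j) (ha j)
    have h8 : L j * ∑ x ∈ s j, a j x ^ p j ≤ L j :=
      mul_le_of_le_one_right (hL j).le (hnorm j)
    calc _ ≤ 12 * K * L j := mul_le_mul_of_nonneg_left (h7.trans h8) (by positivity)
      _ = _ := by ring
  refine (Finset.sum_le_sum fun j _ => hj j).trans ?_
  rw [← Finset.mul_sum]
  linarith

noncomputable def ee (x : ℝ) : ℂ := Complex.exp (((2 * π * x : ℝ) : ℂ) * Complex.I)

lemma ee_add (x y : ℝ) : ee (x + y) = ee x * ee y := by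
  simp only [ee, ← Complex.exp_add]; congr 1; push_cast; ring

@[simp] lemma ee_zero : ee 0 = 1 := by simp [ee]

@[simp] lemma norm_ee (x : ℝ) : ‖ee x‖ = 1 := by simp only [ee, Complex.norm_exp_ofReal_mul_I]

@[simp] lemma ee_int (n : ℤ) : ee n = 1 := by
  have : ((2 * π * (n:ℝ) : ℝ) : ℂ) * Complex.I = n * (2 * π * Complex.I) := by push_cast; ring
  rw [ee, this, Complex.exp_int_mul_two_pi_mul_I]

lemma conj_ee (x : ℝ) : starRingEnd ℂ (ee x) = ee (-x) := by
  rw [ee, ee, ← Complex.exp_conj, map_mul, Complex.conj_ofReal, Complex.conj_I]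
  congr 1; push_cast; ring

lemma contDiff_ee : ContDiff ℝ (⊤ : ℕ∞) ee := by
  unfold ee
  exact ((Complex.ofRealCLM.contDiff.comp (contDiff_const.mul contDiff_id)).mul
    contDiff_const).cexp

lemma continuous_ee : Continuous ee := contDiff_ee.continuous

/-- Functions whose Fourier transform is smooth and supported in `[a, b]`. -/
def BandLimited (u : ℝ → ℂ) (a b : ℝ) : Prop :=
  ∃ F : ℝ → ℂ, ContDiff ℝ (⊤ : ℕ∞) F ∧ (∀ η, η ∉ Icc a b → F η = 0) ∧
    ∀ x, u x = ∫ η, ee (η * x) * F η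

lemma hasCompactSupport_of_Icc {F : ℝ → ℂ} {a b : ℝ} (h : ∀ η, η ∉ Icc a b → F η = 0) :
    HasCompactSupport F := HasCompactSupport.intro isCompact_Icc h

open FourierTransform in
lemma BandLimited.exists_schwartz {u : ℝ → ℂ} {a b : ℝ} (h : BandLimited u a b) :
    ∃ F : SchwartzMap ℝ ℂ, (∀ η, η ∉ Icc a b → F η = 0) ∧ u = ⇑(𝓕⁻ F : SchwartzMap ℝ ℂ) := by
  obtain ⟨F, hF, hs, hu⟩ := h
  refine ⟨(hasCompactSupport_of_Icc hs).toSchwartzMap hF, hs, ?_⟩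
  ext x
  rw [hu, SchwartzMap.fourierInv_coe, Real.fourierInv_eq']
  refine integral_congr_ae (Filter.Eventually.of_forall fun η => ?_)
  simp [ee, mul_assoc, mul_comm x]

lemma BandLimited.decay {u : ℝ → ℂ} {a b : ℝ} (h : BandLimited u a b) (n : ℕ) :
    ∃ C, 0 < C ∧ ∀ x, ‖u x‖ ≤ C * ((1 + |x|) ^ n)⁻¹ := by
  obtain ⟨F, -, rfl⟩ := h.exists_schwartz
  set f : SchwartzMap ℝ ℂ := FourierTransformInv.fourierInv F
  have := SchwartzMap.one_add_le_sup_seminorm_apply (𝕜 := ℝ) (m := (n, 0)) le_rfl le_rfl f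
  refine ⟨2 ^ n * ((Finset.Iic (n, 0)).sup fun m => SchwartzMap.seminorm ℝ m.1 m.2) f + 1,
    by positivity, fun x => ?_⟩
  have h := this x
  rw [norm_iteratedFDeriv_zero, Real.norm_eq_abs] at h
  rw [← div_eq_mul_inv, le_div_iff₀ (by positivity)]
  simp only at h
  linarith

lemma BandLimited.summable {u : ℝ → ℂ} {a b : ℝ} (h : BandLimited u a b) :
    Summable fun n : ℤ => ‖u n‖ := by
  obtain ⟨C, -, hC⟩ := h.decay 2
  refine Summable.of_nonneg_of_le (fun _ => norm_nonneg _) (fun n => hC n) ?_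
  refine Summable.mul_left _ ?_
  have h2 : Summable fun n : ℤ => ((|(n:ℝ)|) ^ (2:ℕ))⁻¹ := by
    have := Real.summable_one_div_int_pow (p := 2) |>.2 (by norm_num)
    simpa using this
  refine Summable.of_norm_bounded_eventually (g := fun n : ℤ => ((|(n:ℝ)|) ^ (2:ℕ))⁻¹) h2 ?_
  rw [Filter.eventually_cofinite]
  refine (Set.finite_singleton (0:ℤ)).subset fun n hn => ?_
  by_contra hne
  apply hn
  have : (0:ℝ) < |(n:ℝ)| := abs_pos.2 (by exact_mod_cast hne)
  rw [Real.norm_of_nonneg (by positivity)]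
  gcongr; linarith

open FourierTransform in
lemma BandLimited.tsum_eq_zero {u : ℝ → ℂ} {a b : ℝ} (h : BandLimited u a b)
    (hab : ∀ n : ℤ, (n : ℝ) ∉ Icc a b) : ∑' n : ℤ, u n = 0 := by
  obtain ⟨F, hF, rfl⟩ := h.exists_schwartz
  have := SchwartzMap.tsum_eq_tsum_fourier (𝓕⁻ F : SchwartzMap ℝ ℂ) 0
  simp only [zero_add] at this
  rw [this]
  simp [hF _ (hab _)]

lemma BandLimited.mul {u v : ℝ → ℂ} {a b c d : ℝ} (hu : BandLimited u a b)
    (hv : BandLimited v c d) : BandLimited (fun x => u x * v x) (a + c) (b + d) := by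
  obtain ⟨F, hF, hFs, hu⟩ := hu
  obtain ⟨G, hG, hGs, hv⟩ := hv
  have hFc := hasCompactSupport_of_Icc hFs
  have hGc := hasCompactSupport_of_Icc hGs
  refine ⟨MeasureTheory.convolution F G (ContinuousLinearMap.mul ℂ ℂ) volume,
    ?_, fun η hη => ?_, fun x => ?_⟩
  · exact hGc.contDiff_convolution_right (ContinuousLinearMap.mul ℂ ℂ |>.bilinearRestrictScalars ℝ)
      hF.continuous.locallyIntegrable hG
  · rw [MeasureTheory.convolution_def]
    refine integral_eq_zero_of_ae (Filter.Eventually.of_forall fun t => ?_)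
    by_contra hne
    simp only [Pi.zero_apply, ContinuousLinearMap.mul_apply', mul_eq_zero, not_or] at hne
    have h1 := not_imp_comm.1 (hFs t) hne.1
    have h2 := not_imp_comm.1 (hGs _) hne.2
    exact hη ⟨by linarith [h1.1, h2.1], by linarith [h1.2, h2.2]⟩
  · have := Real.fourier_mul_convolution_eq (hF.continuous.integrable_of_hasCompactSupport hFc)
      (hG.continuous.integrable_of_hasCompactSupport hGc) (-x)
    have key : ∀ K : ℝ → ℂ, FourierTransform.fourier K (-x) = ∫ η, ee (η * x) * K η := by
      intro K
      rw [Real.fourier_eq']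
      refine integral_congr_ae (Filter.Eventually.of_forall fun η => ?_)
      simp [ee, mul_assoc, mul_comm x]
    rw [key, key, key] at this
    simp only [hu, hv, this]

lemma BandLimited.conj {u : ℝ → ℂ} {a b : ℝ} (hu : BandLimited u a b) :
    BandLimited (fun x => starRingEnd ℂ (u x)) (-b) (-a) := by
  obtain ⟨F, hF, hFs, hu⟩ := hu
  refine ⟨fun η => starRingEnd ℂ (F (-η)), ?_, fun η hη => ?_, fun x => ?_⟩
  · exact Complex.conjCLE.contDiff.comp (hF.comp contDiff_neg)
  · simp only
    rw [hFs, map_zero]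
    exact fun h => hη ⟨by linarith [h.2], by linarith [h.1]⟩
  · simp only [hu]
    rw [← integral_conj, ← integral_neg_eq_self]
    refine integral_congr_ae (Filter.Eventually.of_forall fun η => ?_)
    simp [conj_ee]

lemma BandLimited.neg {u : ℝ → ℂ} {a b : ℝ} (hu : BandLimited u a b) :
    BandLimited (fun x => u (-x)) (-b) (-a) := by
  obtain ⟨F, hF, hFs, hu⟩ := hu
  refine ⟨fun η => F (-η), hF.comp contDiff_neg, fun η hη => hFs _ fun h => hη
    ⟨by linarith [h.2], by linarith [h.1]⟩, fun x => ?_⟩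
  simp only [hu]
  rw [← integral_neg_eq_self]
  refine integral_congr_ae (Filter.Eventually.of_forall fun η => ?_)
  simp

lemma BandLimited.translate {u : ℝ → ℂ} {a b : ℝ} (hu : BandLimited u a b) (y : ℝ) :
    BandLimited (fun x => u (x + y)) a b := by
  obtain ⟨F, hF, hFs, hu⟩ := hu
  refine ⟨fun η => ee (η * y) * F η, ?_, fun η hη => by simp [hFs η hη], fun x => ?_⟩
  · exact (contDiff_ee.comp (contDiff_id.mul contDiff_const)).mul hF
  · simp only [hu]
    refine integral_congr_ae (Filter.Eventually.of_forall fun η => ?_)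
    simp only [mul_add, ee_add]; ring

lemma BandLimited.modulate {u : ℝ → ℂ} {a b : ℝ} (hu : BandLimited u a b) (c : ℝ) :
    BandLimited (fun x => u x * ee (c * x)) (a + c) (b + c) := by
  obtain ⟨F, hF, hFs, hu⟩ := hu
  refine ⟨fun η => F (η - c), hF.comp (contDiff_id.sub contDiff_const), fun η hη => hFs _
    fun h => hη ⟨by linarith [h.1], by linarith [h.2]⟩, fun x => ?_⟩
  simp only [hu]
  rw [← integral_sub_right_eq_self _ c, ← integral_mul_const]
  refine integral_congr_ae (Filter.Eventually.of_forall fun η => ?_)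
  have : η * x = (η - c) * x + c * x := by ring
  simp only [this, ee_add]; ring

lemma BandLimited.dilate {u : ℝ → ℂ} {a b : ℝ} (hu : BandLimited u a b) {A : ℝ} (hA : 0 < A) :
    BandLimited (fun x => ((A⁻¹ : ℝ) : ℂ) * u (x / A)) (a / A) (b / A) := by
  obtain ⟨F, hF, hFs, hu⟩ := hu
  refine ⟨fun η => F (A * η), hF.comp (contDiff_const.mul contDiff_id), fun η hη => hFs _
    fun h => hη ⟨?_, ?_⟩, fun x => ?_⟩
  · rw [div_le_iff₀ hA, mul_comm]; exact h.1
  · rw [le_div_iff₀ hA, mul_comm]; exact h.2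
  · simp only [hu]
    have := MeasureTheory.Measure.integral_comp_mul_left (fun η => ee (η * (x / A)) * F η) A
    rw [abs_of_pos (by positivity)] at this
    rw [← smul_eq_mul, Complex.coe_smul, ← this]
    refine integral_congr_ae (Filter.Eventually.of_forall fun η => ?_)
    simp only
    congr 2; field_simp

noncomputable def stp (x : ℝ) : ℂ := (Real.smoothTransition x : ℂ)

lemma contDiff_stp : ContDiff ℝ (⊤ : ℕ∞) stp :=
  Complex.ofRealCLM.contDiff.comp Real.smoothTransition.contDiff

lemma stp_of_nonpos {x : ℝ} (h : x ≤ 0) : stp x = 0 := by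
  simp [stp, Real.smoothTransition.zero_of_nonpos h]

lemma stp_of_one_le {x : ℝ} (h : 1 ≤ x) : stp x = 1 := by
  simp [stp, Real.smoothTransition.one_of_one_le h]

lemma deriv_stp_eq_zero {x : ℝ} (h : x ∉ Icc (0:ℝ) 1) : deriv stp x = 0 := by
  rw [mem_Icc, not_and_or, not_le, not_le] at h
  rcases h with h | h
  · have : stp =ᶠ[nhds x] fun _ => 0 := by
      filter_upwards [Iio_mem_nhds h] with y hy using stp_of_nonpos (le_of_lt hy)
    rw [this.deriv_eq]; simp
  · have : stp =ᶠ[nhds x] fun _ => 1 := by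
      filter_upwards [Ioi_mem_nhds h] with y hy using stp_of_one_le (le_of_lt hy)
    rw [this.deriv_eq]; simp

lemma contDiff_deriv_stp : ContDiff ℝ (⊤ : ℕ∞) (deriv stp) :=
  (contDiff_infty_iff_deriv.1 contDiff_stp).2

lemma hasDerivAt_stp (x : ℝ) : HasDerivAt stp (deriv stp x) x :=
  (contDiff_stp.differentiable (by norm_num) x).hasDerivAt

noncomputable def phi (x : ℝ) : ℂ :=
  ∫ η, ee (η * x) * (stp (2 * η + 3 / 2) - stp (2 * η - 1 / 2))

noncomputable def psi (x : ℝ) : ℂ := ∫ η, ee (η * x) * (stp (η / 16 - 1) - stp (η / 32 - 1))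

noncomputable def stpE (x : ℝ) : ℂ := ∫ η, ee (η * x) * deriv stp (η - 1)

lemma bandLimited_phi : BandLimited phi (-(3 / 4)) (3 / 4) := by
  refine ⟨_, ?_, fun η hη => ?_, fun x => rfl⟩
  · exact (contDiff_stp.comp (by fun_prop)).sub (contDiff_stp.comp (by fun_prop))
  · rw [mem_Icc, not_and_or, not_le, not_le] at hη
    rcases hη with h | h
    · rw [stp_of_nonpos (by linarith), stp_of_nonpos (by linarith), sub_zero]
    · rw [stp_of_one_le (by linarith), stp_of_one_le (by linarith), sub_self]

lemma psi_window_eq_zero {η : ℝ} (hη : η ∉ Icc (16:ℝ) 64) :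
    stp (η / 16 - 1) - stp (η / 32 - 1) = 0 := by
  rw [mem_Icc, not_and_or, not_le, not_le] at hη
  rcases hη with h | h
  · rw [stp_of_nonpos (by linarith), stp_of_nonpos (by linarith), sub_zero]
  · rw [stp_of_one_le (by linarith), stp_of_one_le (by linarith), sub_self]

lemma bandLimited_psi : BandLimited psi 16 64 := by
  refine ⟨_, ?_, fun η hη => psi_window_eq_zero hη, fun x => rfl⟩
  exact (contDiff_stp.comp (by fun_prop)).sub (contDiff_stp.comp (by fun_prop))

lemma bandLimited_stpE : BandLimited stpE 1 2 := by
  refine ⟨_, contDiff_deriv_stp.comp (by fun_prop), fun η hη => deriv_stp_eq_zero fun h => hη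
    ⟨by linarith [h.1], by linarith [h.2]⟩, fun x => rfl⟩

lemma stpE_zero : stpE 0 = 1 := by
  simp only [stpE, mul_zero, ee_zero, one_mul]
  rw [integral_sub_right_eq_self (deriv stp) 1]
  have h1 : ∫ η, deriv stp η = ∫ η in (0:ℝ)..1, deriv stp η := by
    rw [intervalIntegral.integral_of_le zero_le_one, ← integral_Icc_eq_integral_Ioc,
      setIntegral_eq_integral_of_forall_compl_eq_zero fun x hx => deriv_stp_eq_zero hx]
  rw [h1, intervalIntegral.integral_eq_sub_of_hasDerivAt (fun x _ => hasDerivAt_stp x)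
    (contDiff_deriv_stp.continuous.intervalIntegrable _ _), stp_of_one_le le_rfl,
    stp_of_nonpos le_rfl, sub_zero]

lemma hasDerivAt_ee_mul (x η : ℝ) :
    HasDerivAt (fun η : ℝ => ee (η * x)) (2 * π * Complex.I * x * ee (η * x)) η := by
  unfold ee
  have h : HasDerivAt (fun η : ℝ => ((2 * π * (η * x) : ℝ) : ℂ) * Complex.I)
      (((2 * π * x : ℝ) : ℂ) * Complex.I) η := by
    refine (HasDerivAt.ofReal_comp ?_).mul_const _
    have := ((hasDerivAt_id η).mul_const x).const_mul (2 * π)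
    simpa using this
  have := h.cexp
  convert this using 1
  push_cast; ring

lemma stpE_scale (x : ℝ) {A : ℝ} (hA : 0 < A) :
    stpE (A * x) = ∫ η, ee (η * x) * ((1 / A : ℝ) * deriv stp (η / A - 1)) := by
  have := MeasureTheory.Measure.integral_comp_div
    (fun η => ee (η * (A * x)) * deriv stp (η - 1)) A
  rw [abs_of_pos hA] at this
  rw [stpE]
  have h2 : ∫ η, ee (η * x) * ((1 / A : ℝ) * deriv stp (η / A - 1)) =
      (A⁻¹ : ℝ) • ∫ η, ee (η / A * (A * x)) * deriv stp (η / A - 1) := by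
    rw [← integral_smul]
    refine integral_congr_ae (Filter.Eventually.of_forall fun η => ?_)
    have : η / A * (A * x) = η * x := by field_simp
    simp only [this, one_div, Complex.real_smul]; ring
  rw [h2, this, smul_smul, inv_mul_cancel₀ hA.ne', one_smul]

lemma mul_psi (x : ℝ) : 2 * π * Complex.I * x * psi x = stpE (32 * x) - stpE (16 * x) := by
  rw [stpE_scale x (by norm_num), stpE_scale x (by norm_num)]
  set W : ℝ → ℂ := fun η => stp (η / 16 - 1) - stp (η / 32 - 1) with hW
  have hWd : ∀ η, HasDerivAt W ((1 / 16 : ℝ) * deriv stp (η / 16 - 1)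
      - (1 / 32 : ℝ) * deriv stp (η / 32 - 1)) η := by
    intro η
    have key : ∀ A : ℝ, HasDerivAt (fun η => stp (η / A - 1))
        ((1 / A : ℝ) * deriv stp (η / A - 1)) η := by
      intro A
      have h1 : HasDerivAt (fun η : ℝ => η / A - 1) (1 / A) η :=
        ((hasDerivAt_id η).div_const A).sub_const 1
      have := (hasDerivAt_stp (η / A - 1)).scomp η h1
      simpa [Function.comp_def] using this
    exact (key 16).sub (key 32)
  have hc : ∀ A : ℝ, 0 < A → Integrable fun η => ee (η * x) * ((1 / A : ℝ) * deriv stp (η / A - 1)) := by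
    intro A hA
    refine Continuous.integrable_of_hasCompactSupport ?_ ?_
    · exact (continuous_ee.comp (by fun_prop)).mul (continuous_const.mul
        (contDiff_deriv_stp.continuous.comp (by fun_prop)))
    · refine hasCompactSupport_of_Icc (a := A) (b := 2 * A) fun η hη => ?_
      rw [deriv_stp_eq_zero, mul_zero, mul_zero]
      refine fun h => hη ⟨?_, ?_⟩
      · have := h.1; rw [sub_nonneg, le_div_iff₀ hA] at this; linarith
      · have := h.2; rw [sub_le_iff_le_add, div_le_iff₀ hA] at this; linarith
  have hWc : Continuous W := (contDiff_stp.continuous.comp (by fun_prop)).sub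
    (contDiff_stp.continuous.comp (by fun_prop))
  have hWs : HasCompactSupport W := hasCompactSupport_of_Icc fun η hη => psi_window_eq_zero hη
  have hce : Continuous fun η : ℝ => ee (η * x) := continuous_ee.comp (by fun_prop)
  have hI := hc 16 (by norm_num) |>.sub (hc 32 (by norm_num))
  have ibp := integral_mul_deriv_eq_deriv_mul_of_integrable (u := fun η => ee (η * x)) (v := W)
    (fun η _ => hasDerivAt_ee_mul x η) (fun η _ => hWd η)
    (by refine hI.congr (Filter.Eventually.of_forall fun η => ?_)
        simp only [Pi.sub_apply, Pi.mul_apply]; ring)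
    (by refine Continuous.integrable_of_hasCompactSupport ?_ hWs.mul_left
        exact (continuous_const.mul hce).mul hWc)
    (by exact Continuous.integrable_of_hasCompactSupport (hce.mul hWc) hWs.mul_left)
  rw [← integral_sub (hc 32 (by norm_num)) (hc 16 (by norm_num)), psi, ← integral_const_mul]
  have e1 : ∫ η, (ee (η * x) * ((1 / 32 : ℝ) * deriv stp (η / 32 - 1)) -
      ee (η * x) * ((1 / 16 : ℝ) * deriv stp (η / 16 - 1))) =
      -∫ η, ee (η * x) * ((1 / 16 : ℝ) * deriv stp (η / 16 - 1)
      - (1 / 32 : ℝ) * deriv stp (η / 32 - 1)) := by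
    rw [← integral_neg]
    refine integral_congr_ae (Filter.Eventually.of_forall fun η => ?_)
    simp only; ring
  rw [e1, ibp, neg_neg]
  refine integral_congr_ae (Filter.Eventually.of_forall fun η => ?_)
  simp only [hW]; ring

lemma integral_ee_int {j : ℤ} (hj : j ≠ 0) (a : ℝ) :
    ∫ η in a..(a + 1), ee (η * j) = 0 := by
  have hne : (2 * π * Complex.I * (j:ℝ) : ℂ) ≠ 0 := by
    have : (j:ℂ) ≠ 0 := by exact_mod_cast hj
    simp [this, Real.pi_ne_zero]
  have h : ∀ η ∈ uIcc a (a+1), HasDerivAt (fun η : ℝ => (2 * π * Complex.I * (j:ℝ) : ℂ)⁻¹ * ee (η * j))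
      (ee (η * j)) η := by
    intro η _
    have := (hasDerivAt_ee_mul j η).const_mul (2 * π * Complex.I * (j:ℝ) : ℂ)⁻¹
    rwa [← mul_assoc, inv_mul_cancel₀ hne, one_mul] at this
  rw [intervalIntegral.integral_eq_sub_of_hasDerivAt h
    ((continuous_ee.comp (by fun_prop)).intervalIntegrable _ _), add_mul, ee_add, one_mul, ee_int]
  ring

lemma phi_int (j : ℤ) : phi j = if j = 0 then 1 else 0 := by
  have hc : ∀ c : ℝ, Continuous fun η : ℝ => ee (η * j) * stp (2 * η + c) := fun c =>
    (continuous_ee.comp (by fun_prop)).mul (contDiff_stp.continuous.comp (by fun_prop))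
  have hi : ∀ c a b : ℝ, IntervalIntegrable (fun η : ℝ => ee (η * j) * stp (2 * η + c))
    volume a b := fun c a b => (hc c).intervalIntegrable _ _
  have h1 : phi j = ∫ η in (-2:ℝ)..2, (ee (η * j) * stp (2 * η + 3/2) -
      ee (η * j) * stp (2 * η + (-1/2))) := by
    rw [intervalIntegral.integral_of_le (by norm_num), ← integral_Icc_eq_integral_Ioc,
      setIntegral_eq_integral_of_forall_compl_eq_zero, phi]
    · refine integral_congr_ae (Filter.Eventually.of_forall fun η => ?_)
      beta_reduce; rw [show 2 * η + -1/2 = 2 * η - 1/2 by ring]; ring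
    · intro η hη
      rw [mem_Icc, not_and_or, not_le, not_le] at hη
      rcases hη with h | h
      · rw [stp_of_nonpos (by linarith), stp_of_nonpos (by linarith)]; ring
      · rw [stp_of_one_le (by linarith), stp_of_one_le (by linarith)]; ring
  have h2 : ∫ η in (-2:ℝ)..2, ee (η * j) * stp (2 * η + (-1/2)) =
      ∫ η in (-3:ℝ)..1, ee (η * j) * stp (2 * η + 3/2) := by
    have := intervalIntegral.integral_comp_add_right (a := -3) (b := 1)
      (fun η : ℝ => ee (η * j) * stp (2 * η + (-1/2))) 1
    rw [show (-3:ℝ) + 1 = -2 by norm_num, show (1:ℝ) + 1 = 2 by norm_num] at this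
    rw [← this]
    refine intervalIntegral.integral_congr fun η _ => ?_
    rw [add_mul, ee_add, one_mul, ee_int, mul_one]
    congr 2; ring
  rw [h1, intervalIntegral.integral_sub (hi _ _ _) (hi _ _ _), h2]
  rw [← intervalIntegral.integral_add_adjacent_intervals (hi (3/2) (-2) 1) (hi (3/2) 1 2),
    ← intervalIntegral.integral_add_adjacent_intervals (hi (3/2) (-3) (-2)) (hi (3/2) (-2) 1)]
  have h3 : ∫ η in (-3:ℝ)..(-2), ee (η * j) * stp (2 * η + 3/2) = 0 := by
    rw [intervalIntegral.integral_congr (g := fun _ => (0:ℂ)), intervalIntegral.integral_zero]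
    intro η hη
    rw [uIcc_of_le (by norm_num)] at hη
    simp only; rw [stp_of_nonpos (by linarith [hη.2]), mul_zero]
  have h4 : ∫ η in (1:ℝ)..2, ee (η * j) * stp (2 * η + 3/2) = ∫ η in (1:ℝ)..(1+1), ee (η * j) := by
    rw [show (1:ℝ) + 1 = 2 by norm_num]
    refine intervalIntegral.integral_congr fun η hη => ?_
    rw [uIcc_of_le (by norm_num)] at hη
    rw [stp_of_one_le (by linarith [hη.1]), mul_one]
  rw [h3, h4]
  split_ifs with h
  · subst h; simp
  · rw [integral_ee_int h]; ring

noncomputable def pk (k : ℕ) (l : ℤ) (x : ℝ) : ℂ :=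
  (((2 ^ k : ℝ)⁻¹ : ℝ) : ℂ) * phi (x / 2 ^ k) * ee (l / 2 ^ k * x)

noncomputable def psik (k : ℕ) (x : ℝ) : ℂ := (((2 ^ k : ℝ)⁻¹ : ℝ) : ℂ) * psi (x / 2 ^ k)

lemma bandLimited_pk (k : ℕ) (l : ℤ) :
    BandLimited (pk k l) ((l - 3 / 4) / 2 ^ k) ((l + 3 / 4) / 2 ^ k) := by
  have := (bandLimited_phi.dilate (A := 2 ^ k) (by positivity)).modulate (l / 2 ^ k)
  rw [show ((l:ℝ) - 3 / 4) / 2 ^ k = -(3 / 4) / 2 ^ k + l / 2 ^ k by ring,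
    show ((l:ℝ) + 3 / 4) / 2 ^ k = 3 / 4 / 2 ^ k + l / 2 ^ k by ring]
  exact this

lemma bandLimited_psik (k : ℕ) : BandLimited (psik k) (16 / 2 ^ k) (64 / 2 ^ k) :=
  bandLimited_psi.dilate (A := 2 ^ k) (by positivity)

lemma norm_pk (k : ℕ) (l : ℤ) (x : ℝ) : ‖pk k l x‖ = (2 ^ k)⁻¹ * ‖phi (x / 2 ^ k)‖ := by
  rw [pk, norm_mul, norm_mul, norm_ee, mul_one, Complex.norm_real, Real.norm_of_nonneg (by positivity)]

lemma exists_pk_decay : ∃ B, 0 < B ∧ ∀ k l x,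
    ‖pk k l x‖ ≤ B * (2 ^ k)⁻¹ * ((1 + |x| / 2 ^ k) ^ 6)⁻¹ := by
  obtain ⟨B, hB, h⟩ := bandLimited_phi.decay 6
  refine ⟨B, hB, fun k l x => ?_⟩
  rw [norm_pk]
  have := h (x / 2 ^ k)
  rw [abs_div, abs_of_pos (by positivity : (0:ℝ) < 2 ^ k)] at this
  calc _ ≤ (2 ^ k : ℝ)⁻¹ * (B * ((1 + |x| / 2 ^ k) ^ 6)⁻¹) := by gcongr
    _ = _ := by ring

lemma exists_psik_decay (n : ℕ) : ∃ B, 0 < B ∧ ∀ k x,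
    ‖psik k x‖ ≤ B * (2 ^ k)⁻¹ * ((1 + |x| / 2 ^ k) ^ n)⁻¹ := by
  obtain ⟨B, hB, h⟩ := bandLimited_psi.decay n
  refine ⟨B, hB, fun k x => ?_⟩
  have := h (x / 2 ^ k)
  rw [abs_div, abs_of_pos (by positivity : (0:ℝ) < 2 ^ k)] at this
  rw [psik, norm_mul, Complex.norm_real, Real.norm_of_nonneg (by positivity)]
  calc _ ≤ (2 ^ k : ℝ)⁻¹ * (B * ((1 + |x| / 2 ^ k) ^ n)⁻¹) := by gcongr
    _ = _ := by ring

lemma ee_eq_one_iff {x : ℝ} (h : ee x = 1) : ∃ n : ℤ, x = n := by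
  obtain ⟨n, hn⟩ := Complex.exp_eq_one_iff.1 h
  refine ⟨n, ?_⟩
  have h1 : ((2 * π * x : ℝ) : ℂ) * Complex.I = ((n * (2 * π) : ℝ) : ℂ) * Complex.I := by
    rw [hn]; push_cast; ring
  have h2 := mul_right_cancel₀ Complex.I_ne_zero h1
  have h3 : 2 * π * x = n * (2 * π) := by exact_mod_cast h2
  have := Real.pi_pos
  nlinarith

lemma sum_Ico_telescope (F : ℤ → ℂ) (b : ℤ) (n : ℕ) :
    ∑ l ∈ Finset.Ico b (b + n), (F (l + 1) - F l) = F (b + n) - F b := by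
  induction n with
  | zero => simp
  | succ n ih =>
    have : Finset.Ico b (b + (n + 1 : ℕ)) = insert (b + n) (Finset.Ico b (b + n)) := by
      ext x; simp only [Finset.mem_Ico, Finset.mem_insert]; push_cast; omega
    rw [this, Finset.sum_insert (by simp), ih]
    push_cast; rw [add_assoc]; ring

lemma sum_pk (k : ℕ) (b n : ℤ) :
    ∑ l ∈ Finset.Ico b (b + 2 ^ k), pk k l n = if n = 0 then 1 else 0 := by
  have hN : (0:ℝ) < 2 ^ k := by positivity
  by_cases hd : ∃ j : ℤ, (n / 2 ^ k : ℝ) = j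
  · obtain ⟨j, hj⟩ := hd
    have hnj : n = 2 ^ k * j := by
      rw [div_eq_iff hN.ne'] at hj
      have : (n : ℝ) = ((2 ^ k * j : ℤ) : ℝ) := by push_cast; rw [hj]; ring
      exact_mod_cast this
    have : ∀ l ∈ Finset.Ico b (b + 2 ^ k), pk k l n = (((2 ^ k : ℝ)⁻¹ : ℝ) : ℂ) * phi j := by
      intro l _
      have e : (l / 2 ^ k * n : ℝ) = ((l * j : ℤ) : ℝ) := by push_cast; rw [← hj]; ring
      rw [pk, hj, e, ee_int, mul_one]
    rw [Finset.sum_congr rfl this, Finset.sum_const, Int.card_Ico, phi_int]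
    have e2 : (b + 2 ^ k - b).toNat = 2 ^ k := by
      rw [add_sub_cancel_left]; exact_mod_cast Int.toNat_natCast (2 ^ k)
    rw [e2]
    have : j = 0 ↔ n = 0 := by rw [hnj]; simp
    simp only [this]
    split_ifs <;> simp
  · have hn : n ≠ 0 := by rintro rfl; exact hd ⟨0, by simp⟩
    rw [if_neg hn]
    simp only [pk, ← Finset.mul_sum]
    have h1 : ee (n / 2 ^ k) - 1 ≠ 0 := fun h => hd (ee_eq_one_iff (sub_eq_zero.1 h))
    have h2 := sum_Ico_telescope (fun l => ee (l / 2 ^ k * n)) b (2 ^ k)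
    have h3 : ∀ l : ℤ, ee (((l + 1 : ℤ) : ℝ) / 2 ^ k * n) - ee (l / 2 ^ k * n) =
        (ee (n / 2 ^ k) - 1) * ee (l / 2 ^ k * n) := by
      intro l
      have : (((l + 1 : ℤ) : ℝ) / 2 ^ k * n) = n / 2 ^ k + l / 2 ^ k * n := by push_cast; ring
      rw [this, ee_add]; ring
    have h4 : ee (((b + (2 ^ k : ℕ) : ℤ) : ℝ) / 2 ^ k * n) = ee (b / 2 ^ k * n) := by
      have : (((b + (2 ^ k : ℕ) : ℤ) : ℝ) / 2 ^ k * n) = n + b / 2 ^ k * n := by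
        push_cast; field_simp; ring
      rw [this, ee_add, ee_int, one_mul]
    simp only [h3, h4, sub_self, ← Finset.mul_sum] at h2
    have h5 := (mul_eq_zero.1 h2).resolve_left h1
    push_cast at h5
    rw [h5, mul_zero]

lemma sum_psik (N : ℕ) (hN : 8 ≤ N) (t : ℝ) :
    2 * π * Complex.I * t * ∑ k ∈ Finset.Ico 8 N, psik k t =
      stpE (t / 8) - stpE (32 * (t / 2 ^ N)) := by
  have h : ∀ k : ℕ, 2 * π * Complex.I * t * psik k t =
      stpE (32 * (t / 2 ^ k)) - stpE (32 * (t / 2 ^ (k + 1))) := by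
    intro k
    have := mul_psi (t / 2 ^ k)
    rw [show 32 * (t / 2 ^ (k + 1)) = 16 * (t / 2 ^ k) by rw [pow_succ]; field_simp; ring, ← this, psik]
    push_cast; ring
  rw [Finset.mul_sum, Finset.sum_congr rfl fun k _ => h k,
    Finset.sum_Ico_eq_sum_range]
  have : ∀ M : ℕ, ∑ i ∈ Finset.range M, (stpE (32 * (t / 2 ^ (8 + i))) - stpE (32 * (t / 2 ^ (8 + i + 1)))) =
      stpE (32 * (t / 2 ^ 8)) - stpE (32 * (t / 2 ^ (8 + M))) := by
    intro M
    induction M with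
    | zero => simp
    | succ M ih => rw [Finset.sum_range_succ, ih]; simp only [← add_assoc]; ring
  rw [this, show 32 * (t / 2 ^ 8) = t / 8 by ring, Nat.add_sub_cancel' hN]

lemma pk_orth {k k' : ℕ} {l l' : ℤ} (y y' : ℝ)
    (h1 : (2 ^ k : ℝ)⁻¹ + (2 ^ k' : ℝ)⁻¹ ≤ |(l / 2 ^ k : ℝ) - l' / 2 ^ k'|)
    (h2 : |(l / 2 ^ k : ℝ) - l' / 2 ^ k'| ≤ 1 - ((2 ^ k : ℝ)⁻¹ + (2 ^ k' : ℝ)⁻¹)) :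
    ∑' x : ℤ, pk k l (y - x) * starRingEnd ℂ (pk k' l' (y' - x)) = 0 := by
  have a1 := ((bandLimited_pk k l).translate y).neg
  have a2 := ((bandLimited_pk k' l').translate y').neg.conj
  have := a1.mul a2
  simp only [neg_add_eq_sub] at this
  refine this.tsum_eq_zero fun n hn => ?_
  have p1 : (0:ℝ) < (2 ^ k)⁻¹ := by positivity
  have p2 : (0:ℝ) < (2 ^ k')⁻¹ := by positivity
  obtain ⟨b1, b2⟩ := hn
  simp only [div_eq_mul_inv, add_mul, sub_mul, neg_neg] at b1 b2 h1 h2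
  have hn1 : |(n:ℝ)| < 1 := by
    rw [abs_le] at h2
    rw [abs_lt]; constructor <;> nlinarith
  have hn0 : n = 0 := by
    rw [← Int.cast_abs] at hn1
    have : |n| < 1 := by exact_mod_cast hn1
    exact Int.abs_lt_one_iff.1 this
  rw [hn0] at b1 b2
  push_cast at b1 b2
  rcases le_abs.1 h1 with h | h <;> nlinarith

section

variable {H : Type*} [NormedAddCommGroup H] [InnerProductSpace ℂ H]

/-- The frequency localized piece of a finitely supported function. -/
noncomputable def piece (k : ℕ) (l : ℤ) (s : Finset ℤ) (f : ℤ → H) (y : ℤ) : H :=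
  ∑ x ∈ s, pk k l ((y : ℝ) - x) • f x

/-- Wave packets centred at prescribed points. -/
noncomputable def pack (c y : Tile → ℤ) (P : Tile) (x : ℤ) : ℂ :=
  ((((1 + |y P - P.pos| / 2 ^ P.k) ^ 6)⁻¹ : ℝ) : ℂ) * pk P.k (c P) ((y P : ℝ) - x)

lemma sum_piece (k : ℕ) (L b : ℤ) {s : Finset ℤ} {f : ℤ → H} (hf : ∀ x, x ∉ s → f x = 0) (y : ℤ) :
    ∑ l ∈ Finset.Ico b (b + 2 ^ k), piece k (L + l) s f y = f y := by
  have h : ∀ n : ℤ, ∑ l ∈ Finset.Ico b (b + 2 ^ k), pk k (L + l) n = if n = 0 then 1 else 0 := by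
    intro n
    have e : ∀ l : ℤ, pk k (L + l) n = pk k l n * ee (L / 2 ^ k * n) := by
      intro l
      rw [pk, pk, show (((L + l : ℤ) : ℝ) / 2 ^ k * n) = l / 2 ^ k * n + L / 2 ^ k * n by push_cast; ring,
        ee_add]
      ring
    simp only [e, ← Finset.sum_mul, sum_pk]
    split_ifs with h0
    · subst h0; simp
    · simp
  simp only [piece]
  rw [Finset.sum_comm]
  simp only [← Finset.sum_smul]
  have h' : ∀ x : ℤ, ∑ l ∈ Finset.Ico b (b + 2 ^ k), pk k (L + l) ((y:ℝ) - x) =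
      if y = x then 1 else 0 := by
    intro x
    have := h (y - x)
    push_cast at this
    rw [this]; simp only [sub_eq_zero]
  simp only [h', ite_smul, one_smul, zero_smul, Finset.sum_ite_eq]
  split_ifs with hy
  · rfl
  · exact (hf y hy).symm

lemma coef_pack (c y : Tile → ℤ) (s : Finset ℤ) (f : ℤ → H) (P : Tile) :
    coef (pack c y) s f P =
      ((1 + |y P - P.pos| / 2 ^ P.k) ^ 6)⁻¹ * ‖piece P.k (c P) s f (y P)‖ := by
  have hw : (0:ℝ) ≤ ((1 + |y P - P.pos| / 2 ^ P.k) ^ 6)⁻¹ := by positivity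
  rw [coef, piece]
  simp only [pack, mul_smul, ← Finset.smul_sum]
  rw [norm_smul, Complex.norm_real, Real.norm_of_nonneg hw]

lemma norm_piece_le (k : ℕ) (s : Finset ℤ) (f : ℤ → H) :
    ∃ M, 0 ≤ M ∧ ∀ l y, ‖piece k l s f y‖ ≤ M := by
  obtain ⟨B, hB, h⟩ := exists_pk_decay
  refine ⟨∑ x ∈ s, B * (2 ^ k)⁻¹ * ‖f x‖, Finset.sum_nonneg fun _ _ => by positivity, fun l y => ?_⟩
  refine (norm_sum_le _ _).trans (Finset.sum_le_sum fun x _ => ?_)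
  rw [norm_smul]
  refine mul_le_mul_of_nonneg_right ((h _ _ _).trans ?_) (norm_nonneg _)
  have : ((1 + |(y:ℝ) - x| / 2 ^ k) ^ 6)⁻¹ ≤ 1 := by
    refine inv_le_one_of_one_le₀ (one_le_pow₀ ?_)
    have : 0 ≤ |(y:ℝ) - x| / 2 ^ k := by positivity
    linarith
  exact mul_le_of_le_one_right (by positivity) this

lemma exists_near_max (w : ℤ → ℝ) (h0 : ∀ z, 0 ≤ w z) (M : ℝ) (hM : ∀ z, w z ≤ M) :
    ∃ y, ∀ z, w z ≤ 2 * w y := by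
  by_cases h : ∃ z, 0 < w z
  · obtain ⟨z₀, hz₀⟩ := h
    have hb : BddAbove (range w) := ⟨M, by rintro _ ⟨z, rfl⟩; exact hM z⟩
    have hp : 0 < ⨆ z, w z := hz₀.trans_le (le_ciSup hb z₀)
    obtain ⟨y, hy⟩ := exists_lt_of_lt_ciSup (half_lt_self hp)
    exact ⟨y, fun z => by have := le_ciSup hb z; linarith⟩
  · push Not at h
    exact ⟨0, fun z => by linarith [h z, h0 0]⟩

lemma exists_pack (c : Tile → ℤ) (s : Finset ℤ) (f : ℤ → H) : ∃ y : Tile → ℤ, ∀ P z,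
    ‖piece P.k (c P) s f z‖ ≤
      2 * coef (pack c y) s f P * (1 + |z - P.pos| / 2 ^ P.k) ^ 6 := by
  have : ∀ P : Tile, ∃ y : ℤ, ∀ z : ℤ,
      ((1 + |z - P.pos| / 2 ^ P.k) ^ 6)⁻¹ * ‖piece P.k (c P) s f z‖ ≤
      2 * (((1 + |y - P.pos| / 2 ^ P.k) ^ 6)⁻¹ * ‖piece P.k (c P) s f y‖) := by
    intro P
    obtain ⟨M, hM, h⟩ := norm_piece_le P.k s f
    refine exists_near_max (fun z : ℤ => ((1 + |z - P.pos| / 2 ^ P.k) ^ 6)⁻¹ *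
      ‖piece P.k (c P) s f z‖) (fun z => by positivity) M fun z => ?_
    have h1 : ((1 + |(z:ℝ) - P.pos| / 2 ^ P.k) ^ 6)⁻¹ ≤ 1 := by
      refine inv_le_one_of_one_le₀ (one_le_pow₀ ?_)
      have : 0 ≤ |(z:ℝ) - P.pos| / 2 ^ P.k := by positivity
      linarith
    exact (mul_le_of_le_one_left (norm_nonneg _) h1).trans (h _ _)
  choose y hy using this
  refine ⟨y, fun P z => ?_⟩
  have := hy P z
  rw [← coef_pack c y s f P, inv_mul_le_iff₀ (by positivity)] at this
  linarith

lemma isPacket_pack : ∃ B, 0 ≤ B ∧ ∀ (σ d : ℤ), |σ| ≤ 2 → |d| ≤ 70 → ∀ (R : Finset Tile) (i : ℤ)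
    (_ : ∀ P ∈ R, 8 ≤ P.k ∧ (i:ℝ) ≤ 8 * (P.l / 2 ^ P.k) ∧ 8 * (P.l / 2 ^ P.k : ℝ) < i + 1)
    (c y : Tile → ℤ) (ε : ℤ) (_ : |ε| = 1) (_ : ∀ P, c P = ε * (σ * P.l + d)),
    IsPacket σ d B R (pack c y) := by
  obtain ⟨B, hB, h⟩ := exists_pk_decay
  refine ⟨B, hB.le, fun σ d hσ hd R i hR c y ε hε hc => ⟨fun P hP x => ?_, fun P hP Q hQ h1 h2 => ?_⟩⟩
  · rw [pack, norm_mul, Complex.norm_real, Real.norm_of_nonneg (by positivity)]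
    have hA : (0:ℝ) < 2 ^ P.k := by positivity
    set A : ℝ := 2 ^ P.k
    have hw : wt (x - P.pos) P.k * ((1 + |x - P.pos| / A) ^ 2)⁻¹ = ((1 + |x - P.pos| / A) ^ 6)⁻¹ := by
      rw [wt, ← mul_inv, ← pow_add]
    rw [hw]
    have h3 := h P.k (c P) ((y P : ℝ) - x)
    have key : ((1 + |y P - P.pos| / A) ^ 6)⁻¹ * ((1 + |(y P : ℝ) - x| / A) ^ 6)⁻¹ ≤
        ((1 + |x - P.pos| / A) ^ 6)⁻¹ := by
      rw [← mul_inv, ← mul_pow]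
      gcongr
      have h5 : |x - P.pos| ≤ |y P - P.pos| + |(y P : ℝ) - x| := by
        rw [abs_sub_comm (y P : ℝ) x, add_comm]
        exact abs_sub_le _ _ _
      have h6 : |x - P.pos| / A ≤ |y P - P.pos| / A + |(y P : ℝ) - x| / A := by
        rw [← add_div]; gcongr
      have h7 : 0 ≤ |y P - P.pos| / A := by positivity
      have h8 : 0 ≤ |(y P : ℝ) - x| / A := by positivity
      nlinarith
    calc _ ≤ ((1 + |y P - P.pos| / A) ^ 6)⁻¹ * (B * A⁻¹ * ((1 + |(y P : ℝ) - x| / A) ^ 6)⁻¹) := by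
          gcongr
      _ = B * A⁻¹ * (((1 + |y P - P.pos| / A) ^ 6)⁻¹ * ((1 + |(y P : ℝ) - x| / A) ^ 6)⁻¹) := by ring
      _ ≤ _ := by gcongr
  · have e : ∀ x : ℤ, pack c y P x * starRingEnd ℂ (pack c y Q x) =
        ((((1 + |y P - P.pos| / 2 ^ P.k) ^ 6)⁻¹ : ℝ) : ℂ) *
        ((((1 + |y Q - Q.pos| / 2 ^ Q.k) ^ 6)⁻¹ : ℝ) : ℂ) *
        (pk P.k (c P) ((y P : ℝ) - x) * starRingEnd ℂ (pk Q.k (c Q) ((y Q : ℝ) - x))) := by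
      intro x
      rw [pack, pack, map_mul, Complex.conj_ofReal]; ring
    simp only [e]
    rw [tsum_mul_left, pk_orth, mul_zero]
    all_goals
      have pP : (0:ℝ) < 2 ^ P.k := by positivity
      have pQ : (0:ℝ) < 2 ^ Q.k := by positivity
      have hcc : |(c P / 2 ^ P.k : ℝ) - c Q / 2 ^ Q.k| = |P.cen σ d / 2 ^ P.k - Q.cen σ d / 2 ^ Q.k| := by
        have : (c P / 2 ^ P.k : ℝ) - c Q / 2 ^ Q.k = ε * (P.cen σ d / 2 ^ P.k - Q.cen σ d / 2 ^ Q.k) := by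
          rw [hc, hc]; simp only [Tile.cen]; push_cast; ring
        rw [this, abs_mul, show |(ε:ℝ)| = 1 by exact_mod_cast hε, one_mul]
      rw [hcc]
    · have near : ∀ P Q : Tile, P.k ≤ Q.k → ¬ Near σ d P Q →
          ((2 ^ P.k : ℝ)⁻¹ + (2 ^ Q.k : ℝ)⁻¹) ≤ |P.cen σ d / 2 ^ P.k - Q.cen σ d / 2 ^ Q.k| := by
        intro P Q hk hn
        have pP : (0:ℝ) < 2 ^ P.k := by positivity
        have := not_lt.1 fun h => hn ⟨hk, h⟩
        have e2 : P.cen σ d - 2 ^ P.k / 2 ^ Q.k * Q.cen σ d =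
          2 ^ P.k * (P.cen σ d / 2 ^ P.k - Q.cen σ d / 2 ^ Q.k) := by field_simp
        rw [e2, abs_mul, abs_of_pos pP] at this
        have e3 : (1:ℝ) + 2 ^ P.k / 2 ^ Q.k = 2 ^ P.k * ((2 ^ P.k : ℝ)⁻¹ + (2 ^ Q.k : ℝ)⁻¹) := by
          field_simp
        rw [e3] at this
        exact le_of_mul_le_mul_left this pP
      rcases le_total P.k Q.k with hk | hk
      · exact near P Q hk h1
      · rw [add_comm, abs_sub_comm]; exact near Q P hk h2
    · obtain ⟨kP, aP, bP⟩ := hR P hP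
      obtain ⟨kQ, aQ, bQ⟩ := hR Q hQ
      have gP : (2 ^ P.k : ℝ)⁻¹ ≤ 1 / 256 := by
        rw [one_div]; gcongr
        calc (256:ℝ) = 2 ^ 8 := by norm_num
          _ ≤ _ := pow_le_pow_right₀ (by norm_num) kP
      have gQ : (2 ^ Q.k : ℝ)⁻¹ ≤ 1 / 256 := by
        rw [one_div]; gcongr
        calc (256:ℝ) = 2 ^ 8 := by norm_num
          _ ≤ _ := pow_le_pow_right₀ (by norm_num) kQ
      have gP0 : 0 < (2 ^ P.k : ℝ)⁻¹ := by positivity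
      have gQ0 : 0 < (2 ^ Q.k : ℝ)⁻¹ := by positivity
      have e4 : P.cen σ d / 2 ^ P.k - Q.cen σ d / 2 ^ Q.k =
          σ * (P.l / 2 ^ P.k - Q.l / 2 ^ Q.k) + d * ((2 ^ P.k : ℝ)⁻¹ - (2 ^ Q.k : ℝ)⁻¹) := by
        simp only [Tile.cen]; push_cast; ring
      have hσ' : |(σ:ℝ)| ≤ 2 := by exact_mod_cast hσ
      have hd' : |(d:ℝ)| ≤ 70 := by exact_mod_cast hd
      have m1 : |(P.l / 2 ^ P.k - Q.l / 2 ^ Q.k : ℝ)| ≤ 1 / 8 := by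
        rw [abs_le]; constructor <;> linarith
      have m2 : |(2 ^ P.k : ℝ)⁻¹ - (2 ^ Q.k : ℝ)⁻¹| ≤ 1 / 256 := by
        rw [abs_le]; constructor <;> linarith
      rw [e4]
      refine (abs_add_le _ _).trans ?_
      rw [abs_mul, abs_mul]
      have := mul_le_mul hσ' m1 (abs_nonneg _) (by norm_num)
      have := mul_le_mul hd' m2 (abs_nonneg _) (by norm_num)
      linarith

end

lemma BandLimited.hasSum_zero {u : ℝ → ℂ} {a b : ℝ} (h : BandLimited u a b)
    (hab : ∀ n : ℤ, (n : ℝ) ∉ Icc a b) : HasSum (fun n : ℤ => u n) 0 := by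
  rw [← h.tsum_eq_zero hab]
  exact h.summable.of_norm.hasSum

lemma two_pow_ge {k : ℕ} (hk : 8 ≤ k) : (256 : ℤ) ≤ 2 ^ k :=
  calc (256:ℤ) = 2 ^ 8 := by norm_num
    _ ≤ _ := pow_le_pow_right₀ (by norm_num) hk

lemma int_notMem_Icc {A : ℝ} (hA : 0 < A) {u v : ℝ} (h : (0 < u ∧ v < A) ∨ (-A < u ∧ v < 0)) (n : ℤ) :
    (n : ℝ) ∉ Icc (u / A) (v / A) := by
  rintro ⟨h1, h2⟩
  rw [div_le_iff₀ hA] at h1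
  rw [le_div_iff₀ hA] at h2
  rcases h with ⟨h3, h4⟩ | ⟨h3, h4⟩
  · have p1 : (0:ℝ) < n := by by_contra hn; push Not at hn; nlinarith
    have p2 : (n:ℝ) < 1 := by by_contra hn; push Not at hn; nlinarith
    have q1 : 0 < n := by exact_mod_cast p1
    have q2 : n < 1 := by exact_mod_cast p2
    omega
  · have p1 : (n:ℝ) < 0 := by by_contra hn; push Not at hn; nlinarith
    have p2 : (-1:ℝ) < n := by by_contra hn; push Not at hn; nlinarith
    have q1 : n < 0 := by exact_mod_cast p1
    have q2 : -1 < n := by exact_mod_cast p2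
    omega

lemma hasSum_shift {k : ℕ} (hk : 8 ≤ k) (l : ℤ) {D : ℤ} (h1 : -70 ≤ D) (h2 : D < -70 + 2 ^ k)
    (h3 : ¬ (-65 ≤ D ∧ D ≤ -15)) (a b : ℝ) :
    HasSum (fun t : ℤ => pk k l (a - t) * pk k (l + D) (b + t) * psik k t) 0 := by
  have b1 := ((bandLimited_pk k l).translate a).neg
  have b2 := (bandLimited_pk k (l + D)).translate b
  have := (b1.mul b2).mul (bandLimited_psik k)
  simp only [neg_add_eq_sub, add_comm _ b] at this
  refine this.hasSum_zero ?_
  have hA := two_pow_ge hk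
  have hA' : (256:ℝ) ≤ 2 ^ k := by exact_mod_cast hA
  have h2' : (D:ℝ) + 71 ≤ 2 ^ k := by exact_mod_cast (by omega : D + 71 ≤ 2 ^ k)
  have h1' : (-70:ℝ) ≤ D := by exact_mod_cast h1
  have e1 : (((l + D : ℤ) : ℝ) - 3 / 4) / 2 ^ k - (l + 3 / 4) / 2 ^ k + 16 / 2 ^ k =
      (D + 29 / 2) / 2 ^ k := by push_cast; ring
  have e2 : (((l + D : ℤ) : ℝ) + 3 / 4) / 2 ^ k - (l - 3 / 4) / 2 ^ k + 64 / 2 ^ k =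
      (D + 131 / 2) / 2 ^ k := by push_cast; ring
  rw [e1, e2]
  refine int_notMem_Icc (by positivity) ?_
  rcases lt_or_ge D (-65) with h | h
  · right
    have : (D:ℝ) + 66 ≤ 0 := by exact_mod_cast (by omega : D + 66 ≤ 0)
    constructor <;> linarith
  · left
    have : (-14:ℝ) ≤ D := by exact_mod_cast (by omega : -14 ≤ D)
    constructor <;> linarith

lemma hasSum_translate {k : ℕ} (hk : 8 ≤ k) (l l' : ℤ) {E : ℤ} (h1 : -3 ≤ E) (h2 : E < -3 + 2 ^ k)
    (h3 : ¬ (-2 ≤ E ∧ E ≤ 2)) (a b c : ℝ) :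
    HasSum (fun x : ℤ => pk k l (x + a) * pk k l' (x + b) *
      starRingEnd ℂ (pk k (l + l' + E) (x + c))) 0 := by
  have b1 := (bandLimited_pk k l).translate a
  have b2 := (bandLimited_pk k l').translate b
  have b3 := ((bandLimited_pk k (l + l' + E)).translate c).conj
  have := (b1.mul b2).mul b3
  refine this.hasSum_zero ?_
  have hA := two_pow_ge hk
  have hA' : (256:ℝ) ≤ 2 ^ k := by exact_mod_cast hA
  have h2' : (E:ℝ) + 4 ≤ 2 ^ k := by exact_mod_cast (by omega : E + 4 ≤ 2 ^ k)
  have h1' : (-3:ℝ) ≤ E := by exact_mod_cast h1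
  have e1 : ((l:ℝ) - 3 / 4) / 2 ^ k + (l' - 3 / 4) / 2 ^ k + -((((l + l' + E : ℤ) : ℝ) + 3 / 4) / 2 ^ k) =
      (-E - 9 / 4) / 2 ^ k := by push_cast; ring
  have e2 : ((l:ℝ) + 3 / 4) / 2 ^ k + (l' + 3 / 4) / 2 ^ k + -((((l + l' + E : ℤ) : ℝ) - 3 / 4) / 2 ^ k) =
      (-E + 9 / 4) / 2 ^ k := by push_cast; ring
  rw [e1, e2]
  refine int_notMem_Icc (by positivity) ?_
  rcases lt_or_ge E (-2) with h | h
  · left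
    have : (E:ℝ) + 3 ≤ 0 := by exact_mod_cast (by omega : E + 3 ≤ 0)
    constructor <;> linarith
  · right
    have : (3:ℝ) ≤ E := by exact_mod_cast (by omega : 3 ≤ E)
    constructor <;> linarith

section
variable {H₁ H₂ H₃ : Type*} [NormedAddCommGroup H₁] [InnerProductSpace ℂ H₁]
  [NormedAddCommGroup H₂] [InnerProductSpace ℂ H₂] [NormedAddCommGroup H₃] [InnerProductSpace ℂ H₃]

/-- The contribution of three frequencies to the model trilinear form. -/
noncomputable def localForm (β : H₁ →ₗ[ℂ] H₂ →ₗ[ℂ] H₃) (s₁ s₂ s₃ : Finset ℤ) (f₁ : ℤ → H₁)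
    (f₂ : ℤ → H₂) (f₃ : ℤ → H₃) (k : ℕ) (l D E : ℤ) (z : ℤ × ℤ) : ℂ :=
  inner ℂ (piece k (l + (l + D) + E) s₃ f₃ z.1)
    (β (piece k l s₁ f₁ (z.1 - z.2)) (piece k (l + D) s₂ f₂ (z.1 + z.2))) * psik k z.2

variable (β : H₁ →ₗ[ℂ] H₂ →ₗ[ℂ] H₃) (s₁ s₂ s₃ : Finset ℤ) (f₁ : ℤ → H₁)
    (f₂ : ℤ → H₂) (f₃ : ℤ → H₃)

lemma localForm_eq (k : ℕ) (l D E : ℤ) (z : ℤ × ℤ) :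
    localForm β s₁ s₂ s₃ f₁ f₂ f₃ k l D E z = ∑ a ∈ s₁, ∑ b ∈ s₂, ∑ c ∈ s₃,
      pk k l ((z.1 : ℝ) - z.2 - a) * pk k (l + D) ((z.1 : ℝ) + z.2 - b) *
      starRingEnd ℂ (pk k (l + (l + D) + E) (z.1 - c)) * psik k z.2 * inner ℂ (f₃ c) (β (f₁ a) (f₂ b)) := by
  simp only [localForm, piece, map_sum, map_smul, LinearMap.sum_apply, LinearMap.smul_apply,
    sum_inner, inner_sum, inner_smul_left, inner_smul_right, Finset.sum_mul, Finset.mul_sum]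
  rw [Finset.sum_comm]
  refine Finset.sum_congr rfl fun a _ => Finset.sum_congr rfl fun b _ => Finset.sum_congr rfl
    fun c _ => ?_
  rw [Int.cast_sub, Int.cast_add]
  ring

lemma localForm_tsum_eq_zero_of_shift {k : ℕ} (hk : 8 ≤ k) (l : ℤ) {D : ℤ} (E : ℤ) (h1 : -70 ≤ D)
    (h2 : D < -70 + 2 ^ k) (h3 : ¬ (-65 ≤ D ∧ D ≤ -15)) (x : ℤ) :
    ∑' t, localForm β s₁ s₂ s₃ f₁ f₂ f₃ k l D E (x, t) = 0 := by
  refine HasSum.tsum_eq ?_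
  simp only [localForm_eq]
  rw [show (0:ℂ) = ∑ a ∈ s₁, ∑ b ∈ s₂, ∑ c ∈ s₃, 0 by simp]
  refine hasSum_sum fun a _ => hasSum_sum fun b _ => hasSum_sum fun c _ => ?_
  have := (hasSum_shift hk l h1 h2 h3 (x - a) (x - b)).mul_left
    (starRingEnd ℂ (pk k (l + (l + D) + E) (x - c)) * inner ℂ (f₃ c) (β (f₁ a) (f₂ b)))
  rw [mul_zero] at this
  refine HasSum.congr_fun this fun t => ?_
  rw [show (x:ℝ) - t - a = x - a - t by ring, show (x:ℝ) + t - b = x - b + t by ring]; ring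

lemma localForm_tsum_eq_zero_of_translate {k : ℕ} (hk : 8 ≤ k) (l D : ℤ) {E : ℤ} (h1 : -3 ≤ E)
    (h2 : E < -3 + 2 ^ k) (h3 : ¬ (-2 ≤ E ∧ E ≤ 2)) (t : ℤ) :
    ∑' x, localForm β s₁ s₂ s₃ f₁ f₂ f₃ k l D E (x, t) = 0 := by
  refine HasSum.tsum_eq ?_
  simp only [localForm_eq]
  rw [show (0:ℂ) = ∑ a ∈ s₁, ∑ b ∈ s₂, ∑ c ∈ s₃, 0 by simp]
  refine hasSum_sum fun a _ => hasSum_sum fun b _ => hasSum_sum fun c _ => ?_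
  have := (hasSum_translate hk l (l + D) h1 h2 h3 (-t - a) (t - b) (-c)).mul_left
    (psik k t * inner ℂ (f₃ c) (β (f₁ a) (f₂ b)))
  rw [mul_zero] at this
  refine HasSum.congr_fun this fun x => ?_
  rw [show (x:ℝ) - t - a = x + (-t - a) by ring, show (x:ℝ) + t - b = x + (t - b) by ring,
    show (x:ℝ) - c = x + -c by ring]; ring

variable (hβ : ∀ a b, ‖β a b‖ ≤ ‖a‖ * ‖b‖)
include hβ

lemma norm_localForm_le (k : ℕ) (l D E : ℤ) (z : ℤ × ℤ) :
    ‖localForm β s₁ s₂ s₃ f₁ f₂ f₃ k l D E z‖ ≤ ‖piece k l s₁ f₁ (z.1 - z.2)‖ *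
      ‖piece k (l + D) s₂ f₂ (z.1 + z.2)‖ * ‖piece k (l + (l + D) + E) s₃ f₃ z.1‖ * ‖psik k z.2‖ := by
  rw [localForm, norm_mul]
  refine mul_le_mul_of_nonneg_right ((norm_inner_le_norm _ _).trans ?_) (norm_nonneg _)
  rw [mul_comm]
  exact mul_le_mul_of_nonneg_right (hβ _ _) (norm_nonneg _)

lemma summable_norm_localForm (k : ℕ) (l D E : ℤ) :
    Summable fun z => ‖localForm β s₁ s₂ s₃ f₁ f₂ f₃ k l D E z‖ := by
  obtain ⟨M₁, h₁, hM₁⟩ := norm_piece_le k s₁ f₁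
  obtain ⟨M₂, h₂, hM₂⟩ := norm_piece_le k s₂ f₂
  have h3 : Summable fun x : ℤ => ‖piece k (l + (l + D) + E) s₃ f₃ x‖ := by
    refine Summable.of_nonneg_of_le (fun _ => norm_nonneg _) (fun x => norm_sum_le _ _) ?_
    refine summable_sum fun c _ => ?_
    simp only [norm_smul]
    exact ((bandLimited_pk k _).translate (-c)).summable.mul_right _
  have h4 : Summable fun t : ℤ => ‖psik k t‖ := (bandLimited_psik k).summable
  refine Summable.of_nonneg_of_le (fun _ => norm_nonneg _) (fun z => ?_)
    ((h3.mul_of_nonneg h4 (fun _ => norm_nonneg _) (fun _ => norm_nonneg _)).mul_left (M₁ * M₂))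
  refine (norm_localForm_le β s₁ s₂ s₃ f₁ f₂ f₃ hβ k l D E z).trans ?_
  rw [mul_assoc]
  gcongr
  · exact hM₁ _ _
  · exact hM₂ _ _

omit hβ in
lemma sum_localForm (hf₁ : ∀ x, x ∉ s₁ → f₁ x = 0) (hf₂ : ∀ x, x ∉ s₂ → f₂ x = 0)
    (hf₃ : ∀ x, x ∉ s₃ → f₃ x = 0) (k : ℕ) (z : ℤ × ℤ) :
    ∑ l ∈ Finset.Ico 0 (0 + 2 ^ k), ∑ D ∈ Finset.Ico (-70) (-70 + 2 ^ k),
      ∑ E ∈ Finset.Ico (-3) (-3 + 2 ^ k), localForm β s₁ s₂ s₃ f₁ f₂ f₃ k l D E z =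
    inner ℂ (f₃ z.1) (β (f₁ (z.1 - z.2)) (f₂ (z.1 + z.2))) * psik k z.2 := by
  simp only [localForm, ← Finset.sum_mul, ← sum_inner, sum_piece k _ _ hf₃]
  simp only [← inner_sum, ← map_sum, sum_piece k _ _ hf₂]
  have : ∑ l ∈ Finset.Ico 0 (0 + 2 ^ k), piece k l s₁ f₁ (z.1 - z.2) = f₁ (z.1 - z.2) := by
    have := sum_piece k 0 0 hf₁ (z.1 - z.2)
    simpa only [zero_add] using this
  rw [← this]
  simp only [map_sum, LinearMap.sum_apply]

lemma tsum_form (hf₁ : ∀ x, x ∉ s₁ → f₁ x = 0) (hf₂ : ∀ x, x ∉ s₂ → f₂ x = 0)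
    (hf₃ : ∀ x, x ∉ s₃ → f₃ x = 0) {k : ℕ} (hk : 8 ≤ k) :
    ∑' z : ℤ × ℤ, inner ℂ (f₃ z.1) (β (f₁ (z.1 - z.2)) (f₂ (z.1 + z.2))) * psik k z.2 =
    ∑ l ∈ Finset.Ico 0 (2 ^ k), ∑ D ∈ Finset.Icc (-65) (-15), ∑ E ∈ Finset.Icc (-2) 2,
      ∑' z, localForm β s₁ s₂ s₃ f₁ f₂ f₃ k l D E z := by
  have hA := two_pow_ge hk
  have hs := fun l D E => (summable_norm_localForm β s₁ s₂ s₃ f₁ f₂ f₃ hβ k l D E).of_norm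
  simp only [← sum_localForm β s₁ s₂ s₃ f₁ f₂ f₃ hf₁ hf₂ hf₃]
  rw [Summable.tsum_finsetSum fun l _ => summable_sum fun D _ => summable_sum fun E _ => hs l D E,
    zero_add]
  refine Finset.sum_congr rfl fun l _ => ?_
  rw [Summable.tsum_finsetSum fun D _ => summable_sum fun E _ => hs l D E]
  have hD : Finset.Icc (-65 : ℤ) (-15) ⊆ Finset.Ico (-70) (-70 + 2 ^ k) := by
    intro D; simp only [Finset.mem_Icc, Finset.mem_Ico]; omega
  have hE : Finset.Icc (-2 : ℤ) 2 ⊆ Finset.Ico (-3) (-3 + 2 ^ k) := by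
    intro D; simp only [Finset.mem_Icc, Finset.mem_Ico]; omega
  have key : ∀ D ∈ Finset.Ico (-70) (-70 + 2 ^ k), D ∉ Finset.Icc (-65 : ℤ) (-15) → ∀ E,
      ∑' z, localForm β s₁ s₂ s₃ f₁ f₂ f₃ k l D E z = 0 := by
    intro D hD hD' E
    rw [Finset.mem_Ico] at hD
    rw [Finset.mem_Icc] at hD'
    rw [(hs l D E).tsum_prod]
    simp only [localForm_tsum_eq_zero_of_shift β s₁ s₂ s₃ f₁ f₂ f₃ hk l E hD.1 hD.2 hD', tsum_zero]
  have key2 : ∀ D, ∀ E ∈ Finset.Ico (-3) (-3 + 2 ^ k), E ∉ Finset.Icc (-2 : ℤ) 2 →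
      ∑' z, localForm β s₁ s₂ s₃ f₁ f₂ f₃ k l D E z = 0 := by
    intro D E hE hE'
    rw [Finset.mem_Ico] at hE
    rw [Finset.mem_Icc] at hE'
    have hsw : Summable fun z => localForm β s₁ s₂ s₃ f₁ f₂ f₃ k l D E ((Equiv.prodComm ℤ ℤ) z) :=
      (Equiv.prodComm ℤ ℤ).summable_iff.2 (hs l D E)
    rw [← (Equiv.prodComm ℤ ℤ).tsum_eq, hsw.tsum_prod]
    simp only [Equiv.prodComm_apply, Prod.swap_prod_mk,
      localForm_tsum_eq_zero_of_translate β s₁ s₂ s₃ f₁ f₂ f₃ hk l D hE.1 hE.2 hE', tsum_zero]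
  rw [← Finset.sum_subset hD]
  · refine Finset.sum_congr rfl fun D _ => ?_
    rw [Summable.tsum_finsetSum fun E _ => hs l D E, Finset.sum_subset hE fun E h h' => key2 D E h h']
  · intro D h h'
    rw [Summable.tsum_finsetSum fun E _ => hs l D E]
    exact Finset.sum_eq_zero fun E _ => key D h h' E

end

lemma embeds_coef {H : Type*} [NormedAddCommGroup H] [InnerProductSpace ℂ H] {σ d : ℤ}
    (hp : Params σ d) {B : ℝ} (hB : 0 ≤ B) {R : Finset Tile} {φ : Tile → ℤ → ℂ}
    (h : IsPacket σ d B R φ) (s : Finset ℤ) (f : ℤ → H) (Ξ : Finset ℝ) (hr : Rich Ξ R) :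
    Embeds σ d Ξ R (24 * countC * besC B) (2 * √(sizeC B))⁻¹ (coef φ s f) s fun x => ‖f x‖ := by
  intro v hv
  obtain ⟨𝒯, h1, h2, h3⟩ := h.embedding hp hB s f Ξ hr hv
  refine ⟨𝒯, h1, ?_, h3⟩
  simpa only [div_eq_inv_mul] using h2

section
variable {H₁ H₂ H₃ : Type*} [NormedAddCommGroup H₁] [InnerProductSpace ℂ H₁]
  [NormedAddCommGroup H₂] [InnerProductSpace ℂ H₂] [NormedAddCommGroup H₃] [InnerProductSpace ℂ H₃]
  (β : H₁ →ₗ[ℂ] H₂ →ₗ[ℂ] H₃) (s₁ s₂ s₃ : Finset ℤ) (f₁ : ℤ → H₁)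
    (f₂ : ℤ → H₂) (f₃ : ℤ → H₃) (hβ : ∀ a b, ‖β a b‖ ≤ ‖a‖ * ‖b‖)
include hβ

lemma norm_localForm_tile {B : ℝ} (_hB : 0 ≤ B) {k : ℕ} {l D E m : ℤ} {a₁ a₂ a₃ : ℝ}
    (h₁ : ∀ z : ℤ, ‖piece k l s₁ f₁ z‖ ≤ 2 * a₁ * (1 + |(z:ℝ) - m * 2 ^ k| / 2 ^ k) ^ 6)
    (h₂ : ∀ z : ℤ, ‖piece k (l + D) s₂ f₂ z‖ ≤ 2 * a₂ * (1 + |(z:ℝ) - m * 2 ^ k| / 2 ^ k) ^ 6)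
    (h₃ : ∀ z : ℤ, ‖piece k (l + (l + D) + E) s₃ f₃ z‖ ≤ 2 * a₃ * (1 + |(z:ℝ) - m * 2 ^ k| / 2 ^ k) ^ 6)
    (ha₁ : 0 ≤ a₁) (ha₂ : 0 ≤ a₂) (ha₃ : 0 ≤ a₃) (x t : ℤ) (hx : x / 2 ^ k = m)
    (hψ : ‖psik k t‖ ≤ B * (2 ^ k)⁻¹ * ((1 + |(t:ℝ)| / 2 ^ k) ^ 14)⁻¹) :
    ‖localForm β s₁ s₂ s₃ f₁ f₂ f₃ k l D E (x, t)‖ ≤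
      2 ^ 21 * B * (2 ^ k)⁻¹ * (a₁ * a₂ * a₃) * ((1 + |(t:ℝ) - 0| / 2 ^ k) ^ 2)⁻¹ := by
  have hA : (0:ℝ) < 2 ^ k := by positivity
  have hAz : (0:ℤ) < 2 ^ k := by positivity
  have hx0 : |(x:ℝ) - m * 2 ^ k| ≤ 2 ^ k := by
    have e1 := Int.emod_add_mul_ediv x (2 ^ k)
    rw [hx] at e1
    have e2 := Int.emod_nonneg x hAz.ne'
    have e3 := Int.emod_lt_of_pos x hAz
    have e4 : (x:ℝ) - m * 2 ^ k = ((x % 2 ^ k : ℤ) : ℝ) := by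
      rw [eq_sub_of_add_eq e1]; push_cast; ring
    rw [e4, abs_of_nonneg (by exact_mod_cast e2)]
    exact_mod_cast e3.le
  have hw : ∀ w u : ℝ, |w - m * 2 ^ k| ≤ 2 ^ k + u → 0 ≤ u →
      (1 + |w - m * 2 ^ k| / 2 ^ k) ^ 6 ≤ 2 ^ 6 * (1 + u / 2 ^ k) ^ 6 := by
    intro w u h hu
    rw [← mul_pow]
    have : |w - m * 2 ^ k| / 2 ^ k ≤ 1 + u / 2 ^ k := by
      rw [← div_self hA.ne', ← add_div]
      gcongr
    have h3 : 0 ≤ u / 2 ^ k := by positivity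
    gcongr
    linarith
  have b₁ : ‖piece k l s₁ f₁ (x - t)‖ ≤ 2 * a₁ * (2 ^ 6 * (1 + |(t:ℝ)| / 2 ^ k) ^ 6) := by
    refine (h₁ _).trans (mul_le_mul_of_nonneg_left (hw _ _ ?_ (abs_nonneg _)) (by positivity))
    rw [Int.cast_sub, show (x:ℝ) - t - m * 2 ^ k = (x - m * 2 ^ k) - t by ring]
    exact (abs_sub _ _).trans (by linarith)
  have b₂ : ‖piece k (l + D) s₂ f₂ (x + t)‖ ≤ 2 * a₂ * (2 ^ 6 * (1 + |(t:ℝ)| / 2 ^ k) ^ 6) := by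
    refine (h₂ _).trans (mul_le_mul_of_nonneg_left (hw _ _ ?_ (abs_nonneg _)) (by positivity))
    rw [Int.cast_add, show (x:ℝ) + t - m * 2 ^ k = (x - m * 2 ^ k) + t by ring]
    exact (abs_add_le _ _).trans (by linarith)
  have b₃ : ‖piece k (l + (l + D) + E) s₃ f₃ x‖ ≤ 2 * a₃ * 2 ^ 6 := by
    refine (h₃ _).trans (mul_le_mul_of_nonneg_left ((hw _ 0 (by linarith) le_rfl).trans_eq ?_)
      (by positivity))
    simp
  refine (norm_localForm_le β s₁ s₂ s₃ f₁ f₂ f₃ hβ k l D E (x, t)).trans ?_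
  set τ : ℝ := 1 + |(t:ℝ)| / 2 ^ k with hτ
  have hτ0 : 0 < τ := by positivity
  calc _ ≤ (2 * a₁ * (2 ^ 6 * τ ^ 6)) * (2 * a₂ * (2 ^ 6 * τ ^ 6)) * (2 * a₃ * 2 ^ 6) *
        (B * (2 ^ k)⁻¹ * (τ ^ 14)⁻¹) := by gcongr
    _ = _ := by
        rw [sub_zero, ← hτ]
        field_simp

lemma sum_localForm_tiles {B : ℝ} (hB : 0 ≤ B) {k : ℕ} {l D E : ℤ} {a₁ a₂ a₃ : ℤ → ℝ}
    (h₁ : ∀ m z : ℤ, ‖piece k l s₁ f₁ z‖ ≤ 2 * a₁ m * (1 + |(z:ℝ) - m * 2 ^ k| / 2 ^ k) ^ 6)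
    (h₂ : ∀ m z : ℤ, ‖piece k (l + D) s₂ f₂ z‖ ≤ 2 * a₂ m * (1 + |(z:ℝ) - m * 2 ^ k| / 2 ^ k) ^ 6)
    (h₃ : ∀ m z : ℤ, ‖piece k (l + (l + D) + E) s₃ f₃ z‖ ≤
      2 * a₃ m * (1 + |(z:ℝ) - m * 2 ^ k| / 2 ^ k) ^ 6)
    (ha₁ : ∀ m, 0 ≤ a₁ m) (ha₂ : ∀ m, 0 ≤ a₂ m) (ha₃ : ∀ m, 0 ≤ a₃ m)
    (hψ : ∀ t : ℤ, ‖psik k t‖ ≤ B * (2 ^ k)⁻¹ * ((1 + |(t:ℝ)| / 2 ^ k) ^ 14)⁻¹) (X Y : Finset ℤ) :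
    ∑ x ∈ X, ∑ t ∈ Y, ‖localForm β s₁ s₂ s₃ f₁ f₂ f₃ k l D E (x, t)‖ ≤
      2 ^ 25 * B * wSum * ∑ m ∈ X.image (· / 2 ^ k), 2 ^ k * (a₁ m * a₂ m * a₃ m) := by
  classical
  have hw := wSum_pos
  rw [← Finset.sum_fiberwise_of_maps_to (g := fun x : ℤ => x / 2 ^ k) (t := X.image (· / 2 ^ k))
    (fun x hx => Finset.mem_image_of_mem _ hx), Finset.mul_sum]
  refine Finset.sum_le_sum fun m _ => ?_
  have hcard : ((X.filter fun x => x / 2 ^ k = m).card : ℝ) ≤ 2 ^ k := by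
    have : (X.filter fun x => x / 2 ^ k = m) ⊆ Finset.Ico (m * 2 ^ k) (m * 2 ^ k + 2 ^ k) := by
      intro x hx
      have hx2 := (Finset.mem_filter.1 hx).2
      have hAz : (0:ℤ) < 2 ^ k := by positivity
      have e1 := Int.emod_add_mul_ediv x (2 ^ k)
      rw [hx2] at e1
      have e2 := Int.emod_nonneg x hAz.ne'
      have e3 := Int.emod_lt_of_pos x hAz
      rw [Finset.mem_Ico]
      constructor <;> linarith [mul_comm m (2 ^ k)]
    have h := Finset.card_le_card this
    rw [Int.card_Ico, add_sub_cancel_left] at h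
    have h' : ((2:ℤ) ^ k).toNat = 2 ^ k := by
      rw [show (2:ℤ) ^ k = ((2 ^ k : ℕ) : ℤ) by push_cast; rfl, Int.toNat_natCast]
    rw [h'] at h
    exact_mod_cast h
  have hin : ∀ x ∈ X.filter (fun x => x / 2 ^ k = m),
      ∑ t ∈ Y, ‖localForm β s₁ s₂ s₃ f₁ f₂ f₃ k l D E (x, t)‖ ≤
      2 ^ 25 * B * wSum * (a₁ m * a₂ m * a₃ m) := by
    intro x hx
    have hx2 := (Finset.mem_filter.1 hx).2
    calc _ ≤ ∑ t ∈ Y, 2 ^ 21 * B * (2 ^ k)⁻¹ * (a₁ m * a₂ m * a₃ m) *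
          ((1 + |(t:ℝ) - 0| / 2 ^ k) ^ 2)⁻¹ := Finset.sum_le_sum fun t _ =>
          norm_localForm_tile β s₁ s₂ s₃ f₁ f₂ f₃ hβ hB (h₁ m) (h₂ m) (h₃ m) (ha₁ m) (ha₂ m)
            (ha₃ m) x t hx2 (hψ t)
      _ ≤ 2 ^ 21 * B * (2 ^ k)⁻¹ * (a₁ m * a₂ m * a₃ m) * (16 * wSum * 2 ^ k) := by
          rw [← Finset.mul_sum]
          have := ha₁ m; have := ha₂ m; have := ha₃ m
          exact mul_le_mul_of_nonneg_left (sum_scaled_weight_le Y 0 k) (by positivity)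
      _ = _ := by field_simp; ring
  have := ha₁ m; have := ha₂ m; have := ha₃ m
  calc _ ≤ ∑ x ∈ X.filter (fun x => x / 2 ^ k = m), 2 ^ 25 * B * wSum * (a₁ m * a₂ m * a₃ m) :=
        Finset.sum_le_sum hin
    _ ≤ 2 ^ k * (2 ^ 25 * B * wSum * (a₁ m * a₂ m * a₃ m)) := by
        rw [Finset.sum_const, nsmul_eq_mul]
        exact mul_le_mul_of_nonneg_right hcard (by positivity)
    _ = _ := by ring

end

/-- The tiles coming from given sets of frequencies and positions at each scale. -/
noncomputable def mkTiles (N : ℕ) (M : ℕ → Finset ℤ) : Finset Tile :=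
  ((Finset.Ico 8 N).sigma fun k => (Finset.Ico (0:ℤ) (2 ^ k)) ×ˢ M k).map
    ⟨fun w => ⟨w.1, w.2.1, w.2.2⟩, fun ⟨a, b, c⟩ ⟨a', b', c'⟩ h => by
      simp only [Tile.mk.injEq] at h
      obtain ⟨rfl, rfl, rfl⟩ := h
      rfl⟩

lemma sum_mkTiles (N : ℕ) (M : ℕ → Finset ℤ) (F : Tile → ℝ) :
    ∑ P ∈ mkTiles N M, F P =
      ∑ k ∈ Finset.Ico 8 N, ∑ l ∈ Finset.Ico (0:ℤ) (2 ^ k), ∑ m ∈ M k, F ⟨k, l, m⟩ := by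
  rw [mkTiles, Finset.sum_map, Finset.sum_sigma]
  simp only [Finset.sum_product]
  rfl

lemma mem_mkTiles {N : ℕ} {M : ℕ → Finset ℤ} {P : Tile} (h : P ∈ mkTiles N M) :
    8 ≤ P.k ∧ 0 ≤ P.l ∧ P.l < 2 ^ P.k := by
  rw [mkTiles, Finset.mem_map] at h
  obtain ⟨⟨k, l, m⟩, h, rfl⟩ := h
  simp only [Finset.mem_sigma, Finset.mem_Ico, Finset.mem_product] at h
  exact ⟨h.1.1, h.2.1.1, h.2.1.2⟩

section
variable (H₁ H₂ H₃ : Type*) [NormedAddCommGroup H₁] [InnerProductSpace ℂ H₁]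
  [NormedAddCommGroup H₂] [InnerProductSpace ℂ H₂] [NormedAddCommGroup H₃] [InnerProductSpace ℂ H₃]

lemma tile_sum_bound {p₁ p₂ p₃ : ℝ} (h₁ : 2 < p₁) (h₂ : 2 < p₂) (h₃ : 2 < p₃)
    (hs : 1 / p₁ + 1 / p₂ + 1 / p₃ = 1) : ∃ C, 0 < C ∧ ∀ (s₁ s₂ s₃ : Finset ℤ) (f₁ : ℤ → H₁)
    (f₂ : ℤ → H₂) (f₃ : ℤ → H₃), ∑ x ∈ s₁, ‖f₁ x‖ ^ p₁ ≤ 1 → ∑ x ∈ s₂, ‖f₂ x‖ ^ p₂ ≤ 1 →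
    ∑ x ∈ s₃, ‖f₃ x‖ ^ p₃ ≤ 1 → ∀ D E : ℤ, -65 ≤ D → D ≤ -15 → -2 ≤ E → E ≤ 2 →
    ∀ (c₁ c₂ c₃ y₁ y₂ y₃ : Tile → ℤ), (∀ P, c₁ P = P.l) → (∀ P, c₂ P = P.l + D) →
    (∀ P, c₃ P = P.l + (P.l + D) + E) → ∀ (N : ℕ) (M : ℕ → Finset ℤ),
    ∑ P ∈ mkTiles N M, 2 ^ P.k * (coef (pack c₁ y₁) s₁ f₁ P * coef (pack c₂ y₂) s₂ f₂ P *
      coef (pack c₃ y₃) s₃ f₃ P) ≤ C := by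
  classical
  obtain ⟨B, hB, hpack⟩ := isPacket_pack
  obtain ⟨C, hC, htri⟩ := trilinear_tiles ![p₁, p₂, p₃] (by intro j; fin_cases j <;> assumption)
    (by simpa [Fin.sum_univ_three] using hs) (24 * countC * besC B) (2 * √(sizeC B))⁻¹
    (by have := countC_pos; have := besC_nonneg B; positivity)
    (by have := Real.sqrt_pos.2 (sizeC_pos B); positivity)
  refine ⟨8 * C, by positivity, fun s₁ s₂ s₃ f₁ f₂ f₃ n₁ n₂ n₃ D E hD1 hD2 hE1 hE2 c₁ c₂ c₃ y₁ y₂ y₃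
    hc₁ hc₂ hc₃ N M => ?_⟩
  set R := mkTiles N M
  have hmaps : ∀ P ∈ R, 8 * P.l / 2 ^ P.k ∈ Finset.Ico (0:ℤ) 8 := by
    intro P hP
    obtain ⟨h1, h2, h3⟩ := mem_mkTiles hP
    have hA : (0:ℤ) < 2 ^ P.k := by positivity
    rw [Finset.mem_Ico]
    exact ⟨Int.ediv_nonneg (by omega) hA.le, Int.ediv_lt_of_lt_mul hA (by linarith)⟩
  rw [← Finset.sum_fiberwise_of_maps_to hmaps]
  have hcl : ∀ i ∈ Finset.Ico (0:ℤ) 8, ∑ P ∈ R.filter (fun P => 8 * P.l / 2 ^ P.k = i),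
      2 ^ P.k * (coef (pack c₁ y₁) s₁ f₁ P * coef (pack c₂ y₂) s₂ f₂ P *
      coef (pack c₃ y₃) s₃ f₃ P) ≤ C := by
    intro i _
    set R' := R.filter (fun P => 8 * P.l / 2 ^ P.k = i) with hR'
    have hcond : ∀ P ∈ R', 8 ≤ P.k ∧ (i:ℝ) ≤ 8 * (P.l / 2 ^ P.k) ∧
        8 * (P.l / 2 ^ P.k : ℝ) < i + 1 := by
      intro P hP
      obtain ⟨hP1, hP2⟩ := Finset.mem_filter.1 hP
      have hA : (0:ℝ) < 2 ^ P.k := by positivity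
      have hAz : (0:ℤ) < 2 ^ P.k := by positivity
      have e1 : i * 2 ^ P.k ≤ 8 * P.l := by rw [← hP2]; exact Int.ediv_mul_le _ hAz.ne'
      have e2 : 8 * P.l < (i + 1) * 2 ^ P.k := by rw [← hP2]; exact Int.lt_ediv_add_one_mul_self _ hAz
      have e1' : (i:ℝ) * 2 ^ P.k ≤ 8 * P.l := by exact_mod_cast e1
      have e2' : (8:ℝ) * P.l < (i + 1) * 2 ^ P.k := by exact_mod_cast e2
      refine ⟨(mem_mkTiles hP1).1, ?_, ?_⟩
      · rw [← mul_div_assoc, le_div_iff₀ hA]; exact e1'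
      · rw [← mul_div_assoc, div_lt_iff₀ hA]; exact e2'
    let Ξ : Finset ℝ := R'.image (fun P => ((P.l : ℝ) - 73) / 2 ^ P.k) ∪
      R'.image (fun P => ((P.l : ℝ) + 73) / 2 ^ P.k)
    have hrich : Rich Ξ R' := fun P hP => ⟨Finset.mem_union_left _ (Finset.mem_image_of_mem _ hP),
      Finset.mem_union_right _ (Finset.mem_image_of_mem _ hP)⟩
    have hd : |D| ≤ 66 := abs_le.2 ⟨by omega, by omega⟩
    have he : |-E| ≤ 3 := abs_le.2 ⟨by omega, by omega⟩
    have k₁ := hpack 1 0 (by norm_num) (by norm_num) R' i hcond c₁ y₁ 1 (by norm_num)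
      (fun P => by rw [hc₁]; ring)
    have k₂ := hpack 1 D (by norm_num) (by omega) R' i hcond c₂ y₂ 1 (by norm_num)
      (fun P => by rw [hc₂]; ring)
    have k₃ := hpack (-2) (-D + -E) (by norm_num) (abs_le.2 ⟨by omega, by omega⟩) R' i hcond c₃ y₃
      (-1) (by norm_num) (fun P => by rw [hc₃]; ring)
    have := htri D (-E) (by rw [abs_of_nonpos (by omega)]; omega) hd he Ξ R'
      ![coef (pack c₁ y₁) s₁ f₁, coef (pack c₂ y₂) s₂ f₂, coef (pack c₃ y₃) s₃ f₃]
      ![s₁, s₂, s₃] ![fun x => ‖f₁ x‖, fun x => ‖f₂ x‖, fun x => ‖f₃ x‖] hrich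
      (by intro j P; fin_cases j <;> exact coef_nonneg _ _ _ _)
      (by intro j x; fin_cases j <;> exact norm_nonneg _)
      (by intro j; fin_cases j <;> assumption)
      (by
        intro j
        have hp := params_tri hd he j
        fin_cases j
        · exact embeds_coef hp hB k₁ s₁ f₁ Ξ hrich
        · exact embeds_coef hp hB k₂ s₂ f₂ Ξ hrich
        · exact embeds_coef hp hB k₃ s₃ f₃ Ξ hrich)
    simpa [Fin.prod_univ_three] using this
  refine (Finset.sum_le_sum hcl).trans ?_
  simp

/-- Uniform bounds for truncations of the model trilinear form. -/
theorem model_bound {p₁ p₂ p₃ : ℝ} (h₁ : 2 < p₁) (h₂ : 2 < p₂) (h₃ : 2 < p₃)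
    (hs : 1 / p₁ + 1 / p₂ + 1 / p₃ = 1) : ∃ C, 0 < C ∧ ∀ (β : H₁ →ₗ[ℂ] H₂ →ₗ[ℂ] H₃),
    (∀ a b, ‖β a b‖ ≤ ‖a‖ * ‖b‖) → ∀ (s₁ s₂ s₃ : Finset ℤ) (f₁ : ℤ → H₁)
    (f₂ : ℤ → H₂) (f₃ : ℤ → H₃), (∀ x, x ∉ s₁ → f₁ x = 0) → (∀ x, x ∉ s₂ → f₂ x = 0) →
    (∀ x, x ∉ s₃ → f₃ x = 0) → ∑ x ∈ s₁, ‖f₁ x‖ ^ p₁ ≤ 1 → ∑ x ∈ s₂, ‖f₂ x‖ ^ p₂ ≤ 1 →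
    ∑ x ∈ s₃, ‖f₃ x‖ ^ p₃ ≤ 1 → ∀ N : ℕ, ‖∑ k ∈ Finset.Ico 8 N, ∑' z : ℤ × ℤ,
      inner ℂ (f₃ z.1) (β (f₁ (z.1 - z.2)) (f₂ (z.1 + z.2))) * psik k z.2‖ ≤ C := by
  classical
  obtain ⟨C, hC, htile⟩ := tile_sum_bound H₁ H₂ H₃ h₁ h₂ h₃ hs
  obtain ⟨B, hB, hψ⟩ := exists_psik_decay 14
  have hw := wSum_pos
  refine ⟨51 * (5 * (2 ^ 25 * B * wSum * C)), by positivity, ?_⟩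
  intro β hβ s₁ s₂ s₃ f₁ f₂ f₃ hf₁ hf₂ hf₃ n₁ n₂ n₃ N
  have key : ∀ D ∈ Finset.Icc (-65:ℤ) (-15), ∀ E ∈ Finset.Icc (-2:ℤ) 2,
      ∑ k ∈ Finset.Ico 8 N, ∑ l ∈ Finset.Ico (0:ℤ) (2 ^ k),
        ∑' z, ‖localForm β s₁ s₂ s₃ f₁ f₂ f₃ k l D E z‖ ≤ 2 ^ 25 * B * wSum * C := by
    intro D hD E hE
    rw [Finset.mem_Icc] at hD hE
    have hsum := fun k l => summable_norm_localForm β s₁ s₂ s₃ f₁ f₂ f₃ hβ k l D E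
    obtain ⟨y₁, hy₁⟩ := exists_pack (fun P => P.l) s₁ f₁
    obtain ⟨y₂, hy₂⟩ := exists_pack (fun P => P.l + D) s₂ f₂
    obtain ⟨y₃, hy₃⟩ := exists_pack (fun P => P.l + (P.l + D) + E) s₃ f₃
    have e : ∑ k ∈ Finset.Ico 8 N, ∑ l ∈ Finset.Ico (0:ℤ) (2 ^ k),
        ∑' z, ‖localForm β s₁ s₂ s₃ f₁ f₂ f₃ k l D E z‖ =
        ∑' z, ∑ k ∈ Finset.Ico 8 N, ∑ l ∈ Finset.Ico (0:ℤ) (2 ^ k),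
          ‖localForm β s₁ s₂ s₃ f₁ f₂ f₃ k l D E z‖ := by
      rw [Summable.tsum_finsetSum fun k _ => summable_sum fun l _ => hsum k l]
      exact Finset.sum_congr rfl fun k _ => (Summable.tsum_finsetSum fun l _ => hsum k l).symm
    rw [e]
    refine (summable_sum fun k _ => summable_sum fun l _ => hsum k l).tsum_le_of_sum_le fun u => ?_
    calc _ ≤ ∑ z ∈ u.image Prod.fst ×ˢ u.image Prod.snd,
          ∑ k ∈ Finset.Ico 8 N, ∑ l ∈ Finset.Ico (0:ℤ) (2 ^ k),
          ‖localForm β s₁ s₂ s₃ f₁ f₂ f₃ k l D E z‖ :=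
          Finset.sum_le_sum_of_subset_of_nonneg Finset.subset_product fun z _ _ =>
            Finset.sum_nonneg fun k _ => Finset.sum_nonneg fun l _ => norm_nonneg _
      _ = ∑ k ∈ Finset.Ico 8 N, ∑ l ∈ Finset.Ico (0:ℤ) (2 ^ k), ∑ x ∈ u.image Prod.fst,
          ∑ t ∈ u.image Prod.snd, ‖localForm β s₁ s₂ s₃ f₁ f₂ f₃ k l D E (x, t)‖ := by
          rw [Finset.sum_comm]
          refine Finset.sum_congr rfl fun k _ => ?_
          rw [Finset.sum_comm]
          exact Finset.sum_congr rfl fun l _ => Finset.sum_product _ _ _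
      _ ≤ ∑ k ∈ Finset.Ico 8 N, ∑ l ∈ Finset.Ico (0:ℤ) (2 ^ k), 2 ^ 25 * B * wSum *
          ∑ m ∈ (u.image Prod.fst).image (· / 2 ^ k), 2 ^ k *
            (coef (pack (fun P => P.l) y₁) s₁ f₁ ⟨k, l, m⟩ *
            coef (pack (fun P => P.l + D) y₂) s₂ f₂ ⟨k, l, m⟩ *
            coef (pack (fun P => P.l + (P.l + D) + E) y₃) s₃ f₃ ⟨k, l, m⟩) :=
          Finset.sum_le_sum fun k _ => Finset.sum_le_sum fun l _ =>
            sum_localForm_tiles β s₁ s₂ s₃ f₁ f₂ f₃ hβ hB.le (fun m z => hy₁ ⟨k, l, m⟩ z)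
              (fun m z => hy₂ ⟨k, l, m⟩ z) (fun m z => hy₃ ⟨k, l, m⟩ z)
              (fun m => coef_nonneg _ _ _ _) (fun m => coef_nonneg _ _ _ _)
              (fun m => coef_nonneg _ _ _ _) (fun t => hψ k t) _ _
      _ ≤ _ := by
          simp only [← Finset.mul_sum]
          have := htile s₁ s₂ s₃ f₁ f₂ f₃ n₁ n₂ n₃ D E hD.1 hD.2 hE.1 hE.2 _ _ _ y₁ y₂ y₃
            (fun P => rfl) (fun P => rfl) (fun P => rfl) N
            (fun k => (u.image Prod.fst).image (· / 2 ^ k))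
          rw [sum_mkTiles] at this
          refine mul_le_mul_of_nonneg_left ?_ (by positivity)
          simpa only [Finset.mul_sum] using this
  have e2 : ∑ k ∈ Finset.Ico 8 N, ∑' z : ℤ × ℤ,
      inner ℂ (f₃ z.1) (β (f₁ (z.1 - z.2)) (f₂ (z.1 + z.2))) * psik k z.2 =
      ∑ D ∈ Finset.Icc (-65:ℤ) (-15), ∑ E ∈ Finset.Icc (-2:ℤ) 2, ∑ k ∈ Finset.Ico 8 N,
        ∑ l ∈ Finset.Ico (0:ℤ) (2 ^ k), ∑' z, localForm β s₁ s₂ s₃ f₁ f₂ f₃ k l D E z := by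
    rw [Finset.sum_congr rfl fun k hk => tsum_form β s₁ s₂ s₃ f₁ f₂ f₃ hβ hf₁ hf₂ hf₃
      (Finset.mem_Ico.1 hk).1]
    rw [Finset.sum_congr rfl fun k _ => Finset.sum_comm]
    rw [Finset.sum_comm]
    refine Finset.sum_congr rfl fun D _ => ?_
    rw [Finset.sum_congr rfl fun k _ => Finset.sum_comm]
    rw [Finset.sum_comm]
  rw [e2]
  calc _ ≤ ∑ D ∈ Finset.Icc (-65:ℤ) (-15), ∑ E ∈ Finset.Icc (-2:ℤ) 2, 2 ^ 25 * B * wSum * C := by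
        refine (norm_sum_le _ _).trans (Finset.sum_le_sum fun D hD => ?_)
        refine (norm_sum_le _ _).trans (Finset.sum_le_sum fun E hE => ?_)
        refine le_trans ?_ (key D hD E hE)
        refine (norm_sum_le _ _).trans (Finset.sum_le_sum fun k _ => ?_)
        refine (norm_sum_le _ _).trans (Finset.sum_le_sum fun l _ => ?_)
        exact norm_tsum_le_tsum_norm (summable_norm_localForm β s₁ s₂ s₃ f₁ f₂ f₃ hβ k l D E)
    _ = _ := by simp

end

lemma continuous_stpE : Continuous stpE := by
  obtain ⟨F, -, h⟩ := bandLimited_stpE.exists_schwartz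
  rw [h]
  exact SchwartzMap.continuous _

open Filter Topology in
lemma exists_kernel_approx : ∃ C, 0 < C ∧ ∀ T : Finset ℤ, ∃ N : ℕ, ∀ t ∈ T,
    ‖(t : ℂ)⁻¹ + 2 * π * Complex.I * ∑ k ∈ Finset.Ico 8 N, psik k t‖ ≤ C * ((1 + |(t:ℝ)|) ^ 2)⁻¹ := by
  obtain ⟨B, hB, hψ⟩ := exists_psik_decay 0
  obtain ⟨B', hB', hE⟩ := bandLimited_stpE.decay 1
  have hπ := Real.pi_pos
  refine ⟨2 * π * (B * 2) + 2 * (8 * B' + 1), by positivity, fun T => ?_⟩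
  have hev : ∀ᶠ N : ℕ in atTop, ∀ t ∈ T, ‖1 - stpE (32 * ((t:ℝ) / 2 ^ N))‖ ≤ (1 + |(t:ℝ)|)⁻¹ := by
    rw [Finset.eventually_all]
    intro t _
    have h1 : Tendsto (fun N : ℕ => 32 * ((t:ℝ) / 2 ^ N)) atTop (𝓝 0) := by
      have := ((tendsto_pow_atTop_nhds_zero_of_lt_one (r := (1 / 2 : ℝ)) (by norm_num)
        (by norm_num)).const_mul (t:ℝ)).const_mul 32
      simpa [div_eq_mul_inv] using this
    have h2 : Tendsto (fun N : ℕ => ‖1 - stpE (32 * ((t:ℝ) / 2 ^ N))‖) atTop (𝓝 0) := by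
      have := ((continuous_stpE.tendsto 0).comp h1).const_sub 1 |>.norm
      simpa [stpE_zero] using this
    have h3 : (0:ℝ) < (1 + |(t:ℝ)|)⁻¹ := by positivity
    exact (h2.eventually_lt_const h3).mono fun N hN => hN.le
  obtain ⟨N, hN, hN8⟩ := (hev.and (eventually_ge_atTop 8)).exists
  refine ⟨N, fun t ht => ?_⟩
  have hnn : ‖(2 * π * Complex.I : ℂ)‖ = 2 * π := by
    simp [abs_of_pos hπ]
  rcases eq_or_ne t 0 with rfl | h0
  · have h4 : ‖∑ k ∈ Finset.Ico 8 N, psik k ((0:ℤ):ℝ)‖ ≤ B * 2 := by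
      refine (norm_sum_le _ _).trans ?_
      calc _ ≤ ∑ k ∈ Finset.Ico 8 N, B * (1 / 2) ^ k := Finset.sum_le_sum fun k _ => by
            simpa using hψ k ((0:ℤ):ℝ)
        _ ≤ ∑ k ∈ Finset.range N, B * (1 / 2) ^ k := by
            refine Finset.sum_le_sum_of_subset_of_nonneg (fun k hk => ?_) fun _ _ _ => by positivity
            exact Finset.mem_range.2 (Finset.mem_Ico.1 hk).2
        _ ≤ _ := by
            rw [← Finset.mul_sum]
            exact mul_le_mul_of_nonneg_left (sum_geometric_two_le N) hB.le
    simp only [Int.cast_zero, inv_zero, zero_add, abs_zero, add_zero, one_pow, inv_one, mul_one] at h4 ⊢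
    rw [norm_mul, hnn]
    have : 2 * π * ‖∑ k ∈ Finset.Ico 8 N, psik k 0‖ ≤ 2 * π * (B * 2) := by gcongr
    linarith
  · have ht0 : (t:ℂ) ≠ 0 := by exact_mod_cast h0
    have ht1 : (1:ℝ) ≤ |(t:ℝ)| := by exact_mod_cast Int.one_le_abs h0
    have h5 : (t : ℂ)⁻¹ + 2 * π * Complex.I * ∑ k ∈ Finset.Ico 8 N, psik k t =
        (t:ℂ)⁻¹ * (stpE (t / 8) + (1 - stpE (32 * ((t:ℝ) / 2 ^ N)))) := by
      have := sum_psik N hN8 t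
      rw [Complex.ofReal_intCast] at this
      rw [eq_inv_mul_iff_mul_eq₀ ht0]
      linear_combination this + mul_inv_cancel₀ ht0
    have h6 : ‖stpE ((t:ℝ) / 8)‖ ≤ 8 * B' * (1 + |(t:ℝ)|)⁻¹ := by
      refine (hE _).trans ?_
      rw [abs_div, pow_one, abs_of_pos (by norm_num : (0:ℝ) < 8), ← div_eq_mul_inv, ← div_eq_mul_inv,
        div_le_div_iff₀ (by positivity) (by positivity)]
      nlinarith
    have h7 : |(t:ℝ)|⁻¹ ≤ 2 * (1 + |(t:ℝ)|)⁻¹ := by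
      rw [← div_eq_mul_inv, inv_eq_one_div, div_le_div_iff₀ (by positivity) (by positivity)]
      linarith
    have h8 : ‖(t:ℂ)⁻¹‖ = |(t:ℝ)|⁻¹ := by
      rw [norm_inv]
      congr 1
      rw [← Complex.ofReal_intCast, Complex.norm_real, Real.norm_eq_abs]
    rw [h5, norm_mul, h8]
    calc _ ≤ 2 * (1 + |(t:ℝ)|)⁻¹ * (8 * B' * (1 + |(t:ℝ)|)⁻¹ + (1 + |(t:ℝ)|)⁻¹) := by
          gcongr
          exact (norm_add_le _ _).trans (add_le_add h6 (hN t ht))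
      _ = 2 * (8 * B' + 1) * ((1 + |(t:ℝ)|) ^ 2)⁻¹ := by rw [pow_two, mul_inv]; ring
      _ ≤ _ := by gcongr; linarith [show 0 ≤ 2 * π * (B * 2) by positivity]

lemma mul_mul_le_rpow {p₁ p₂ p₃ : ℝ} (h₁ : 0 < p₁) (h₂ : 0 < p₂) (h₃ : 0 < p₃)
    (hs : 1 / p₁ + 1 / p₂ + 1 / p₃ = 1) {a b c : ℝ} (ha : 0 ≤ a) (hb : 0 ≤ b) (hc : 0 ≤ c) :
    a * b * c ≤ 1 / p₁ * a ^ p₁ + 1 / p₂ * b ^ p₂ + 1 / p₃ * c ^ p₃ := by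
  have := Real.geom_mean_le_arith_mean3_weighted (w₁ := 1 / p₁) (w₂ := 1 / p₂) (w₃ := 1 / p₃)
    (by positivity) (by positivity) (by positivity) (rpow_nonneg ha p₁) (rpow_nonneg hb p₂)
    (rpow_nonneg hc p₃) hs
  rwa [← rpow_mul ha, ← rpow_mul hb, ← rpow_mul hc, mul_one_div_cancel h₁.ne',
    mul_one_div_cancel h₂.ne', mul_one_div_cancel h₃.ne', rpow_one, rpow_one, rpow_one] at this

lemma sum_translate_le {s X : Finset ℤ} {a : ℤ → ℝ} (ha : ∀ x, 0 ≤ a x) (hs : ∀ x, x ∉ s → a x = 0)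
    (e : ℤ ≃ ℤ) : ∑ x ∈ X, a (e x) ≤ ∑ x ∈ s, a x := by
  classical
  have h1 : ∑ x ∈ X, a (e x) = ∑ x ∈ X.map e.toEmbedding, a x := (Finset.sum_map X e.toEmbedding a).symm
  rw [h1]
  rw [← Finset.sum_filter_add_sum_filter_not _ (· ∈ s)]
  have h2 : ∑ x ∈ (X.map e.toEmbedding).filter (· ∉ s), a x = 0 :=
    Finset.sum_eq_zero fun x hx => hs x (Finset.mem_filter.1 hx).2
  rw [h2, add_zero]
  exact Finset.sum_le_sum_of_subset_of_nonneg (fun x hx => (Finset.mem_filter.1 hx).2) fun _ _ _ => ha _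

lemma sum_weight_trilinear_le {p₁ p₂ p₃ : ℝ} (h₁ : 0 < p₁) (h₂ : 0 < p₂) (h₃ : 0 < p₃)
    (hs : 1 / p₁ + 1 / p₂ + 1 / p₃ = 1) {s₁ s₂ s₃ : Finset ℤ} {a b c : ℤ → ℝ}
    (ha : ∀ x, 0 ≤ a x) (hb : ∀ x, 0 ≤ b x) (hc : ∀ x, 0 ≤ c x) (ha' : ∀ x, x ∉ s₁ → a x = 0)
    (hb' : ∀ x, x ∉ s₂ → b x = 0) (na : ∑ x ∈ s₁, a x ^ p₁ ≤ 1)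
    (nb : ∑ x ∈ s₂, b x ^ p₂ ≤ 1) (nc : ∑ x ∈ s₃, c x ^ p₃ ≤ 1) (T : Finset ℤ) :
    ∑ x ∈ s₃, ∑ t ∈ T, ((1 + |(t:ℝ)|) ^ 2)⁻¹ * (a (x - t) * b (x + t) * c x) ≤ 16 * wSum := by
  have key : ∀ t : ℤ, ∑ x ∈ s₃, a (x - t) * b (x + t) * c x ≤ 1 := by
    intro t
    have e1 := sum_translate_le (s := s₁) (X := s₃) (a := fun x => a x ^ p₁)
      (fun x => rpow_nonneg (ha x) _) (fun x hx => by simp only [ha' x hx]; exact zero_rpow h₁.ne')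
      (Equiv.subRight t)
    have e2 := sum_translate_le (s := s₂) (X := s₃) (a := fun x => b x ^ p₂)
      (fun x => rpow_nonneg (hb x) _) (fun x hx => by simp only [hb' x hx]; exact zero_rpow h₂.ne')
      (Equiv.addRight t)
    simp only [Equiv.coe_addRight, Equiv.subRight_apply] at e1 e2
    calc _ ≤ ∑ x ∈ s₃, (1 / p₁ * a (x - t) ^ p₁ + 1 / p₂ * b (x + t) ^ p₂ + 1 / p₃ * c x ^ p₃) :=
          Finset.sum_le_sum fun x _ => mul_mul_le_rpow h₁ h₂ h₃ hs (ha _) (hb _) (hc _)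
      _ ≤ 1 / p₁ * 1 + 1 / p₂ * 1 + 1 / p₃ * 1 := by
          rw [Finset.sum_add_distrib, Finset.sum_add_distrib, ← Finset.mul_sum, ← Finset.mul_sum,
            ← Finset.mul_sum]
          gcongr
          · exact e1.trans na
          · exact e2.trans nb
      _ = 1 := by rw [mul_one, mul_one, mul_one, hs]
  rw [Finset.sum_comm]
  calc _ = ∑ t ∈ T, ((1 + |(t:ℝ)|) ^ 2)⁻¹ * ∑ x ∈ s₃, a (x - t) * b (x + t) * c x := by
        simp only [Finset.mul_sum]
    _ ≤ ∑ t ∈ T, ((1 + |(t:ℝ)|) ^ 2)⁻¹ * 1 :=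
        Finset.sum_le_sum fun t _ => mul_le_mul_of_nonneg_left (key t) (by positivity)
    _ ≤ _ := by simpa using sum_scaled_weight_le T 0 0

section
variable (H₁ H₂ H₃ : Type*) [NormedAddCommGroup H₁] [InnerProductSpace ℂ H₁]
  [NormedAddCommGroup H₂] [InnerProductSpace ℂ H₂] [NormedAddCommGroup H₃] [InnerProductSpace ℂ H₃]

theorem trilinear_hilbert {p₁ p₂ p₃ : ℝ} (h₁ : 2 < p₁) (h₂ : 2 < p₂) (h₃ : 2 < p₃)
    (hs : 1 / p₁ + 1 / p₂ + 1 / p₃ = 1) : ∃ C, 0 < C ∧ ∀ (β : H₁ →ₗ[ℂ] H₂ →ₗ[ℂ] H₃),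
    (∀ a b, ‖β a b‖ ≤ ‖a‖ * ‖b‖) → ∀ (s₁ s₂ s₃ : Finset ℤ) (f₁ : ℤ → H₁)
    (f₂ : ℤ → H₂) (f₃ : ℤ → H₃), (∀ x, x ∉ s₁ → f₁ x = 0) → (∀ x, x ∉ s₂ → f₂ x = 0) →
    (∀ x, x ∉ s₃ → f₃ x = 0) → ∑ x ∈ s₁, ‖f₁ x‖ ^ p₁ ≤ 1 → ∑ x ∈ s₂, ‖f₂ x‖ ^ p₂ ≤ 1 →
    ∑ x ∈ s₃, ‖f₃ x‖ ^ p₃ ≤ 1 → ∀ T : Finset ℤ, (∀ x ∈ s₃, ∀ t ∉ T, f₁ (x - t) = 0) →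
    ‖∑ x ∈ s₃, ∑ t ∈ T, (t : ℂ)⁻¹ * inner ℂ (f₃ x) (β (f₁ (x - t)) (f₂ (x + t)))‖ ≤ C := by
  obtain ⟨C, hC, hmodel⟩ := model_bound H₁ H₂ H₃ h₁ h₂ h₃ hs
  obtain ⟨C', hC', hker⟩ := exists_kernel_approx
  have hπ := Real.pi_pos
  have hw := wSum_pos
  refine ⟨C' * (16 * wSum) + 2 * π * C, by positivity, ?_⟩
  intro β hβ s₁ s₂ s₃ f₁ f₂ f₃ hf₁ hf₂ hf₃ n₁ n₂ n₃ T hT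
  obtain ⟨N, hN⟩ := hker T
  have hm := hmodel β hβ s₁ s₂ s₃ f₁ f₂ f₃ hf₁ hf₂ hf₃ n₁ n₂ n₃ N
  set A : ℤ → ℤ → ℂ := fun x t => inner ℂ (f₃ x) (β (f₁ (x - t)) (f₂ (x + t))) with hA
  have e1 : ∑ k ∈ Finset.Ico 8 N, ∑' z : ℤ × ℤ, A z.1 z.2 * psik k z.2 =
      ∑ x ∈ s₃, ∑ t ∈ T, A x t * ∑ k ∈ Finset.Ico 8 N, psik k t := by
    simp only [Finset.mul_sum]
    have : ∀ k, ∑' z : ℤ × ℤ, A z.1 z.2 * psik k z.2 = ∑ x ∈ s₃, ∑ t ∈ T, A x t * psik k t := by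
      intro k
      rw [tsum_eq_sum (s := s₃ ×ˢ T), Finset.sum_product]
      intro z hz
      have : A z.1 z.2 = 0 := by
        by_cases h : z.1 ∈ s₃
        · have h' : z.2 ∉ T := fun h' => hz (Finset.mem_product.2 ⟨h, h'⟩)
          simp [hA, hT z.1 h z.2 h']
        · simp [hA, hf₃ _ h]
      rw [this, zero_mul]
    simp only [this]
    rw [Finset.sum_comm]
    exact Finset.sum_congr rfl fun x _ => Finset.sum_comm
  have e2 : ∑ x ∈ s₃, ∑ t ∈ T, (t : ℂ)⁻¹ * A x t =
      ∑ x ∈ s₃, ∑ t ∈ T, ((t : ℂ)⁻¹ + 2 * π * Complex.I * ∑ k ∈ Finset.Ico 8 N, psik k t) * A x t -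
      2 * π * Complex.I * ∑ k ∈ Finset.Ico 8 N, ∑' z : ℤ × ℤ, A z.1 z.2 * psik k z.2 := by
    rw [e1, Finset.mul_sum, ← Finset.sum_sub_distrib]
    refine Finset.sum_congr rfl fun x _ => ?_
    rw [Finset.mul_sum, ← Finset.sum_sub_distrib]
    exact Finset.sum_congr rfl fun t _ => by ring
  have hnn : ‖(2 * π * Complex.I : ℂ)‖ = 2 * π := by simp [abs_of_pos hπ]
  rw [e2]
  refine (norm_sub_le _ _).trans (add_le_add ?_ ?_)
  · have h0 : ∀ q : ℝ, 2 < q → 0 < q := fun q h => by linarith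
    have hwt := sum_weight_trilinear_le (h0 _ h₁) (h0 _ h₂) (h0 _ h₃) hs (s₁ := s₁) (s₂ := s₂) (s₃ := s₃)
      (a := fun x => ‖f₁ x‖) (b := fun x => ‖f₂ x‖) (c := fun x => ‖f₃ x‖) (fun _ => norm_nonneg _)
      (fun _ => norm_nonneg _) (fun _ => norm_nonneg _) (fun x hx => by simp [hf₁ x hx])
      (fun x hx => by simp [hf₂ x hx]) n₁ n₂ n₃ T
    refine le_trans ?_ (mul_le_mul_of_nonneg_left hwt hC'.le)
    rw [Finset.mul_sum]
    refine (norm_sum_le _ _).trans (Finset.sum_le_sum fun x _ => ?_)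
    rw [Finset.mul_sum]
    refine (norm_sum_le _ _).trans (Finset.sum_le_sum fun t ht => ?_)
    rw [norm_mul, ← mul_assoc]
    refine mul_le_mul (hN t ht) ((norm_inner_le_norm _ _).trans ?_) (norm_nonneg _) (by positivity)
    rw [mul_comm]
    exact mul_le_mul_of_nonneg_right (hβ _ _) (norm_nonneg _)
  · rw [norm_mul, hnn]
    exact mul_le_mul_of_nonneg_left hm (by positivity)

end

section
variable {H₁ H₂ H₃ : Type*} [NormedAddCommGroup H₁] [InnerProductSpace ℂ H₁]
  [NormedAddCommGroup H₂] [InnerProductSpace ℂ H₂] [NormedAddCommGroup H₃] [InnerProductSpace ℂ H₃]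

/-- The discrete bilinear Hilbert transform. -/
noncomputable def dHil (β : H₁ →ₗ[ℂ] H₂ →ₗ[ℂ] H₃) (f₁ : ℤ → H₁) (f₂ : ℤ → H₂) (m : ℤ) : H₃ :=
  ∑' t : ℤ, (t : ℂ)⁻¹ • β (f₁ (m - t)) (f₂ (m + t))

variable (H₁ H₂ H₃)

lemma dHil_finite {p q r : ℝ} (hp : 2 < p) (hq : 2 < q) (hr : 1 / r = 1 / p + 1 / q) (hr1 : 1 < r)
    (hr2 : r < 2) : ∃ C, 0 < C ∧ ∀ (β : H₁ →ₗ[ℂ] H₂ →ₗ[ℂ] H₃),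
    (∀ a b, ‖β a b‖ ≤ ‖a‖ * ‖b‖) → ∀ (s₁ s₂ : Finset ℤ) (f₁ : ℤ → H₁)
    (f₂ : ℤ → H₂), (∀ x, x ∉ s₁ → f₁ x = 0) → (∀ x, x ∉ s₂ → f₂ x = 0) →
    ∑ x ∈ s₁, ‖f₁ x‖ ^ p ≤ 1 → ∑ x ∈ s₂, ‖f₂ x‖ ^ q ≤ 1 →
    ∀ s : Finset ℤ, ∑ m ∈ s, ‖dHil β f₁ f₂ m‖ ^ r ≤ C ^ r := by
  have hr0 : 0 < r := by linarith
  have hr3 : 0 < r - 1 := by linarith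
  have h3 : 2 < r / (r - 1) := by rw [lt_div_iff₀ hr3]; linarith
  have hs : 1 / p + 1 / q + 1 / (r / (r - 1)) = 1 := by rw [← hr]; field_simp; ring
  obtain ⟨C, hC, htri⟩ := trilinear_hilbert H₁ H₂ H₃ hp hq h3 hs
  refine ⟨C, hC, fun β hβ s₁ s₂ f₁ f₂ hf₁ hf₂ n₁ n₂ s => ?_⟩
  classical
  set S := dHil β f₁ f₂ with hS
  set X := ∑ m ∈ s, ‖S m‖ ^ r with hX
  have hX0 : 0 ≤ X := Finset.sum_nonneg fun m _ => by positivity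
  rcases hX0.eq_or_lt with h0 | hpos
  · rw [← h0]; positivity
  set q' := r / (r - 1) with hq'
  have hq'0 : 0 < q' := by linarith
  let c : ℤ → ℝ := fun m => X ^ (-(1 / q')) * ‖S m‖ ^ (r - 2)
  let f₃ : ℤ → H₃ := fun m => if m ∈ s then (c m : ℂ) • S m else 0
  have hc : ∀ m, 0 ≤ c m := fun m => by positivity
  have hnS : ∀ (m : ℤ) , ‖S m‖ ^ (r - 2) * ‖S m‖ = ‖S m‖ ^ (r - 1) := by
    intro m
    rcases (norm_nonneg (S m)).eq_or_lt with h | h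
    · rw [← h, mul_zero, zero_rpow hr3.ne']
    · rw [← rpow_add_one h.ne']; congr 1; ring
  have hn : ∀ m ∈ s, ‖f₃ m‖ = X ^ (-(1 / q')) * ‖S m‖ ^ (r - 1) := by
    intro m hm
    simp only [f₃, if_pos hm]
    rw [norm_smul, Complex.norm_real, Real.norm_of_nonneg (hc m), ← hnS]
    simp only [c]; ring
  have n₃ : ∑ x ∈ s, ‖f₃ x‖ ^ q' ≤ 1 := by
    have : ∀ x ∈ s, ‖f₃ x‖ ^ q' = X⁻¹ * ‖S x‖ ^ r := by
      intro x hx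
      rw [hn x hx, mul_rpow (by positivity) (by positivity), ← rpow_mul hX0, ← rpow_mul (norm_nonneg _)]
      rw [show -(1 / q') * q' = -1 by field_simp, rpow_neg_one,
        show (r - 1) * q' = r by rw [hq']; field_simp]
    rw [Finset.sum_congr rfl this, ← Finset.mul_sum, ← hX, inv_mul_cancel₀ hpos.ne']
  let T : Finset ℤ := (s ×ˢ s₁).image fun z => z.1 - z.2
  have hT : ∀ x ∈ s, ∀ t ∉ T, f₁ (x - t) = 0 := by
    intro x hx t ht
    refine hf₁ _ fun h => ht ?_
    exact Finset.mem_image.2 ⟨(x, x - t), Finset.mem_product.2 ⟨hx, h⟩, by simp⟩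
  have hb := htri β hβ s₁ s₂ s f₁ f₂ f₃ hf₁ hf₂ (fun x hx => by simp [f₃, hx]) n₁ n₂ n₃ T hT
  have e : ∑ x ∈ s, ∑ t ∈ T, (t : ℂ)⁻¹ * inner ℂ (f₃ x) (β (f₁ (x - t)) (f₂ (x + t))) =
      ((X ^ (1 / r) : ℝ) : ℂ) := by
    have h1 : ∀ x ∈ s, ∑ t ∈ T, (t : ℂ)⁻¹ * inner ℂ (f₃ x) (β (f₁ (x - t)) (f₂ (x + t))) =
        ((X ^ (-(1 / q')) * ‖S x‖ ^ r : ℝ) : ℂ) := by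
      intro x hx
      have h2 : S x = ∑ t ∈ T, (t : ℂ)⁻¹ • β (f₁ (x - t)) (f₂ (x + t)) := by
        rw [hS, dHil, tsum_eq_sum]
        intro t ht
        rw [hT x hx t ht, map_zero, LinearMap.zero_apply, smul_zero]
      simp only [← inner_smul_right]
      rw [← inner_sum, ← h2]
      simp only [f₃, if_pos hx]
      rw [inner_smul_left, Complex.conj_ofReal, inner_self_eq_norm_sq_to_K]
      have h4 : ‖S x‖ ^ r = ‖S x‖ ^ (r - 2) * ‖S x‖ * ‖S x‖ := by
        rw [hnS]
        rcases (norm_nonneg (S x)).eq_or_lt with h | h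
        · rw [← h, mul_zero, zero_rpow hr0.ne']
        · rw [← rpow_add_one h.ne']; congr 1; ring
      rw [h4]
      simp only [c]
      push_cast
      simp only [Complex.coe_algebraMap]
      ring
    rw [Finset.sum_congr rfl h1, ← Complex.ofReal_sum, ← Finset.mul_sum, ← hX]
    congr 1
    rw [← rpow_add_one hpos.ne']
    congr 1
    rw [hq']; field_simp; ring
  rw [e, Complex.norm_real, Real.norm_of_nonneg (by positivity)] at hb
  calc X = (X ^ (1 / r)) ^ r := by rw [← rpow_mul hX0, one_div_mul_cancel hr0.ne', rpow_one]
    _ ≤ _ := rpow_le_rpow (by positivity) hb hr0.le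

open Filter Topology in
/-- Bounds for the discrete bilinear Hilbert transform. -/
theorem dHil_bound [CompleteSpace H₃] {p q r : ℝ} (hp : 2 < p) (hq : 2 < q) (hr : 1 / r = 1 / p + 1 / q) (hr1 : 1 < r)
    (hr2 : r < 2) : ∃ C, 0 < C ∧ ∀ (β : H₁ →ₗ[ℂ] H₂ →ₗ[ℂ] H₃),
    (∀ a b, ‖β a b‖ ≤ ‖a‖ * ‖b‖) → ∀ (f₁ : ℤ → H₁) (f₂ : ℤ → H₂), (Summable fun x => ‖f₁ x‖) →
    ∀ A B : ℝ, 0 < A → 0 < B → (∀ s : Finset ℤ, ∑ x ∈ s, ‖f₁ x‖ ^ p ≤ A ^ p) →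
    (∀ s : Finset ℤ, ∑ x ∈ s, ‖f₂ x‖ ^ q ≤ B ^ q) →
    ∀ s : Finset ℤ, ∑ m ∈ s, ‖dHil β f₁ f₂ m‖ ^ r ≤ (C * A * B) ^ r := by
  obtain ⟨C, hC, hfin⟩ := dHil_finite H₁ H₂ H₃ hp hq hr hr1 hr2
  refine ⟨C, hC, fun β hβ f₁ f₂ hs₁ A B hA hB n₁ n₂ s => ?_⟩
  have hr0 : 0 < r := by linarith
  have hp0 : 0 < p := by linarith
  have hq0 : 0 < q := by linarith
  have hf₂ : ∀ x, ‖f₂ x‖ ≤ B := fun x => by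
    have := n₂ {x}
    rw [Finset.sum_singleton] at this
    exact (rpow_le_rpow_iff (norm_nonneg _) hB.le hq0).1 this
  let I : ℕ → Finset ℤ := fun N => Finset.Icc (-(N:ℤ)) N
  let g₁ : ℕ → ℤ → H₁ := fun N x => if x ∈ I N then f₁ x else 0
  let g₂ : ℕ → ℤ → H₂ := fun N x => if x ∈ I N then f₂ x else 0
  have hg₁ : ∀ N x, ‖g₁ N x‖ ≤ ‖f₁ x‖ := fun N x => by
    simp only [g₁]; split_ifs <;> simp
  have hg₂ : ∀ N x, ‖g₂ N x‖ ≤ ‖f₂ x‖ := fun N x => by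
    simp only [g₂]; split_ifs <;> simp
  have hev : ∀ x : ℤ, ∀ᶠ N : ℕ in atTop, x ∈ I N := fun x => by
    filter_upwards [eventually_ge_atTop x.natAbs] with N hN
    rw [Finset.mem_Icc]; omega
  have hbound : ∀ N, ∑ m ∈ s, ‖dHil β (g₁ N) (g₂ N) m‖ ^ r ≤ (C * A * B) ^ r := by
    intro N
    have hA' : ‖(A : ℂ)⁻¹‖ = A⁻¹ := by rw [norm_inv, Complex.norm_real, Real.norm_of_nonneg hA.le]
    have hB' : ‖(B : ℂ)⁻¹‖ = B⁻¹ := by rw [norm_inv, Complex.norm_real, Real.norm_of_nonneg hB.le]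
    have h := hfin β hβ (I N) (I N) (fun x => (A:ℂ)⁻¹ • g₁ N x) (fun x => (B:ℂ)⁻¹ • g₂ N x)
      (fun x hx => by simp [g₁, hx]) (fun x hx => by simp [g₂, hx])
      (by
        simp only [norm_smul, hA']
        calc _ ≤ ∑ x ∈ I N, (A ^ p)⁻¹ * ‖f₁ x‖ ^ p := Finset.sum_le_sum fun x _ => by
              rw [mul_rpow (by positivity) (norm_nonneg _), inv_rpow hA.le]
              gcongr
              exact hg₁ N x
          _ ≤ (A ^ p)⁻¹ * A ^ p := by
              rw [← Finset.mul_sum]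
              exact mul_le_mul_of_nonneg_left (n₁ _) (by positivity)
          _ = 1 := inv_mul_cancel₀ (by positivity))
      (by
        simp only [norm_smul, hB']
        calc _ ≤ ∑ x ∈ I N, (B ^ q)⁻¹ * ‖f₂ x‖ ^ q := Finset.sum_le_sum fun x _ => by
              rw [mul_rpow (by positivity) (norm_nonneg _), inv_rpow hB.le]
              gcongr
              exact hg₂ N x
          _ ≤ (B ^ q)⁻¹ * B ^ q := by
              rw [← Finset.mul_sum]
              exact mul_le_mul_of_nonneg_left (n₂ _) (by positivity)
          _ = 1 := inv_mul_cancel₀ (by positivity)) s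
    have e : ∀ m, dHil β (fun x => (A:ℂ)⁻¹ • g₁ N x) (fun x => (B:ℂ)⁻¹ • g₂ N x) m =
        ((A:ℂ)⁻¹ * (B:ℂ)⁻¹) • dHil β (g₁ N) (g₂ N) m := by
      intro m
      rw [dHil, dHil, ← tsum_const_smul'']
      refine tsum_congr fun t => ?_
      rw [map_smul, map_smul, LinearMap.smul_apply, smul_smul, smul_smul, smul_smul]
      congr 1; ring
    simp only [e, norm_smul, norm_mul, hA', hB'] at h
    have h2 : ∑ m ∈ s, ‖dHil β (g₁ N) (g₂ N) m‖ ^ r =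
        (A * B) ^ r * ∑ m ∈ s, (A⁻¹ * B⁻¹ * ‖dHil β (g₁ N) (g₂ N) m‖) ^ r := by
      rw [Finset.mul_sum]
      refine Finset.sum_congr rfl fun m _ => ?_
      rw [← mul_rpow (by positivity) (by positivity)]
      congr 1; field_simp
    rw [h2, show C * A * B = (A * B) * C by ring, mul_rpow (by positivity : 0 ≤ A * B) hC.le]
    exact mul_le_mul_of_nonneg_left h (by positivity)
  have hlim : ∀ m, Tendsto (fun N => dHil β (g₁ N) (g₂ N) m) atTop (𝓝 (dHil β f₁ f₂ m)) := by
    intro m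
    refine tendsto_tsum_of_dominated_convergence (bound := fun t : ℤ => ‖f₁ (m - t)‖ * B) ?_ ?_ ?_
    · exact ((Equiv.subLeft m).summable_iff.2 hs₁).mul_right B
    · intro t
      refine tendsto_const_nhds.congr' ?_
      filter_upwards [hev (m - t), hev (m + t)] with N h1 h2
      simp only [g₁, g₂, if_pos h1, if_pos h2]
    · refine Eventually.of_forall fun N t => ?_
      rw [norm_smul]
      have h1 : ‖(t:ℂ)⁻¹‖ ≤ 1 := by
        rcases eq_or_ne t 0 with rfl | h0
        · simp
        · rw [norm_inv]
          refine inv_le_one_of_one_le₀ ?_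
          rw [← Complex.ofReal_intCast, Complex.norm_real, Real.norm_eq_abs]
          exact_mod_cast Int.one_le_abs h0
      calc _ ≤ 1 * (‖g₁ N (m - t)‖ * ‖g₂ N (m + t)‖) := by gcongr; exact hβ _ _
        _ ≤ _ := by
          rw [one_mul]
          gcongr
          · exact hg₁ _ _
          · exact (hg₂ _ _).trans (hf₂ _)
  refine le_of_tendsto' (x := atTop) (f := fun N => ∑ m ∈ s, ‖dHil β (g₁ N) (g₂ N) m‖ ^ r)
    (tendsto_finsetSum _ fun m _ => ?_) hbound
  exact (hlim m).norm.rpow_const (Or.inr hr0.le)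

end

lemma sum_translate_le_of_bound {a : ℤ → ℝ} {M : ℝ} (h : ∀ s : Finset ℤ, ∑ x ∈ s, a x ≤ M) (e : ℤ ≃ ℤ)
    (s : Finset ℤ) : ∑ x ∈ s, a (e x) ≤ M := by
  have h1 : ∑ x ∈ s, a (e x) = ∑ x ∈ s.map e.toEmbedding, a x := (Finset.sum_map s e.toEmbedding a).symm
  rw [h1]
  exact h _

lemma sum_error_finite {p q r : ℝ} (hp : 0 < p) (hq : 0 < q) (hr : 1 / r = 1 / p + 1 / q) (hr1 : 1 < r)
    {a b : ℤ → ℝ} (ha : ∀ x, 0 ≤ a x) (hb : ∀ x, 0 ≤ b x)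
    (na : ∀ s : Finset ℤ, ∑ x ∈ s, a x ^ p ≤ 1) (nb : ∀ s : Finset ℤ, ∑ x ∈ s, b x ^ q ≤ 1)
    (T s : Finset ℤ) :
    ∑ m ∈ s, (∑ t ∈ T, ((1 + |(t:ℝ)|) ^ 2)⁻¹ * (a (m - t) * b (m + t))) ^ r ≤ (16 * wSum) ^ r := by
  have hr0 : 0 < r := by linarith
  have hw := wSum_pos
  set W := ∑ t ∈ T, ((1 + |(t:ℝ)|) ^ 2)⁻¹ with hW
  have hWle : W ≤ 16 * wSum := by simpa using sum_scaled_weight_le T 0 0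
  have hW0 : 0 ≤ W := Finset.sum_nonneg fun _ _ => by positivity
  rcases T.eq_empty_or_nonempty with rfl | hT
  · simp only [Finset.sum_empty, zero_rpow hr0.ne', Finset.sum_const_zero]; positivity
  have hWp : 0 < W := Finset.sum_pos (fun _ _ => by positivity) hT
  have key : ∀ t : ℤ, ∑ m ∈ s, (a (m - t) * b (m + t)) ^ r ≤ 1 := by
    intro t
    have e1 := sum_translate_le_of_bound na (Equiv.subRight t) s
    have e2 := sum_translate_le_of_bound nb (Equiv.addRight t) s
    simp only [Equiv.coe_addRight, Equiv.subRight_apply] at e1 e2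
    have hsum : r / p + r / q = 1 := by
      have : r * (1 / r) = r * (1 / p + 1 / q) := by rw [hr]
      rw [mul_one_div_cancel hr0.ne'] at this
      rw [this]; ring
    calc _ ≤ ∑ m ∈ s, (r / p * a (m - t) ^ p + r / q * b (m + t) ^ q) := by
          refine Finset.sum_le_sum fun m _ => ?_
          have := Real.geom_mean_le_arith_mean2_weighted (w₁ := r / p) (w₂ := r / q) (by positivity)
            (by positivity) (rpow_nonneg (ha (m - t)) p) (rpow_nonneg (hb (m + t)) q) hsum
          rwa [← rpow_mul (ha _), ← rpow_mul (hb _), mul_div_cancel₀ _ hp.ne',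
            mul_div_cancel₀ _ hq.ne', ← mul_rpow (ha _) (hb _)] at this
      _ ≤ r / p * 1 + r / q * 1 := by
          rw [Finset.sum_add_distrib, ← Finset.mul_sum, ← Finset.mul_sum]
          gcongr
      _ = 1 := by rw [mul_one, mul_one, hsum]
  have hJ : ∀ m, (∑ t ∈ T, ((1 + |(t:ℝ)|) ^ 2)⁻¹ * (a (m - t) * b (m + t))) ^ r ≤
      W ^ r * ∑ t ∈ T, W⁻¹ * ((1 + |(t:ℝ)|) ^ 2)⁻¹ * (a (m - t) * b (m + t)) ^ r := by
    intro m
    have := Real.rpow_arith_mean_le_arith_mean_rpow T (fun t => W⁻¹ * ((1 + |(t:ℝ)|) ^ 2)⁻¹)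
      (fun t => a (m - t) * b (m + t)) (fun t _ => by positivity)
      (by rw [← Finset.mul_sum, ← hW, inv_mul_cancel₀ hWp.ne'])
      (fun t _ => mul_nonneg (ha _) (hb _)) hr1.le
    refine le_trans (le_of_eq ?_) (mul_le_mul_of_nonneg_left this (by positivity))
    have h0 : 0 ≤ ∑ t ∈ T, W⁻¹ * ((1 + |(t:ℝ)|) ^ 2)⁻¹ * (a (m - t) * b (m + t)) :=
      Finset.sum_nonneg fun t _ => mul_nonneg (by positivity) (mul_nonneg (ha _) (hb _))
    rw [← mul_rpow hW0 h0, Finset.mul_sum]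
    congr 1
    refine Finset.sum_congr rfl fun t _ => ?_
    field_simp
  calc _ ≤ ∑ m ∈ s, W ^ r * ∑ t ∈ T, W⁻¹ * ((1 + |(t:ℝ)|) ^ 2)⁻¹ * (a (m - t) * b (m + t)) ^ r :=
        Finset.sum_le_sum fun m _ => hJ m
    _ = W ^ r * ∑ t ∈ T, W⁻¹ * ((1 + |(t:ℝ)|) ^ 2)⁻¹ * ∑ m ∈ s, (a (m - t) * b (m + t)) ^ r := by
        rw [← Finset.mul_sum, Finset.sum_comm]
        simp only [Finset.mul_sum]
    _ ≤ W ^ r * ∑ t ∈ T, W⁻¹ * ((1 + |(t:ℝ)|) ^ 2)⁻¹ * 1 := by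
        gcongr with t _
        exact key t
    _ = W ^ r := by
        simp only [mul_one]
        rw [← Finset.mul_sum, ← hW, inv_mul_cancel₀ hWp.ne', mul_one]
    _ ≤ _ := rpow_le_rpow hW0 hWle hr0.le

/-- Bounds for bilinear discrete averages. -/
lemma sum_error_bound {p q r : ℝ} (hp : 0 < p) (hq : 0 < q) (hr : 1 / r = 1 / p + 1 / q) (hr1 : 1 < r)
    {a b : ℤ → ℝ} (ha : ∀ x, 0 ≤ a x) (hb : ∀ x, 0 ≤ b x) {A B : ℝ} (hA : 0 < A) (hB : 0 < B)
    (na : ∀ s : Finset ℤ, ∑ x ∈ s, a x ^ p ≤ A ^ p) (nb : ∀ s : Finset ℤ, ∑ x ∈ s, b x ^ q ≤ B ^ q)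
    (hs : ∀ m : ℤ, Summable fun t : ℤ => ((1 + |(t:ℝ)|) ^ 2)⁻¹ * (a (m - t) * b (m + t)))
    (s : Finset ℤ) :
    ∑ m ∈ s, (∑' t : ℤ, ((1 + |(t:ℝ)|) ^ 2)⁻¹ * (a (m - t) * b (m + t))) ^ r ≤
      (16 * wSum * A * B) ^ r := by
  have hr0 : 0 < r := by linarith
  have hw := wSum_pos
  have hfin : ∀ T : Finset ℤ, ∑ m ∈ s, (∑ t ∈ T, ((1 + |(t:ℝ)|) ^ 2)⁻¹ * (a (m - t) * b (m + t))) ^ r ≤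
      (16 * wSum * A * B) ^ r := by
    intro T
    have h := sum_error_finite hp hq hr hr1 (a := fun x => A⁻¹ * a x) (b := fun x => B⁻¹ * b x)
      (fun x => mul_nonneg (by positivity) (ha x)) (fun x => mul_nonneg (by positivity) (hb x))
      (fun s => by
        simp only [fun x => mul_rpow (z := p) (inv_nonneg.2 hA.le) (ha x), ← Finset.mul_sum]
        rw [inv_rpow hA.le]
        refine (mul_le_mul_of_nonneg_left (na s) (by positivity)).trans_eq ?_
        exact inv_mul_cancel₀ (by positivity))
      (fun s => by
        simp only [fun x => mul_rpow (z := q) (inv_nonneg.2 hB.le) (hb x), ← Finset.mul_sum]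
        rw [inv_rpow hB.le]
        refine (mul_le_mul_of_nonneg_left (nb s) (by positivity)).trans_eq ?_
        exact inv_mul_cancel₀ (by positivity)) T s
    rw [show 16 * wSum * A * B = (A * B) * (16 * wSum) by ring, mul_rpow (by positivity) (by positivity)]
    refine le_trans (le_of_eq ?_) (mul_le_mul_of_nonneg_left h (by positivity))
    rw [Finset.mul_sum]
    refine Finset.sum_congr rfl fun m _ => ?_
    have h0 : 0 ≤ ∑ t ∈ T, ((1 + |(t:ℝ)|) ^ 2)⁻¹ * (A⁻¹ * a (m - t) * (B⁻¹ * b (m + t))) :=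
      Finset.sum_nonneg fun t _ => mul_nonneg (by positivity) (mul_nonneg
        (mul_nonneg (by positivity) (ha _)) (mul_nonneg (by positivity) (hb _)))
    rw [← mul_rpow (by positivity) h0, Finset.mul_sum]
    congr 1
    refine Finset.sum_congr rfl fun t _ => ?_
    field_simp
  refine le_of_tendsto' (x := Filter.atTop)
    (f := fun T : Finset ℤ => ∑ m ∈ s, (∑ t ∈ T, ((1 + |(t:ℝ)|) ^ 2)⁻¹ * (a (m - t) * b (m + t))) ^ r)
    (tendsto_finsetSum _ fun m _ => ?_) hfin
  have h : Filter.Tendsto (fun T : Finset ℤ => ∑ t ∈ T, ((1 + |(t:ℝ)|) ^ 2)⁻¹ * (a (m - t) * b (m + t)))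
    Filter.atTop (nhds _) := (hs m).hasSum
  exact h.rpow_const (Or.inr hr0.le)

lemma FT_eq (f : ℝ → ℂ) (ξ : ℝ) : FT f ξ = ∫ t : ℝ, ee (-(t * ξ)) * f t := by
  unfold FT ee
  congr 1; ext t; congr 3; push_cast; ring

lemma FT_schwartz (f : SchwartzMap ℝ ℂ) : FT f = ⇑(FourierTransform.fourier f) := by
  ext ξ
  rw [SchwartzMap.fourier_coe, Real.fourier_real_eq_integral_exp_smul]
  simp [FT]

lemma integrable_FT (f : SchwartzMap ℝ ℂ) : Integrable (FT f) := by
  rw [FT_schwartz]; exact SchwartzMap.integrable _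

lemma continuous_FT (f : SchwartzMap ℝ ℂ) : Continuous (FT f) := by
  rw [FT_schwartz]; exact SchwartzMap.continuous _

/-- Fourier inversion for Schwartz functions. -/
lemma integral_ee_mul_FT (f : SchwartzMap ℝ ℂ) (x : ℝ) : ∫ ξ, ee (ξ * x) * FT f ξ = f x := by
  have h0 : FourierTransformInv.fourierInv (FourierTransform.fourier f : SchwartzMap ℝ ℂ) = f :=
    FourierTransform.fourierInv_fourier_eq f
  have h := congrArg (fun F : SchwartzMap ℝ ℂ => F x) h0
  simp only [SchwartzMap.fourierInv_coe] at h
  rw [← h, Real.fourierInv_eq', ← FT_schwartz]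
  congr 1; ext ξ
  simp only [ee, smul_eq_mul]
  congr 3; simp; ring

lemma biMul_eq_ee (A : Set ℝ) (f g : ℝ → ℂ) (x : ℝ) :
    biMul A f g x = ∫ ξ : ℝ × ℝ, ee (x * (ξ.1 + ξ.2)) * FT f ξ.1 * FT g ξ.2 *
      A.indicator 1 (ξ.2 - ξ.1) := by
  unfold biMul ee
  congr 1; ext ξ; congr 5; push_cast; ring

/-- The frequency slices of a bilinear multiplier, on the space side. -/
lemma slice_eq (f g : SchwartzMap ℝ ℂ) (x s : ℝ) :
    ∫ ξ, ee (x * (2 * ξ + s)) * FT f ξ * FT g (ξ + s) =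
      ∫ t, f (x - t) * g (x + t) * ee (-(t * s)) := by
  have h_int : Integrable (fun z : ℝ × ℝ => ee (x * (2 * z.1 + s)) * FT f z.1 *
      (ee (-(z.2 * (z.1 + s))) * g z.2)) (volume.prod volume) := by
    have h := (integrable_FT f).mul_prod g.integrable (μ := volume) (ν := volume)
    refine h.mono ?_ (Filter.Eventually.of_forall fun z => by simp)
    have h1 := continuous_ee
    have h2 := continuous_FT f
    have h3 := g.continuous
    exact Continuous.aestronglyMeasurable (by fun_prop)
  calc ∫ ξ, ee (x * (2 * ξ + s)) * FT f ξ * FT g (ξ + s)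
      = ∫ ξ, ∫ τ, ee (x * (2 * ξ + s)) * FT f ξ * (ee (-(τ * (ξ + s))) * g τ) := by
        congr 1; ext ξ
        rw [FT_eq g, integral_const_mul]
    _ = ∫ τ, ∫ ξ, ee (x * (2 * ξ + s)) * FT f ξ * (ee (-(τ * (ξ + s))) * g τ) :=
        integral_integral_swap h_int
    _ = ∫ τ, f (2 * x - τ) * g τ * ee ((x - τ) * s) := by
        congr 1; ext τ
        rw [← integral_ee_mul_FT f, mul_assoc, ← integral_mul_const]
        congr 1; ext ξ
        rw [show ee (x * (2 * ξ + s)) * FT f ξ * (ee (-(τ * (ξ + s))) * g τ) =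
          (ee (x * (2 * ξ + s)) * ee (-(τ * (ξ + s)))) * FT f ξ * g τ by ring,
          ← ee_add, show x * (2 * ξ + s) + -(τ * (ξ + s)) = ξ * (2 * x - τ) + (x - τ) * s by ring,
          ee_add]
        ring
    _ = _ := by
        rw [← integral_add_left_eq_self (fun τ => f (2 * x - τ) * g τ * ee ((x - τ) * s)) x]
        congr 1; ext t
        rw [show 2 * x - (x + t) = x - t by ring, show (x - (x + t)) * s = -(t * s) by ring]

lemma biMul_Icc (f g : SchwartzMap ℝ ℂ) {a b : ℝ} (hab : a ≤ b) (x : ℝ) :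
    biMul (Icc a b) f g x = ∫ t, f (x - t) * g (x + t) * ∫ s in a..b, ee (-(t * s)) := by
  have h1 := continuous_ee
  have h2 := continuous_FT f
  have h3 := continuous_FT g
  have hmp := measurePreserving_prod_add (volume : Measure ℝ) (volume : Measure ℝ)
  have hI0 : Integrable (fun ξ : ℝ × ℝ => ee (x * (ξ.1 + ξ.2)) * FT f ξ.1 * FT g ξ.2 *
      (Icc a b).indicator 1 (ξ.2 - ξ.1)) (volume.prod volume) := by
    have h := (integrable_FT f).mul_prod (integrable_FT g) (μ := volume) (ν := volume)
    refine h.mono ?_ (Filter.Eventually.of_forall fun z => ?_)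
    · refine (Continuous.aestronglyMeasurable (by fun_prop)).mul ?_
      exact ((measurable_one.indicator measurableSet_Icc).comp
        (measurable_snd.sub measurable_fst)).aestronglyMeasurable
    · simp only [norm_mul, norm_ee, one_mul]
      refine mul_le_of_le_one_right (by positivity) ?_
      by_cases hz : z.2 - z.1 ∈ Icc a b
      · simp [indicator_of_mem hz]
      · simp [indicator_of_notMem hz]
  have hI2 := (hmp.integrable_comp_emb (MeasurableEquiv.shearAddRight ℝ).measurableEmbedding).2 hI0
  simp only [Function.comp_def] at hI2
  rw [biMul_eq_ee, Measure.volume_eq_prod, ← hmp.integral_comp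
    (MeasurableEquiv.shearAddRight ℝ).measurableEmbedding,
    integral_prod_symm _ hI2]
  have hI1 : Integrable (fun z : ℝ × ℝ => f (x - z.2) * g (x + z.2) * ee (-(z.2 * z.1)))
      ((volume.restrict (Ioc a b)).prod volume) := by
    have hf : Integrable (fun t => f (x - t) * g (x + t)) := by
      refine (f.integrable.comp_sub_left x).mul_bdd (c := SchwartzMap.seminorm ℝ 0 0 g)
        (g.continuous.comp (continuous_const.add continuous_id)).aestronglyMeasurable
        (Filter.Eventually.of_forall fun t => ?_)
      simpa using g.norm_le_seminorm ℝ (x + t)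
    have h := (integrable_const (1:ℂ) (μ := volume.restrict (Ioc a b))).mul_prod hf
    refine h.mono ?_ (Filter.Eventually.of_forall fun z => by simp)
    have h4 := f.continuous
    have h5 := g.continuous
    exact Continuous.aestronglyMeasurable (by fun_prop)
  calc _ = ∫ s, (Icc a b).indicator (fun s => ∫ t, f (x - t) * g (x + t) * ee (-(t * s))) s := by
        congr 1; ext s
        by_cases hs : s ∈ Icc a b
        · rw [indicator_of_mem hs, ← slice_eq]
          congr 1; ext ξ
          simp only [add_sub_cancel_left, indicator_of_mem hs, Pi.one_apply, mul_one]
          congr 3; ring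
        · rw [indicator_of_notMem hs]
          simp [indicator_of_notMem hs]
    _ = ∫ s in Ioc a b, ∫ t, f (x - t) * g (x + t) * ee (-(t * s)) := by
        rw [integral_indicator measurableSet_Icc, integral_Icc_eq_integral_Ioc]
    _ = ∫ t, ∫ s in Ioc a b, f (x - t) * g (x + t) * ee (-(t * s)) :=
        integral_integral_swap hI1
    _ = _ := by
        congr 1; ext t
        rw [integral_const_mul, intervalIntegral.integral_of_le hab]

/-- The rescaled formula for the multipliers of a periodic family of strips. -/
lemma biMul_scaled (f g : SchwartzMap ℝ ℂ) {δ : ℝ} (hδ : 0 < δ) {a b θa θb : ℝ} (hab : a ≤ b) (n : ℤ)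
    (ha : δ * a = θa + n) (hb : δ * b = θb + n) (u : ℝ) :
    biMul (Icc a b) f g (δ * u) = ∫ σ, f (δ * (u - σ)) * g (δ * (u + σ)) *
      (∫ s in θa..θb, ee (-(σ * s))) * ee (-(n * σ)) := by
  rw [biMul_Icc f g hab]
  have h := Measure.integral_comp_mul_left (fun t => f (δ * u - t) * g (δ * u + t) *
    ∫ s in a..b, ee (-(t * s))) δ
  rw [abs_of_pos (by positivity), eq_inv_smul_iff₀ hδ.ne'] at h
  rw [← h, ← integral_smul]
  congr 1; ext σ
  have e : δ • ∫ s in a..b, ee (-(δ * σ * s)) = (∫ s in θa..θb, ee (-(σ * s))) * ee (-(n * σ)) := by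
    have h2 := intervalIntegral.smul_integral_comp_mul_left (a := a) (b := b)
      (fun s => ee (-(σ * s))) δ
    rw [ha, hb] at h2
    rw [← intervalIntegral.integral_mul_const]
    simp only [← ee_add]
    have h3 := intervalIntegral.integral_comp_add_right (a := θa) (b := θb)
      (fun s => ee (-(σ * s))) (n:ℝ)
    rw [← h2] at h3
    simp only [show ∀ s, δ * σ * s = σ * (δ * s) from fun s => by ring, ← h3]
    refine intervalIntegral.integral_congr fun s _ => ?_
    congr 1; ring
  rw [← mul_smul_comm, e, ← mul_assoc]
  simp only [mul_sub, mul_add, mul_comm]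

/-- The quadratic decay profile. -/
noncomputable def dcy (x : ℝ) : ℝ := ((1 + |x|) ^ 2)⁻¹

lemma dcy_pos (x : ℝ) : 0 < dcy x := by unfold dcy; positivity

lemma dcy_le_one (x : ℝ) : dcy x ≤ 1 := by
  unfold dcy
  refine inv_le_one_of_one_le₀ ?_
  nlinarith [abs_nonneg x]

lemma integrable_dcy : Integrable dcy := by
  have h := integrable_one_add_norm (E := ℝ) (μ := volume) (r := 2) (by simp)
  refine h.congr (Filter.Eventually.of_forall fun x => ?_)
  simp only [dcy, Real.norm_eq_abs]
  rw [rpow_neg (by positivity)]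
  norm_num

lemma dcy_add_le (x y : ℝ) : dcy (x + y) ≤ (1 + |y|) ^ 2 * dcy x := by
  unfold dcy
  have h : 1 + |x| ≤ (1 + |x + y|) * (1 + |y|) := by
    have := abs_sub_abs_le_abs_sub x (-y)
    rw [abs_neg, sub_neg_eq_add] at this
    nlinarith [abs_nonneg y, abs_nonneg (x + y)]
  rw [← div_eq_mul_inv, inv_le_iff_one_le_mul₀ (by positivity), ← mul_div_right_comm,
    one_le_div (by positivity)]
  calc (1 + |x|) ^ 2 ≤ ((1 + |x + y|) * (1 + |y|)) ^ 2 := by gcongr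
    _ = _ := by ring

lemma summable_dcy_add (y : ℝ) : Summable fun j : ℤ => dcy (y + j) := by
  refine summable_of_sum_le (c := 16 * wSum) (fun j => (dcy_pos _).le) fun s => ?_
  have h := sum_scaled_weight_le s (-y) 0
  simp only [pow_zero, div_one, mul_one, sub_neg_eq_add] at h
  simpa [dcy, add_comm] using h

lemma summable_dcy : Summable fun j : ℤ => dcy j := by
  simpa using summable_dcy_add 0

/-- Parseval's identity for periodizations. -/
lemma tsum_sq_fourier_eq {H : ℝ → ℂ} (hH : Continuous H) {C : ℝ} (hC : ∀ x, ‖H x‖ ≤ C * dcy x) :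
    ∑' n : ℤ, ‖∫ σ, H σ * ee (-(n * σ))‖ ^ 2 = ∫ σ in Ioc (0:ℝ) 1, ‖∑' j : ℤ, H (σ + j)‖ ^ 2 := by
  have hC0 : 0 ≤ C := by
    have := (norm_nonneg _).trans (hC 0)
    exact nonneg_of_mul_nonneg_left this (dcy_pos 0)
  let f : C(ℝ, ℂ) := ⟨H, hH⟩
  have hf : ∀ K : TopologicalSpace.Compacts ℝ,
      Summable fun n : ℤ => ‖(f.comp (ContinuousMap.addRight (n:ℝ))).restrict K‖ := by
    intro K
    obtain ⟨R, hR⟩ := K.isCompact.isBounded.exists_norm_le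
    refine Summable.of_nonneg_of_le (fun n => norm_nonneg _) (fun n => ?_)
      (summable_dcy.mul_left (C * (1 + |R|) ^ 2))
    refine (ContinuousMap.norm_le _ (mul_nonneg (by positivity) (dcy_pos _).le)).2 fun x => ?_
    have hx : |(x:ℝ)| ≤ |R| := (hR x x.2).trans (le_abs_self R)
    calc ‖H (x + n)‖ ≤ C * dcy (n + x) := by rw [add_comm (n:ℝ)]; exact hC _
      _ ≤ C * ((1 + |(x:ℝ)|) ^ 2 * dcy n) := by gcongr; exact dcy_add_le _ _
      _ ≤ C * ((1 + |R|) ^ 2 * dcy n) := by gcongr; exact (dcy_pos _).le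
      _ = _ := by ring
  let F : C(UnitAddCircle, ℂ) := ⟨(f.periodic_tsum_comp_add_zsmul 1).lift,
    continuous_coinduced_dom.mpr (map_continuous _)⟩
  have h1 : ∀ n : ℤ, fourierCoeff F n = ∫ σ, H σ * ee (-(n * σ)) := by
    intro n
    have := Real.fourierCoeff_tsum_comp_add hf n
    refine this.trans ?_
    rw [Real.fourier_real_eq_integral_exp_smul]
    congr 1; ext σ
    simp only [smul_eq_mul, ee, f, ContinuousMap.coe_mk]
    rw [mul_comm]
    congr 3; push_cast; ring
  have h2 := tsum_sq_fourierCoeff (ContinuousMap.toLp 2 AddCircle.haarAddCircle ℂ F)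
  have h3 : ∀ᵐ t ∂AddCircle.haarAddCircle, ‖(ContinuousMap.toLp 2 AddCircle.haarAddCircle ℂ F :
      UnitAddCircle → ℂ) t‖ ^ 2 = ‖F t‖ ^ 2 := by
    filter_upwards [ContinuousMap.coeFn_toLp (p := 2) (𝕜 := ℂ) AddCircle.haarAddCircle F] with t ht
    rw [ht]
  rw [integral_congr_ae h3, AddCircle.integral_haarAddCircle, inv_one, one_smul,
    ← UnitAddCircle.integral_preimage 0] at h2
  simp only [fourierCoeff_toLp, h1, zero_add] at h2
  rw [h2]
  congr 1; ext σ
  congr 2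
  simp only [F, ContinuousMap.coe_mk, Function.Periodic.lift_coe]
  rw [← ContinuousMap.tsum_apply]
  · simp [f]
  · refine ContinuousMap.summable_of_locally_summable_norm ?_
    simpa using hf

/-- The Fourier transform of an interval. -/
noncomputable def kk (θa θb σ : ℝ) : ℂ := ∫ s in θa..θb, ee (-(σ * s))

lemma continuous_kk (θa θb : ℝ) : Continuous (kk θa θb) := by
  have h := continuous_ee
  unfold kk
  exact intervalIntegral.continuous_parametric_intervalIntegral_of_continuous' (by fun_prop) _ _

lemma norm_kk_le {θa θb : ℝ} (h0 : θa ≤ θb) (h1 : θb ≤ θa + 1) (σ : ℝ) : ‖kk θa θb σ‖ ≤ 1 := by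
  have h := intervalIntegral.norm_integral_le_of_norm_le_const (a := θa) (b := θb)
    (f := fun s => ee (-(σ * s))) (C := 1) fun s _ => by simp
  rw [abs_of_nonneg (by linarith)] at h
  unfold kk
  linarith

lemma kk_eq (θa θb : ℝ) {τ : ℝ} (hτ : τ ≠ 0) :
    kk θa θb τ = (τ:ℂ)⁻¹ * ((2 * π * Complex.I)⁻¹ * (ee (-(τ * θa)) - ee (-(τ * θb)))) := by
  have hc : -(2 * π * τ * Complex.I) ≠ 0 := by
    simp [hτ, Real.pi_ne_zero, Complex.I_ne_zero]
  have h := integral_exp_mul_complex (a := θa) (b := θb) hc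
  have e : ∀ s : ℝ, ee (-(τ * s)) = Complex.exp (-(2 * π * τ * Complex.I) * s) := by
    intro s; unfold ee; congr 1; push_cast; ring
  unfold kk
  simp only [e, h]
  have h1 : (τ:ℂ) ≠ 0 := by exact_mod_cast hτ
  have h2 : (π:ℂ) ≠ 0 := by exact_mod_cast Real.pi_ne_zero
  have h3 := Complex.I_ne_zero
  field_simp
  ring

lemma dcy_inv_le {j : ℤ} {σ : ℝ} (hσ0 : 0 ≤ σ) (hσ1 : σ ≤ 1) (h0 : j ≠ 0) (h1 : j ≠ -1) :
    (|σ + j| * |(j:ℝ)|)⁻¹ ≤ 8 * dcy j := by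
  have hj : 1 ≤ |(j:ℝ)| := by exact_mod_cast Int.one_le_abs h0
  have h2 : |(j:ℝ)| / 2 ≤ |σ + j| := by
    rcases lt_or_gt_of_ne h0 with h | h
    · have h3 : (j:ℝ) ≤ -2 := by exact_mod_cast (by omega : j ≤ -2)
      rw [abs_of_neg (by linarith), abs_of_neg (by linarith)]; linarith
    · have h3 : (1:ℝ) ≤ j := by exact_mod_cast h
      rw [abs_of_pos (by linarith), abs_of_pos (by linarith)]; linarith
  unfold dcy
  have h4 := mul_le_mul_of_nonneg_right h2 (abs_nonneg (j:ℝ))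
  have h5 : 0 < |σ + j| * |(j:ℝ)| := mul_pos (by linarith) (by linarith)
  rw [← div_eq_mul_inv, inv_le_iff_one_le_mul₀ h5, ← mul_div_right_comm, one_le_div (by positivity)]
  nlinarith

/-- Discretization of the kernel. -/
lemma kk_approx {θa θb : ℝ} (h0 : θa ≤ θb) (h1 : θb ≤ θa + 1) {σ : ℝ} (hσ0 : 0 ≤ σ) (hσ1 : σ ≤ 1)
    (j : ℤ) : ‖kk θa θb (σ + j) - (j:ℂ)⁻¹ * ((2 * π * Complex.I)⁻¹ *
      (ee (-((σ + j) * θa)) - ee (-((σ + j) * θb))))‖ ≤ 8 * dcy j := by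
  have hpi : (2 * π)⁻¹ ≤ 1 / 2 := by
    rw [inv_eq_one_div]
    exact one_div_le_one_div_of_le (by norm_num) (by linarith [Real.pi_gt_three])
  have hw : ‖(2 * π * Complex.I : ℂ)⁻¹ * (ee (-((σ + j) * θa)) - ee (-((σ + j) * θb)))‖ ≤ 1 := by
    have h : ‖ee (-((σ + j) * θa)) - ee (-((σ + j) * θb))‖ ≤ 2 := by
      refine (norm_sub_le _ _).trans ?_
      simp; norm_num
    rw [norm_mul, norm_inv]
    have e : ‖(2 * π * Complex.I : ℂ)‖ = 2 * π := by
      simp [abs_of_pos Real.pi_pos]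
    rw [e]
    calc _ ≤ 1 / 2 * (2:ℝ) := by gcongr
      _ = 1 := by norm_num
  have hk := norm_kk_le h0 h1 (σ + j)
  by_cases hj0 : j = 0
  · subst hj0
    simp only [Int.cast_zero, inv_zero, zero_mul, sub_zero] at hk ⊢
    refine hk.trans ?_
    norm_num [dcy]
  by_cases hj1 : j = -1
  · refine (norm_sub_le _ _).trans ?_
    rw [norm_mul]
    have : ‖((j:ℤ):ℂ)⁻¹‖ = 1 := by subst hj1; simp
    rw [this, one_mul]
    refine (add_le_add hk hw).trans ?_
    subst hj1
    norm_num [dcy]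
  have hj : (j:ℝ) ≠ 0 := by exact_mod_cast hj0
  have hτ : σ + j ≠ 0 := by
    intro h
    have h1 : (j:ℝ) = -σ := by linarith
    have h2 : -1 ≤ j := by
      have : (-1:ℝ) ≤ j := by linarith
      exact_mod_cast this
    have h3 : j ≤ 0 := by
      have : (j:ℝ) ≤ 0 := by linarith
      exact_mod_cast this
    omega
  rw [kk_eq _ _ hτ, ← sub_mul, norm_mul]
  have e : ((σ + j : ℝ):ℂ)⁻¹ - (j:ℂ)⁻¹ = ((-σ * ((σ + j) * j)⁻¹ : ℝ) : ℂ) := by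
    have h1 : ((σ + j : ℝ):ℂ) ≠ 0 := by exact_mod_cast hτ
    have h2 : (j:ℂ) ≠ 0 := by exact_mod_cast hj0
    push_cast at h1 ⊢
    field_simp
    ring
  rw [e, Complex.norm_real, norm_mul, norm_neg, norm_inv, norm_mul]
  simp only [Real.norm_eq_abs]
  have h8 := dcy_inv_le hσ0 hσ1 hj0 hj1
  rw [abs_of_nonneg hσ0]
  calc σ * (|σ + j| * |(j:ℝ)|)⁻¹ * _ ≤ 1 * (|σ + j| * |(j:ℝ)|)⁻¹ * 1 := by gcongr
    _ ≤ _ := by simpa using h8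

/-- The map `(y, σ) ↦ (y - σ, y + σ)`. -/
def shear (z : ℝ × ℝ) : ℝ × ℝ := (z.1 - z.2, z.1 + z.2)

lemma continuous_shear : Continuous shear := by unfold shear; fun_prop

lemma map_shear_le : Measure.map shear (volume.prod volume) ≤ (volume : Measure ℝ).prod volume := by
  let L : (ℝ × ℝ) →ₗ[ℝ] (ℝ × ℝ) :=
    Matrix.toLin (Module.Basis.finTwoProd ℝ) (Module.Basis.finTwoProd ℝ) !![1, -1; 1, 1]
  have hL : ⇑L = shear := by
    ext z <;> simp [L, Matrix.toLin_finTwoProd_apply, shear, sub_eq_add_neg]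
  have hd : LinearMap.det L = 2 := by
    simp only [L, LinearMap.det_toLin, Matrix.det_fin_two_of]; norm_num
  have h := Measure.map_linearMap_addHaar_eq_smul_addHaar ((volume : Measure ℝ).prod volume)
    (f := L) (by rw [hd]; norm_num)
  rw [hL, hd] at h
  rw [h]
  intro s
  simp only [Measure.smul_apply, smul_eq_mul]
  refine mul_le_of_le_one_left zero_le ?_
  rw [ENNReal.ofReal_le_one, abs_of_pos (by norm_num)]
  norm_num

lemma eLpNorm_comp_shear_le {Φ : ℝ × ℝ → ℂ} (hΦ : AEStronglyMeasurable Φ (volume.prod volume)) :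
    eLpNorm (fun z => Φ (shear z)) 2 (volume.prod volume) ≤ eLpNorm Φ 2 (volume.prod volume) := by
  have h := eLpNorm_map_measure (p := 2) (μ := (volume : Measure ℝ).prod volume) (f := shear)
    (hΦ.mono_measure map_shear_le) continuous_shear.aemeasurable
  refine (le_of_eq ?_).trans (eLpNorm_mono_measure Φ map_shear_le)
  rw [h]; rfl

lemma eLpNorm_tensor {F G : ℝ → ℂ} (hF : AEStronglyMeasurable F) (hG : AEStronglyMeasurable G) :
    eLpNorm (fun z : ℝ × ℝ => F z.1 * G z.2) 2 (volume.prod volume) = eLpNorm F 2 * eLpNorm G 2 := by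
  simp only [eLpNorm_eq_lintegral_rpow_enorm_toReal (p := 2) (by norm_num) (by norm_num), enorm_mul,
    ENNReal.toReal_ofNat]
  rw [← ENNReal.mul_rpow_of_nonneg _ _ (by norm_num)]
  congr 1
  rw [← lintegral_prod_mul (by fun_prop) (by fun_prop)]
  congr 1; ext z
  rw [ENNReal.mul_rpow_of_nonneg _ _ (by norm_num)]

lemma memLp_tensor {F G : ℝ → ℂ} (hF : MemLp F 2) (hG : MemLp G 2) :
    MemLp (fun z : ℝ × ℝ => F z.1 * G z.2) 2 (volume.prod volume) :=
  ⟨hF.1.comp_fst.mul hG.1.comp_snd, by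
    rw [eLpNorm_tensor hF.1 hG.1]; exact ENNReal.mul_lt_top hF.2 hG.2⟩

lemma ae_fst {p : ℝ → Prop} (h : ∀ᵐ x : ℝ, p x) :
    ∀ᵐ z ∂((volume : Measure ℝ).prod (volume : Measure ℝ)), p z.1 :=
  Measure.quasiMeasurePreserving_fst.ae h

lemma ae_snd {p : ℝ → Prop} (h : ∀ᵐ x : ℝ, p x) :
    ∀ᵐ z ∂((volume : Measure ℝ).prod (volume : Measure ℝ)), p z.2 :=
  Measure.quasiMeasurePreserving_snd.ae h

lemma toLp_tensor_congr {F G F' G' : ℝ → ℂ} (hF : MemLp F 2) (hG : MemLp G 2) (hF' : MemLp F' 2)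
    (hG' : MemLp G' 2) (h1 : F =ᵐ[volume] F') (h2 : G =ᵐ[volume] G') :
    (memLp_tensor hF hG).toLp = (memLp_tensor hF' hG').toLp := by
  rw [MemLp.toLp_eq_toLp_iff]
  filter_upwards [ae_fst h1, ae_snd h2] with z h3 h4
  rw [h3, h4]

/-- The tensor product `L² × L² → L²(ℝ²)`. -/
noncomputable def tensor : Lp ℂ 2 (volume : Measure ℝ) →ₗ[ℂ] Lp ℂ 2 (volume : Measure ℝ) →ₗ[ℂ]
    Lp ℂ 2 ((volume : Measure ℝ).prod (volume : Measure ℝ)) :=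
  LinearMap.mk₂ ℂ (fun F G => (memLp_tensor (Lp.memLp F) (Lp.memLp G)).toLp)
    (fun F F' G => by
      rw [← MemLp.toLp_add, MemLp.toLp_eq_toLp_iff]
      filter_upwards [ae_fst (Lp.coeFn_add F F')] with z h
      simp only [h, Pi.add_apply, add_mul])
    (fun c F G => by
      rw [← MemLp.toLp_const_smul, MemLp.toLp_eq_toLp_iff]
      filter_upwards [ae_fst (Lp.coeFn_smul c F)] with z h
      simp only [h, Pi.smul_apply, smul_eq_mul, mul_assoc])
    (fun F G G' => by
      rw [← MemLp.toLp_add, MemLp.toLp_eq_toLp_iff]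
      filter_upwards [ae_snd (Lp.coeFn_add G G')] with z h
      simp only [h, Pi.add_apply, mul_add])
    (fun c F G => by
      rw [← MemLp.toLp_const_smul, MemLp.toLp_eq_toLp_iff]
      filter_upwards [ae_snd (Lp.coeFn_smul c G)] with z h
      simp only [h, Pi.smul_apply, smul_eq_mul]; ring)

lemma tensor_toLp {F G : ℝ → ℂ} (hF : MemLp F 2) (hG : MemLp G 2) :
    tensor hF.toLp hG.toLp = (memLp_tensor hF hG).toLp :=
  toLp_tensor_congr (Lp.memLp _) (Lp.memLp _) hF hG hF.coeFn_toLp hG.coeFn_toLp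

lemma norm_tensor_le (F G : Lp ℂ 2 (volume : Measure ℝ)) : ‖tensor F G‖ ≤ ‖F‖ * ‖G‖ := by
  refine le_of_eq ?_
  change ‖(memLp_tensor (Lp.memLp F) (Lp.memLp G)).toLp‖ = _
  rw [Lp.norm_toLp, eLpNorm_tensor (Lp.memLp F).1 (Lp.memLp G).1, ENNReal.toReal_mul]
  rfl

lemma toLp_sum {α ι : Type*} [MeasurableSpace α] {μ : Measure α} (s : Finset ι) {f : ι → α → ℂ}
    (h : ∀ i, MemLp (f i) 2 μ) :
    ∑ i ∈ s, (h i).toLp = (memLp_finsetSum s fun i _ => h i).toLp := by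
  classical
  induction s using Finset.induction_on with
  | empty =>
    simp only [Finset.sum_empty]
    exact (MemLp.toLp_zero _).symm
  | insert i s hi ih =>
    rw [Finset.sum_insert hi, ih, ← MemLp.toLp_add, MemLp.toLp_eq_toLp_iff]
    refine Filter.Eventually.of_forall fun z => ?_
    simp [Finset.sum_insert hi]

lemma eLpNorm_eq_ofReal_toLp {α : Type*} [MeasurableSpace α] {μ : Measure α} {f : α → ℂ}
    (h : MemLp f 2 μ) : eLpNorm f 2 μ = ENNReal.ofReal ‖h.toLp‖ := by
  rw [Lp.norm_toLp, ENNReal.ofReal_toReal h.2.ne]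

/-- Modulation of a sequence. -/
noncomputable def modL {E : Type*} [SMul ℂ E] (θ : ℝ) (f : ℤ → E) (x : ℤ) : E := ee (x * θ) • f x

lemma norm_modL {E : Type*} [NormedAddCommGroup E] [NormedSpace ℂ E] (θ : ℝ) (f : ℤ → E) (x : ℤ) :
    ‖modL θ f x‖ = ‖f x‖ := by simp [modL, norm_smul]

section

variable {F G : ℤ → ℝ → ℂ}

lemma eLpNorm_modulated (hF : ∀ x, MemLp (F x) 2) (hG : ∀ x, MemLp (G x) 2) (θ : ℝ) (m : ℤ)
    (s : Finset ℤ) : ∃ h : MemLp (fun w : ℝ × ℝ => ∑ j ∈ s, (j:ℂ)⁻¹ *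
      (ee ((m - j : ℤ) * θ) * (F (m - j) w.1 * G (m + j) w.2))) 2 (volume.prod volume),
    h.toLp = ∑ j ∈ s, (j:ℂ)⁻¹ • tensor (modL θ (fun x => (hF x).toLp) (m - j)) ((hG (m + j)).toLp) := by
  have h1 : ∀ j : ℤ, MemLp (fun w : ℝ × ℝ => (j:ℂ)⁻¹ *
      (ee ((m - j : ℤ) * θ) * (F (m - j) w.1 * G (m + j) w.2))) 2 (volume.prod volume) := fun j =>
    ((memLp_tensor (hF _) (hG _)).const_mul _).const_mul _
  refine ⟨memLp_finsetSum s fun j _ => h1 j, ?_⟩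
  rw [← toLp_sum s h1]
  refine Finset.sum_congr rfl fun j _ => ?_
  rw [modL, map_smul, LinearMap.smul_apply, tensor_toLp]
  rfl

lemma finite_bound (hF : ∀ x, MemLp (F x) 2) (hG : ∀ x, MemLp (G x) 2)
    {θa θb : ℝ} (h0 : θa ≤ θb) (h1 : θb ≤ θa + 1) (m : ℤ) (s : Finset ℤ) :
    eLpNorm (fun z : ℝ × ℝ => ∑ j ∈ s, F (m - j) (z.1 - z.2) * G (m + j) (z.1 + z.2) *
        kk θa θb (z.2 + j)) 2 ((volume.prod volume).restrict (Icc 0 1 ×ˢ Icc 0 1)) ≤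
      ENNReal.ofReal (
        ‖∑ j ∈ s, (j:ℂ)⁻¹ • tensor (modL θa (fun x => (hF x).toLp) (m - j)) ((hG (m + j)).toLp)‖ +
        ‖∑ j ∈ s, (j:ℂ)⁻¹ • tensor (modL θb (fun x => (hF x).toLp) (m - j)) ((hG (m + j)).toLp)‖ +
        8 * ∑ j ∈ s, dcy j * (‖(hF (m - j)).toLp‖ * ‖(hG (m + j)).toLp‖)) := by
  set μ := (volume : Measure ℝ).prod (volume : Measure ℝ) with hμ
  set Q : Set (ℝ × ℝ) := Icc 0 1 ×ˢ Icc 0 1 with hQ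
  have hres : μ.restrict Q ≤ μ := Measure.restrict_le_self
  have hee := continuous_ee
  have hkk := continuous_kk θa θb
  obtain ⟨ma, ea⟩ := eLpNorm_modulated hF hG θa m s
  obtain ⟨mb, eb⟩ := eLpNorm_modulated hF hG θb m s
  rw [← ea, ← eb]
  set c : ℂ := (2 * π * Complex.I)⁻¹ with hc
  have hc1 : ‖c‖ ≤ 1 := by
    have e : ‖(2 * π * Complex.I : ℂ)‖ = 2 * π := by simp [abs_of_pos Real.pi_pos]
    rw [hc, norm_inv, e]
    exact inv_le_one_of_one_le₀ (by linarith [Real.pi_gt_three])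
  set Φ : ℝ → ℝ × ℝ → ℂ := fun θ w => ∑ j ∈ s, (j:ℂ)⁻¹ *
      (ee ((m - j : ℤ) * θ) * (F (m - j) w.1 * G (m + j) w.2)) with hΦ
  set T : ℤ → ℝ × ℝ → ℂ := fun j w => F (m - j) w.1 * G (m + j) w.2 with hT
  have mT : ∀ j, MemLp (T j) 2 μ := fun j => memLp_tensor (hF _) (hG _)
  have qm : Measure.QuasiMeasurePreserving shear μ μ :=
    ⟨continuous_shear.measurable, Measure.absolutelyContinuous_of_le map_shear_le⟩
  have aT : ∀ j, AEStronglyMeasurable (fun z => T j (shear z)) μ :=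
    fun j => (mT j).1.comp_quasiMeasurePreserving qm
  have main : ∀ θ, (h : MemLp (Φ θ) 2 μ) → AEStronglyMeasurable
      (fun z : ℝ × ℝ => c * ee (-((z.2 + m) * θ)) * Φ θ (shear z)) μ ∧
      eLpNorm (fun z : ℝ × ℝ => c * ee (-((z.2 + m) * θ)) * Φ θ (shear z)) 2 (μ.restrict Q) ≤
        ENNReal.ofReal ‖h.toLp‖ := by
    intro θ h
    have h2 : AEStronglyMeasurable (fun z => Φ θ (shear z)) μ := h.1.comp_quasiMeasurePreserving qm
    refine ⟨(Continuous.aestronglyMeasurable (by fun_prop)).mul h2, ?_⟩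
    rw [← eLpNorm_eq_ofReal_toLp]
    refine (eLpNorm_mono_measure _ hres).trans (le_trans ?_ (eLpNorm_comp_shear_le h.1))
    refine eLpNorm_mono_ae (Filter.Eventually.of_forall fun z => ?_)
    rw [norm_mul, norm_mul, norm_ee, mul_one]
    exact mul_le_of_le_one_left (norm_nonneg _) hc1
  set R : ℤ → ℝ × ℝ → ℂ := fun j z => T j (shear z) * (kk θa θb (z.2 + j) - (j:ℂ)⁻¹ * (c *
      (ee (-((z.2 + j) * θa)) - ee (-((z.2 + j) * θb))))) with hR
  have aR : ∀ j, AEStronglyMeasurable (R j) μ := fun j =>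
    (aT j).mul (Continuous.aestronglyMeasurable (by fun_prop))
  have hQm : MeasurableSet Q := measurableSet_Icc.prod measurableSet_Icc
  have bR : ∀ j, eLpNorm (R j) 2 (μ.restrict Q) ≤
      ENNReal.ofReal (8 * dcy j * (‖(hF (m - j)).toLp‖ * ‖(hG (m + j)).toLp‖)) := by
    intro j
    have h2 : eLpNorm (R j) 2 (μ.restrict Q) ≤
        eLpNorm (fun z => ((8 * dcy j : ℝ) : ℂ) * T j (shear z)) 2 (μ.restrict Q) := by
      refine eLpNorm_mono_ae ?_
      filter_upwards [ae_restrict_mem hQm] with z hz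
      have h3 := kk_approx h0 h1 hz.2.1 hz.2.2 j
      have h5 : ‖((8 * dcy j : ℝ) : ℂ) * T j (shear z)‖ = 8 * dcy j * ‖T j (shear z)‖ := by
        rw [norm_mul, Complex.norm_real, Real.norm_eq_abs,
          abs_of_pos (by have := dcy_pos j; positivity)]
      rw [h5]
      simp only [hR]
      rw [norm_mul, mul_comm]
      exact mul_le_mul_of_nonneg_right h3 (norm_nonneg _)
    refine h2.trans ((eLpNorm_mono_measure _ hres).trans ?_)
    have h3 := eLpNorm_comp_shear_le ((mT j).const_mul ((8 * dcy j : ℝ) : ℂ)).1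
    refine h3.trans ?_
    have h4 := eLpNorm_const_smul ((8 * dcy j : ℝ) : ℂ) (T j) 2 μ
    refine h4.le.trans ?_
    rw [eLpNorm_tensor (hF _).1 (hG _).1, eLpNorm_eq_ofReal_toLp (hF _), eLpNorm_eq_ofReal_toLp (hG _),
      ← ENNReal.ofReal_mul (norm_nonneg _), ← ofReal_norm, Complex.norm_real, Real.norm_eq_abs,
      abs_of_pos (by have := dcy_pos j; positivity),
      ← ENNReal.ofReal_mul (by have := dcy_pos j; positivity)]
  have key : (fun z : ℝ × ℝ => ∑ j ∈ s, F (m - j) (z.1 - z.2) * G (m + j) (z.1 + z.2) *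
        kk θa θb (z.2 + j)) = (fun z => c * ee (-((z.2 + m) * θa)) * Φ θa (shear z)) -
        (fun z => c * ee (-((z.2 + m) * θb)) * Φ θb (shear z)) + ∑ j ∈ s, R j := by
    ext z
    simp only [Pi.add_apply, Pi.sub_apply, Finset.sum_apply, hΦ, Finset.mul_sum,
      ← Finset.sum_sub_distrib, ← Finset.sum_add_distrib]
    refine Finset.sum_congr rfl fun j _ => ?_
    have e : ∀ θ, ee (-((z.2 + j) * θ)) = ee (-((z.2 + m) * θ)) * ee ((m - j : ℤ) * θ) := by
      intro θ; rw [← ee_add]; congr 1; push_cast; ring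
    simp only [hR, hT, e, shear]
    ring
  rw [key]
  have ma' := main θa ma
  have mb' := main θb mb
  refine (eLpNorm_add_le ((ma'.1.sub mb'.1).mono_measure hres)
    ((Finset.aestronglyMeasurable_sum s fun j _ => aR j).mono_measure hres) (by norm_num)).trans ?_
  have n1 : 0 ≤ 8 * ∑ j ∈ s, dcy j * (‖(hF (m - j)).toLp‖ * ‖(hG (m + j)).toLp‖) :=
    mul_nonneg (by norm_num) (Finset.sum_nonneg fun j _ => mul_nonneg (dcy_pos _).le (by positivity))
  rw [ENNReal.ofReal_add (by positivity) n1, ENNReal.ofReal_add (norm_nonneg _) (norm_nonneg _)]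
  refine add_le_add ((eLpNorm_sub_le (ma'.1.mono_measure hres) (mb'.1.mono_measure hres)
    (by norm_num)).trans (add_le_add ma'.2 mb'.2)) ?_
  refine (eLpNorm_sum_le (fun j _ => (aR j).mono_measure hres) (by norm_num)).trans ?_
  refine (Finset.sum_le_sum fun j _ => bR j).trans ?_
  rw [← ENNReal.ofReal_sum_of_nonneg fun j _ =>
    mul_nonneg (mul_nonneg (by norm_num) (dcy_pos _).le) (by positivity), Finset.mul_sum]
  simp only [mul_assoc]
  exact le_rfl

set_option maxHeartbeats 1000000 in
/-- The local `L²` bound of the periodized product by discrete Hilbert transforms. -/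
lemma local_bound (hF : ∀ x, MemLp (F x) 2) (hG : ∀ x, MemLp (G x) 2)
    {A B : ℝ} (pF : ∀ x u, ‖F x u‖ ≤ A * dcy x) (pG : ∀ x u, ‖G x u‖ ≤ B)
    (nF : ∀ x, ‖(hF x).toLp‖ ≤ A * dcy x) (nG : ∀ x, ‖(hG x).toLp‖ ≤ B)
    {θa θb : ℝ} (h0 : θa ≤ θb) (h1 : θb ≤ θa + 1) (m : ℤ) :
    eLpNorm (fun z : ℝ × ℝ => ∑' j : ℤ, F (m - j) (z.1 - z.2) * G (m + j) (z.1 + z.2) *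
        kk θa θb (z.2 + j)) 2 ((volume.prod volume).restrict (Icc 0 1 ×ˢ Icc 0 1)) ≤
      ENNReal.ofReal (
        ‖dHil tensor (modL θa fun x => (hF x).toLp) (fun x => (hG x).toLp) m‖ +
        ‖dHil tensor (modL θb fun x => (hF x).toLp) (fun x => (hG x).toLp) m‖ +
        8 * ∑' j : ℤ, dcy j * (‖(hF (m - j)).toLp‖ * ‖(hG (m + j)).toLp‖)) := by
  have hA : 0 ≤ A := nonneg_of_mul_nonneg_left ((norm_nonneg _).trans (nF 0)) (dcy_pos _)
  have hB : 0 ≤ B := (norm_nonneg _).trans (nG 0)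
  have hdm : Summable fun j : ℤ => dcy (m - j : ℤ) := (Equiv.subLeft m).summable_iff.2 summable_dcy
  have hdm' : Summable fun j : ℤ => A * dcy (m - j : ℤ) * B := (hdm.mul_left A).mul_right B
  set s : ℕ → Finset ℤ := fun N => Finset.Icc (-(N:ℤ)) N with hs
  have hsT : Filter.Tendsto s Filter.atTop Filter.atTop := Finset.tendsto_Icc_neg
  have hFG : ∀ j : ℤ, ‖(hF (m - j)).toLp‖ * ‖(hG (m + j)).toLp‖ ≤ A * dcy (m - j : ℤ) * B :=
    fun j => mul_le_mul (nF _) (nG _) (norm_nonneg _) (mul_nonneg hA (dcy_pos _).le)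
  have hpt : ∀ z : ℝ × ℝ, Summable fun j : ℤ => F (m - j) (z.1 - z.2) * G (m + j) (z.1 + z.2) *
        kk θa θb (z.2 + j) := by
    intro z
    refine Summable.of_norm_bounded hdm' fun j => ?_
    rw [norm_mul, norm_mul, ← mul_one (A * _ * B)]
    refine mul_le_mul ?_ (norm_kk_le h0 h1 _) (norm_nonneg _)
      (mul_nonneg (mul_nonneg hA (dcy_pos _).le) hB)
    exact mul_le_mul (pF _ _) (pG _ _) (norm_nonneg _) (mul_nonneg hA (dcy_pos _).le)
  have hd : ∀ θ, Filter.Tendsto (fun N => ‖∑ j ∈ s N, (j:ℂ)⁻¹ •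
      tensor (modL θ (fun x => (hF x).toLp) (m - j)) ((hG (m + j)).toLp)‖) Filter.atTop
      (nhds ‖dHil tensor (modL θ fun x => (hF x).toLp) (fun x => (hG x).toLp) m‖) := by
    intro θ
    have hsum : Summable fun j : ℤ => (j:ℂ)⁻¹ •
        tensor (modL θ (fun x => (hF x).toLp) (m - j)) ((hG (m + j)).toLp) := by
      refine Summable.of_norm_bounded hdm' fun j => ?_
      rw [norm_smul]
      have h2 : ‖(j:ℂ)⁻¹‖ ≤ 1 := by
        rcases eq_or_ne j 0 with rfl | h0
        · simp
        · rw [norm_inv]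
          refine inv_le_one_of_one_le₀ ?_
          rw [← Complex.ofReal_intCast, Complex.norm_real, Real.norm_eq_abs]
          exact_mod_cast Int.one_le_abs h0
      have h3 := norm_tensor_le (modL θ (fun x => (hF x).toLp) (m - j)) ((hG (m + j)).toLp)
      rw [norm_modL] at h3
      exact (mul_le_of_le_one_left (norm_nonneg _) h2).trans (h3.trans (hFG j))
    exact (hsum.hasSum.comp hsT).norm
  have hE : Filter.Tendsto (fun N => ∑ j ∈ s N, dcy j * (‖(hF (m - j)).toLp‖ * ‖(hG (m + j)).toLp‖))
      Filter.atTop (nhds (∑' j : ℤ, dcy j * (‖(hF (m - j)).toLp‖ * ‖(hG (m + j)).toLp‖))) := by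
    have hsum : Summable fun j : ℤ => dcy j * (‖(hF (m - j)).toLp‖ * ‖(hG (m + j)).toLp‖) := by
      refine Summable.of_nonneg_of_le (fun j => mul_nonneg (dcy_pos _).le (by positivity)) (fun j => ?_)
        hdm'
      exact (mul_le_of_le_one_left (by positivity) (dcy_le_one _)).trans (hFG j)
    exact hsum.hasSum.comp hsT
  have hlim := ENNReal.tendsto_ofReal (((hd θa).add (hd θb)).add (hE.const_mul 8))
  have qm : Measure.QuasiMeasurePreserving shear (volume.prod volume) (volume.prod volume) :=
    ⟨continuous_shear.measurable, Measure.absolutelyContinuous_of_le map_shear_le⟩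
  have hkk := continuous_kk θa θb
  refine (Lp.eLpNorm_lim_le_liminf_eLpNorm (f := fun N (z : ℝ × ℝ) => ∑ j ∈ s N,
    F (m - j) (z.1 - z.2) * G (m + j) (z.1 + z.2) * kk θa θb (z.2 + j)) (fun N => ?_) _
    (Filter.Eventually.of_forall fun z => (hpt z).hasSum.comp hsT)).trans ?_
  · have h2 : AEStronglyMeasurable (∑ j ∈ s N, fun z : ℝ × ℝ =>
        F (m - j) (z.1 - z.2) * G (m + j) (z.1 + z.2) * kk θa θb (z.2 + j)) (volume.prod volume) := by
      refine Finset.aestronglyMeasurable_sum _ fun j _ => ?_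
      exact ((memLp_tensor (hF _) (hG _)).1.comp_quasiMeasurePreserving qm).mul
        (Continuous.aestronglyMeasurable (by fun_prop))
    refine (h2.mono_measure Measure.restrict_le_self).congr (Filter.Eventually.of_forall fun z => ?_)
    simp
  · rw [← hlim.liminf_eq]
    exact Filter.liminf_le_liminf (Filter.Eventually.of_forall fun N => finite_bound hF hG h0 h1 m (s N))

end

lemma rpow_add_three_le {a b c r : ℝ} (ha : 0 ≤ a) (hb : 0 ≤ b) (hc : 0 ≤ c) (hr : 0 ≤ r) :
    (a + b + c) ^ r ≤ 3 ^ r * (a ^ r + b ^ r + c ^ r) := by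
  have key : ∀ x : ℝ, 0 ≤ x → a ≤ x → b ≤ x → c ≤ x → x ^ r ≤ a ^ r + b ^ r + c ^ r →
      (a + b + c) ^ r ≤ 3 ^ r * (a ^ r + b ^ r + c ^ r) := by
    intro x hx h1 h2 h3 h4
    calc (a + b + c) ^ r ≤ (3 * x) ^ r := by
          apply rpow_le_rpow (by positivity) (by linarith) hr
      _ = 3 ^ r * x ^ r := mul_rpow (by norm_num) hx
      _ ≤ _ := by gcongr
  have h1 := rpow_nonneg ha r
  have h2 := rpow_nonneg hb r
  have h3 := rpow_nonneg hc r
  rcases le_total a b with h | h <;> rcases le_total b c with h' | h' <;>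
    rcases le_total a c with h'' | h''
  · exact key c hc h'' h' le_rfl (by linarith)
  · exact key c hc (h.trans h') h' le_rfl (by linarith)
  · exact key b hb h le_rfl h' (by linarith)
  · exact key b hb h le_rfl h' (by linarith)
  · exact key c hc h'' h' le_rfl (by linarith)
  · exact key a ha le_rfl h h'' (by linarith)
  · exact key a ha le_rfl h (h'.trans h) (by linarith)
  · exact key a ha le_rfl h h'' (by linarith)

/-- The summed local bounds. -/
lemma summed_bound {p q r : ℝ} (hp : 2 < p) (hq : 2 < q) (hr : 1 / r = 1 / p + 1 / q) (hr1 : 1 < r)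
    (hr2 : r < 2) : ∃ C : ℝ, 0 < C ∧ ∀ (F G : ℤ → ℝ → ℂ) (hF : ∀ x, MemLp (F x) 2)
    (hG : ∀ x, MemLp (G x) 2) (A B : ℝ), (∀ x u, ‖F x u‖ ≤ A * dcy x) → (∀ x u, ‖G x u‖ ≤ B) →
    (∀ x, ‖(hF x).toLp‖ ≤ A * dcy x) → (∀ x, ‖(hG x).toLp‖ ≤ B) →
    ∀ θa θb : ℝ, θa ≤ θb → θb ≤ θa + 1 → ∀ S T : ℝ, 0 < S → 0 < T →
    (∀ s : Finset ℤ, ∑ x ∈ s, ‖(hF x).toLp‖ ^ p ≤ S ^ p) →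
    (∀ s : Finset ℤ, ∑ x ∈ s, ‖(hG x).toLp‖ ^ q ≤ T ^ q) → ∀ s : Finset ℤ,
    ∑ m ∈ s, eLpNorm (fun z : ℝ × ℝ => ∑' j : ℤ, F (m - j) (z.1 - z.2) * G (m + j) (z.1 + z.2) *
        kk θa θb (z.2 + j)) 2 ((volume.prod volume).restrict (Icc 0 1 ×ˢ Icc 0 1)) ^ r ≤
      ENNReal.ofReal ((C * S * T) ^ r) := by
  obtain ⟨C₁, hC₁, hd⟩ := dHil_bound (Lp ℂ 2 (volume : Measure ℝ)) (Lp ℂ 2 (volume : Measure ℝ))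
    (Lp ℂ 2 ((volume : Measure ℝ).prod (volume : Measure ℝ))) hp hq hr hr1 hr2
  have hw := wSum_pos
  have hr0 : 0 < r := by linarith
  set C₀ := max C₁ (8 * (16 * wSum)) with hC₀
  have hC₀p : 0 < C₀ := lt_max_of_lt_left hC₁
  refine ⟨9 * C₀, by positivity, ?_⟩
  intro F G hF hG A B pF pG nF nG θa θb h0 h1 S T hS hT sF sG s
  have hA : 0 ≤ A := nonneg_of_mul_nonneg_left ((norm_nonneg _).trans (nF 0)) (dcy_pos _)
  have hd' : ∀ θ, ∑ m ∈ s, ‖dHil tensor (modL θ fun x => (hF x).toLp) (fun x => (hG x).toLp) m‖ ^ r ≤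
      (C₀ * S * T) ^ r := by
    intro θ
    refine (hd tensor norm_tensor_le (modL θ fun x => (hF x).toLp) (fun x => (hG x).toLp) ?_ S T hS hT
      ?_ sG s).trans (rpow_le_rpow (by positivity) (by gcongr; exact le_max_left _ _) hr0.le)
    · simp only [norm_modL]
      exact Summable.of_nonneg_of_le (fun _ => norm_nonneg _) nF (summable_dcy.mul_left A)
    · simpa only [norm_modL] using sF
  set E : ℤ → ℝ := fun m => ∑' j : ℤ, dcy j * (‖(hF (m - j)).toLp‖ * ‖(hG (m + j)).toLp‖) with hE
  have hE0 : ∀ m, 0 ≤ E m := fun m => tsum_nonneg fun j => mul_nonneg (dcy_pos _).le (by positivity)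
  have hEs : ∑ m ∈ s, (8 * E m) ^ r ≤ (C₀ * S * T) ^ r := by
    have h := sum_error_bound (by linarith : 0 < p) (by linarith : 0 < q) hr hr1
      (a := fun x => ‖(hF x).toLp‖) (b := fun x => ‖(hG x).toLp‖) (fun _ => norm_nonneg _)
      (fun _ => norm_nonneg _) hS hT sF sG (fun m => by
        have hdm : Summable fun j : ℤ => dcy (m - j : ℤ) :=
          (Equiv.subLeft m).summable_iff.2 summable_dcy
        refine Summable.of_nonneg_of_le (fun j => by positivity) (fun j => ?_)
          ((hdm.mul_left A).mul_right B)
        refine (mul_le_of_le_one_left (by positivity) (dcy_le_one _)).trans ?_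
        exact mul_le_mul (nF _) (nG _) (norm_nonneg _) (mul_nonneg hA (dcy_pos _).le)) s
    simp only [fun m => mul_rpow (z := r) (by norm_num : (0:ℝ) ≤ 8) (hE0 m), ← Finset.mul_sum]
    refine (mul_le_mul_of_nonneg_left h (by positivity)).trans ?_
    rw [← mul_rpow (by norm_num) (by positivity)]
    refine rpow_le_rpow (by positivity) ?_ hr0.le
    have h2 : 8 * (16 * wSum) ≤ C₀ := le_max_right _ _
    calc 8 * (16 * wSum * S * T) = 8 * (16 * wSum) * S * T := by ring
      _ ≤ _ := by gcongr
  calc _ ≤ ∑ m ∈ s, ENNReal.ofReal (3 ^ r * (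
        ‖dHil tensor (modL θa fun x => (hF x).toLp) (fun x => (hG x).toLp) m‖ ^ r +
        ‖dHil tensor (modL θb fun x => (hF x).toLp) (fun x => (hG x).toLp) m‖ ^ r + (8 * E m) ^ r)) := by
        refine Finset.sum_le_sum fun m _ => ?_
        refine (ENNReal.rpow_le_rpow (local_bound hF hG pF pG nF nG h0 h1 m) hr0.le).trans ?_
        have h8 : 0 ≤ 8 * E m := mul_nonneg (by norm_num) (hE0 m)
        rw [ENNReal.ofReal_rpow_of_nonneg (by positivity) hr0.le]
        exact ENNReal.ofReal_le_ofReal (rpow_add_three_le (norm_nonneg _) (norm_nonneg _) h8 hr0.le)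
    _ ≤ _ := by
        rw [← ENNReal.ofReal_sum_of_nonneg fun m _ => by
          have h8 : 0 ≤ 8 * E m := mul_nonneg (by norm_num) (hE0 m)
          positivity]
        refine ENNReal.ofReal_le_ofReal ?_
        rw [← Finset.mul_sum, Finset.sum_add_distrib, Finset.sum_add_distrib]
        have h3 : (3:ℝ) ≤ 3 ^ r := by
          simpa using rpow_le_rpow_of_exponent_le (by norm_num : (1:ℝ) ≤ 3) hr1.le
        have h4 : (0:ℝ) ≤ (C₀ * S * T) ^ r := by positivity
        calc _ ≤ 3 ^ r * ((C₀ * S * T) ^ r + (C₀ * S * T) ^ r + (C₀ * S * T) ^ r) := by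
              gcongr
              · exact hd' θa
              · exact hd' θb
          _ = 3 ^ r * (3 * (C₀ * S * T) ^ r) := by ring
          _ ≤ 3 ^ r * (3 ^ r * (C₀ * S * T) ^ r) := by gcongr
          _ = (9 * C₀ * S * T) ^ r := by
            rw [← mul_rpow (by norm_num) (by positivity), ← mul_rpow (by norm_num) (by positivity)]
            congr 1; ring

lemma lintegral_eq_tsum_Ioc (a : ℝ) (h : ℝ → ℝ≥0∞) :
    ∫⁻ u, h u = ∑' x : ℤ, ∫⁻ u in Ioc a (a + 1), h (x + u) := by
  have e : (∫⁻ u, h u) = ∫⁻ u in ⋃ n : ℤ, Ioc (a + n) (a + n + 1), h u := by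
    rw [iUnion_Ioc_add_intCast, setLIntegral_univ]
  rw [e, lintegral_iUnion (fun n => measurableSet_Ioc) (pairwise_disjoint_Ioc_add_intCast a)]
  refine tsum_congr fun x => ?_
  have := (measurePreserving_add_left (volume : Measure ℝ) (x : ℝ)).setLIntegral_comp_preimage_emb
    (MeasurableEquiv.addLeft (x:ℝ)).measurableEmbedding h (Ioc (a + x) (a + x + 1))
  rw [← this]
  congr 2
  ext u
  simp only [mem_Ioc, mem_preimage]
  constructor <;> rintro ⟨h1, h2⟩ <;> constructor <;> linarith

/-- The unit-scale piece of `φ` near the integer `x`. -/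
noncomputable def unitPiece (a : ℝ) (φ : ℝ → ℂ) (x : ℤ) : ℝ → ℂ :=
  (Icc a (a + 2)).indicator fun u => φ (x + u)

section

variable {a A : ℝ} {φ : ℝ → ℂ}

lemma norm_unitPiece_le (ha : -1 ≤ a) (ha0 : a ≤ 0) (hA : ∀ x, ‖φ x‖ ≤ A * dcy x) (x : ℤ) (u : ℝ) :
    ‖unitPiece a φ x u‖ ≤ 9 * A * dcy x := by
  have hA0 : 0 ≤ A := nonneg_of_mul_nonneg_left ((norm_nonneg _).trans (hA 0)) (dcy_pos _)
  have hd := dcy_pos x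
  unfold unitPiece
  by_cases hu : u ∈ Icc a (a + 2)
  · rw [indicator_of_mem hu]
    have hu2 : |u| ≤ 2 := abs_le.2 ⟨by linarith [hu.1], by linarith [hu.2]⟩
    calc ‖φ (x + u)‖ ≤ A * ((1 + |u|) ^ 2 * dcy x) :=
        (hA _).trans (mul_le_mul_of_nonneg_left (dcy_add_le _ _) hA0)
      _ ≤ A * ((1 + 2) ^ 2 * dcy x) := by gcongr
      _ = _ := by ring
  · rw [indicator_of_notMem hu, norm_zero]
    positivity

lemma eLpNorm_unitPiece (x : ℤ) (p : ℝ≥0∞) :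
    eLpNorm (unitPiece a φ x) p = eLpNorm (fun u => φ (x + u)) p (volume.restrict (Icc a (a + 2))) :=
  eLpNorm_indicator_eq_eLpNorm_restrict measurableSet_Icc

lemma eLpNorm_unitPiece_le_ofReal (ha : -1 ≤ a) (ha0 : a ≤ 0) (hA : ∀ x, ‖φ x‖ ≤ A * dcy x) (x : ℤ) :
    eLpNorm (unitPiece a φ x) 2 ≤ ENNReal.ofReal (18 * A * dcy x) := by
  have hA0 : 0 ≤ A := nonneg_of_mul_nonneg_left ((norm_nonneg _).trans (hA 0)) (dcy_pos _)
  have hd := dcy_pos x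
  have e : unitPiece a φ x = (Icc a (a + 2)).indicator (unitPiece a φ x) := by
    rw [unitPiece, indicator_indicator, inter_self]
  rw [e, eLpNorm_indicator_eq_eLpNorm_restrict measurableSet_Icc]
  refine (eLpNorm_le_of_ae_bound (C := 9 * A * dcy x)
    (Filter.Eventually.of_forall (norm_unitPiece_le ha ha0 hA x))).trans ?_
  rw [Measure.restrict_apply_univ, Real.volume_Icc]
  have : (ENNReal.ofReal (a + 2 - a)) ^ (ENNReal.toReal 2)⁻¹ ≤ 2 := by
    rw [show a + 2 - a = 2 by ring, show ENNReal.ofReal 2 = 2 by norm_num]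
    calc (2:ℝ≥0∞) ^ (ENNReal.toReal 2)⁻¹ ≤ 2 ^ (1:ℝ) :=
          ENNReal.rpow_le_rpow_of_exponent_le (by norm_num) (by norm_num)
      _ = 2 := by simp
  calc _ ≤ 2 * ENNReal.ofReal (9 * A * dcy x) := by gcongr
    _ = ENNReal.ofReal (2 * (9 * A * dcy x)) := by
      rw [ENNReal.ofReal_mul (by norm_num : (0:ℝ) ≤ 2), show ENNReal.ofReal 2 = 2 by norm_num]
    _ = _ := by congr 1; ring

lemma memLp_unitPiece (hφ : Continuous φ) (ha : -1 ≤ a) (ha0 : a ≤ 0) (hA : ∀ x, ‖φ x‖ ≤ A * dcy x)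
    (x : ℤ) : MemLp (unitPiece a φ x) 2 := by
  refine ⟨?_, (eLpNorm_unitPiece_le_ofReal ha ha0 hA x).trans_lt ENNReal.ofReal_lt_top⟩
  exact ((by fun_prop : Continuous fun u => φ (x + u)).aestronglyMeasurable).indicator
    measurableSet_Icc

lemma sum_eLpNorm_unitPiece_rpow_le (hφ : Continuous φ) {p : ℝ} (hp : 2 < p) (s : Finset ℤ) :
    ∑ x ∈ s, eLpNorm (unitPiece a φ x) 2 ^ p ≤ (4 * eLpNorm φ (ENNReal.ofReal p)) ^ p := by
  have hp0 : 0 < p := by linarith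
  have hP0 : ENNReal.ofReal p ≠ 0 := by simpa using hp0
  have key : ∀ f : ℝ → ℂ, ∀ μ : Measure ℝ,
      eLpNorm f (ENNReal.ofReal p) μ ^ p = ∫⁻ u, ‖f u‖ₑ ^ p ∂μ := by
    intro f μ
    rw [eLpNorm_eq_lintegral_rpow_enorm_toReal hP0 ENNReal.ofReal_ne_top,
      ENNReal.toReal_ofReal hp0.le, ← ENNReal.rpow_mul, one_div_mul_cancel hp0.ne', ENNReal.rpow_one]
  have h1 : ∀ x : ℤ, eLpNorm (unitPiece a φ x) 2 ^ p ≤ 2 ^ p *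
      ((∫⁻ u in Ioc a (a + 1), ‖φ (x + u)‖ₑ ^ p) +
        ∫⁻ u in Ioc (a + 1) (a + 1 + 1), ‖φ (x + u)‖ₑ ^ p) := by
    intro x
    have hm : AEStronglyMeasurable (fun u => φ (x + u)) (volume.restrict (Icc a (a + 2))) :=
      (by fun_prop : Continuous fun u => φ (x + u)).aestronglyMeasurable
    have h2 := eLpNorm_le_eLpNorm_mul_rpow_measure_univ (p := 2) (q := ENNReal.ofReal p)
      (by rw [show (2:ℝ≥0∞) = ENNReal.ofReal 2 by norm_num]; exact ENNReal.ofReal_le_ofReal hp.le) hm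
    rw [Measure.restrict_apply_univ, Real.volume_Icc, show a + 2 - a = 2 by ring,
      show ENNReal.ofReal 2 = 2 by norm_num, ENNReal.toReal_ofReal hp0.le] at h2
    have h3 : (2:ℝ≥0∞) ^ (1 / ENNReal.toReal 2 - 1 / p) ≤ 2 := by
      calc (2:ℝ≥0∞) ^ (1 / ENNReal.toReal 2 - 1 / p) ≤ 2 ^ (1:ℝ) :=
            ENNReal.rpow_le_rpow_of_exponent_le (by norm_num) (by
              have : 0 < 1 / p := by positivity
              rw [ENNReal.toReal_ofNat]
              linarith)
        _ = 2 := by simp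
    rw [eLpNorm_unitPiece]
    calc _ ≤ (2 * eLpNorm (fun u => φ (x + u)) (ENNReal.ofReal p)
          (volume.restrict (Icc a (a + 2)))) ^ p := by
          refine ENNReal.rpow_le_rpow (h2.trans ?_) hp0.le
          rw [mul_comm]; gcongr
      _ = 2 ^ p * ∫⁻ u in Icc a (a + 2), ‖φ (x + u)‖ₑ ^ p := by
          rw [ENNReal.mul_rpow_of_nonneg _ _ hp0.le, key]
      _ = 2 ^ p * ∫⁻ u in Ioc a (a + 1) ∪ Ioc (a + 1) (a + 1 + 1), ‖φ (x + u)‖ₑ ^ p := by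
          rw [Ioc_union_Ioc_eq_Ioc (by linarith) (by linarith), show a + 1 + 1 = a + 2 by ring,
            restrict_Ioc_eq_restrict_Icc]
      _ ≤ _ := by gcongr; exact lintegral_union_le _ _ _
  calc _ ≤ ∑ x ∈ s, 2 ^ p * ((∫⁻ u in Ioc a (a + 1), ‖φ (x + u)‖ₑ ^ p) +
        ∫⁻ u in Ioc (a + 1) (a + 1 + 1), ‖φ (x + u)‖ₑ ^ p) := Finset.sum_le_sum fun x _ => h1 x
    _ ≤ ∑' x : ℤ, 2 ^ p * ((∫⁻ u in Ioc a (a + 1), ‖φ (x + u)‖ₑ ^ p) +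
        ∫⁻ u in Ioc (a + 1) (a + 1 + 1), ‖φ (x + u)‖ₑ ^ p) := ENNReal.sum_le_tsum _
    _ = 2 ^ p * (2 * ∫⁻ u, ‖φ u‖ₑ ^ p) := by
      rw [ENNReal.tsum_mul_left, ENNReal.tsum_add,
        ← lintegral_eq_tsum_Ioc a (fun u => ‖φ u‖ₑ ^ p),
        ← lintegral_eq_tsum_Ioc (a + 1) (fun u => ‖φ u‖ₑ ^ p), two_mul]
    _ ≤ 2 ^ p * (2 ^ p * ∫⁻ u, ‖φ u‖ₑ ^ p) := by
      gcongr
      calc (2:ℝ≥0∞) = 2 ^ (1:ℝ) := by simp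
        _ ≤ 2 ^ p := ENNReal.rpow_le_rpow_of_exponent_le (by norm_num) (by linarith)
    _ = _ := by
      rw [← key, ← ENNReal.mul_rpow_of_nonneg _ _ hp0.le, ← ENNReal.mul_rpow_of_nonneg _ _ hp0.le,
        ← mul_assoc]
      norm_num

lemma sum_norm_toLp_unitPiece_rpow_le (hφ : Continuous φ) (h : ∀ x, MemLp (unitPiece a φ x) 2) {p : ℝ}
    (hp : 2 < p) (hφp : eLpNorm φ (ENNReal.ofReal p) ≠ ⊤) (s : Finset ℤ) :
    ∑ x ∈ s, ‖(h x).toLp‖ ^ p ≤ (4 * (eLpNorm φ (ENNReal.ofReal p)).toReal) ^ p := by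
  have hp0 : 0 < p := by linarith
  have h1 := sum_eLpNorm_unitPiece_rpow_le (a := a) hφ hp s
  have h2 := ENNReal.toReal_mono
    (ENNReal.rpow_ne_top_of_nonneg hp0.le (ENNReal.mul_ne_top (by norm_num) hφp)) h1
  rw [ENNReal.toReal_sum fun x _ => ENNReal.rpow_ne_top_of_nonneg hp0.le (h x).2.ne] at h2
  simpa [← ENNReal.toReal_rpow, ENNReal.toReal_mul, Lp.norm_toLp] using h2

end

/-- The square function of the rescaled bilinear operators. -/
noncomputable def sqFun (φ ψ : ℝ → ℂ) (θa θb u : ℝ) : ℝ :=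
  √(∑' n : ℤ, ‖∫ σ, φ (u - σ) * ψ (u + σ) * kk θa θb σ * ee (-(n * σ))‖ ^ 2)

/-- The periodized integrand, expressed through the unit-scale pieces. -/
noncomputable def perFun (φ ψ : ℝ → ℂ) (θa θb : ℝ) (m : ℤ) (z : ℝ × ℝ) : ℂ :=
  ∑' j : ℤ, unitPiece (-1) φ (m - j) (z.1 - z.2) * unitPiece 0 ψ (m + j) (z.1 + z.2) * kk θa θb (z.2 + j)

section

variable {φ ψ : ℝ → ℂ} {A B θa θb : ℝ}

lemma measurable_unitPiece (hφ : Continuous φ) (a : ℝ) (x : ℤ) : Measurable (unitPiece a φ x) :=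
  ((by fun_prop : Continuous fun u => φ (x + u)).measurable).indicator measurableSet_Icc

lemma measurable_perFun (hφ : Continuous φ) (hψ : Continuous ψ) (hA : ∀ x, ‖φ x‖ ≤ A * dcy x)
    (hB : ∀ x, ‖ψ x‖ ≤ B * dcy x) (h0 : θa ≤ θb) (h1 : θb ≤ θa + 1) (m : ℤ) :
    Measurable (perFun φ ψ θa θb m) := by
  have hA0 : 0 ≤ A := nonneg_of_mul_nonneg_left ((norm_nonneg _).trans (hA 0)) (dcy_pos _)
  have hB0 : 0 ≤ B := nonneg_of_mul_nonneg_left ((norm_nonneg _).trans (hB 0)) (dcy_pos _)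
  have hkk := continuous_kk θa θb
  have hs : ∀ z : ℝ × ℝ, Summable fun j : ℤ =>
      unitPiece (-1) φ (m - j) (z.1 - z.2) * unitPiece 0 ψ (m + j) (z.1 + z.2) * kk θa θb (z.2 + j) := by
    intro z
    have hdm : Summable fun j : ℤ => dcy (m - j : ℤ) :=
      (Equiv.subLeft m).summable_iff.2 summable_dcy
    refine Summable.of_norm_bounded (hdm.mul_left (9 * A * (9 * B))) fun j => ?_
    rw [norm_mul, norm_mul]
    have e1 := norm_unitPiece_le (a := -1) le_rfl (by norm_num) hA (m - j) (z.1 - z.2)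
    have e2 : ‖unitPiece 0 ψ (m + j) (z.1 + z.2)‖ ≤ 9 * B :=
      (norm_unitPiece_le (by norm_num) le_rfl hB (m + j) (z.1 + z.2)).trans
        (mul_le_of_le_one_right (by positivity) (dcy_le_one _))
    have hd := dcy_pos ((m - j : ℤ) : ℝ)
    calc _ ≤ 9 * A * dcy (m - j : ℤ) * (9 * B) * 1 := by
          gcongr
          exact norm_kk_le h0 h1 _
      _ = _ := by ring
  refine measurable_of_tendsto_metrizable (f := fun (N : ℕ) z => ∑ j ∈ Finset.Icc (-(N:ℤ)) N,
      unitPiece (-1) φ (m - j) (z.1 - z.2) * unitPiece 0 ψ (m + j) (z.1 + z.2) * kk θa θb (z.2 + j))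
    (fun N => Finset.measurable_fun_sum _ fun j _ => ?_) ?_
  · exact (((measurable_unitPiece hφ _ _).comp (by fun_prop)).mul
      ((measurable_unitPiece hψ _ _).comp (by fun_prop))).mul (hkk.measurable.comp (by fun_prop))
  · rw [tendsto_pi_nhds]
    intro z
    exact (hs z).hasSum.comp (Finset.tendsto_Icc_neg.comp tendsto_natCast_atTop_atTop)

lemma norm_integrand_le (hA : ∀ x, ‖φ x‖ ≤ A * dcy x) (hB : ∀ x, ‖ψ x‖ ≤ B * dcy x)
    (h0 : θa ≤ θb) (h1 : θb ≤ θa + 1) (u σ : ℝ) :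
    ‖φ (u - σ) * ψ (u + σ) * kk θa θb σ‖ ≤ A * (1 + |u|) ^ 2 * B * dcy σ := by
  have hA0 : 0 ≤ A := nonneg_of_mul_nonneg_left ((norm_nonneg _).trans (hA 0)) (dcy_pos _)
  have hB0 : 0 ≤ B := nonneg_of_mul_nonneg_left ((norm_nonneg _).trans (hB 0)) (dcy_pos _)
  have hd := dcy_pos σ
  have e1 : dcy (u - σ) ≤ (1 + |u|) ^ 2 * dcy σ := by
    have := dcy_add_le (-σ) u
    rwa [neg_add_eq_sub, show dcy (-σ) = dcy σ by simp [dcy]] at this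
  rw [norm_mul, norm_mul]
  calc _ ≤ (A * ((1 + |u|) ^ 2 * dcy σ)) * (B * 1) * 1 := by
        gcongr
        · exact (hA _).trans (by gcongr)
        · exact (hB _).trans (by gcongr; exact dcy_le_one _)
        · exact norm_kk_le h0 h1 _
    _ = _ := by ring

lemma sqFun_add_int (hφ : Continuous φ) (hψ : Continuous ψ) (hA : ∀ x, ‖φ x‖ ≤ A * dcy x)
    (hB : ∀ x, ‖ψ x‖ ≤ B * dcy x) (h0 : θa ≤ θb) (h1 : θb ≤ θa + 1) (m : ℤ) {y : ℝ}
    (hy : y ∈ Ioc (0:ℝ) 1) :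
    ‖sqFun φ ψ θa θb (m + y)‖ₑ ^ (2:ℝ) ≤
      ∫⁻ σ in Ioc (0:ℝ) 1, ‖perFun φ ψ θa θb m (y, σ)‖ₑ ^ (2:ℝ) := by
  have hkk := continuous_kk θa θb
  have h := tsum_sq_fourier_eq (H := fun σ => φ (m + y - σ) * ψ (m + y + σ) * kk θa θb σ)
    (by fun_prop) (norm_integrand_le hA hB h0 h1 (m + y))
  have e : ‖sqFun φ ψ θa θb (m + y)‖ₑ ^ (2:ℝ) =
      ‖∫ σ in Ioc (0:ℝ) 1, ‖∑' j : ℤ, φ (m + y - (σ + j)) * ψ (m + y + (σ + j)) *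
        kk θa θb (σ + j)‖ ^ 2‖ₑ := by
    rw [← h, sqFun, ENNReal.rpow_ofNat, ← enorm_pow,
      sq_sqrt (tsum_nonneg fun n => by positivity)]
  rw [e]
  refine (enorm_integral_le_lintegral_enorm _).trans (le_of_eq ?_)
  refine setLIntegral_congr_fun measurableSet_Ioc fun σ hσ => ?_
  simp only [enorm_pow, enorm_norm, ENNReal.rpow_ofNat, perFun]
  congr 2
  refine tsum_congr fun j => ?_
  have m1 : y - σ ∈ Icc (-1:ℝ) (-1 + 2) := ⟨by linarith [hy.1, hσ.2], by linarith [hy.2, hσ.1]⟩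
  have m2 : y + σ ∈ Icc (0:ℝ) (0 + 2) := ⟨by linarith [hy.1, hσ.1], by linarith [hy.2, hσ.2]⟩
  rw [unitPiece, unitPiece, indicator_of_mem m1, indicator_of_mem m2]
  push_cast
  rw [show (m:ℝ) + y - (σ + j) = m - j + (y - σ) by ring,
    show (m:ℝ) + y + (σ + j) = m + j + (y + σ) by ring]

lemma lintegral_sqFun_rpow_le (hφ : Continuous φ) (hψ : Continuous ψ)
    (hA : ∀ x, ‖φ x‖ ≤ A * dcy x) (hB : ∀ x, ‖ψ x‖ ≤ B * dcy x) (h0 : θa ≤ θb)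
    (h1 : θb ≤ θa + 1) (m : ℤ) {r : ℝ} (hr0 : 0 < r) (hr2 : r ≤ 2) :
    ∫⁻ y in Ioc (0:ℝ) 1, ‖sqFun φ ψ θa θb (m + y)‖ₑ ^ r ≤
      eLpNorm (perFun φ ψ θa θb m) 2 ((volume.prod volume).restrict (Icc 0 1 ×ˢ Icc 0 1)) ^ r := by
  have hm := measurable_perFun hφ hψ hA hB h0 h1 m
  have hmm : Measurable fun z => ‖perFun φ ψ θa θb m z‖ₑ ^ (2:ℝ) := hm.enorm.pow_const _
  set h : ℝ → ℝ≥0∞ := fun y => ∫⁻ σ in Ioc (0:ℝ) 1, ‖perFun φ ψ θa θb m (y, σ)‖ₑ ^ (2:ℝ) with hh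
  have hmeas : Measurable h := hmm.lintegral_prod_right'
  have e1 : ∫⁻ y in Ioc (0:ℝ) 1, ‖sqFun φ ψ θa θb (m + y)‖ₑ ^ r ≤
      ∫⁻ y in Ioc (0:ℝ) 1, h y ^ (r / 2) := by
    refine setLIntegral_mono (hmeas.pow_const _) fun y hy => ?_
    have := ENNReal.rpow_le_rpow (sqFun_add_int hφ hψ hA hB h0 h1 m hy)
      (by positivity : 0 ≤ r / 2)
    rwa [← ENNReal.rpow_mul, mul_div_cancel₀ _ two_ne_zero] at this
  have e2 : ∫⁻ y in Ioc (0:ℝ) 1, h y ^ (r / 2) ≤ (∫⁻ y in Ioc (0:ℝ) 1, h y) ^ (r / 2) := by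
    have hprob : IsProbabilityMeasure (volume.restrict (Ioc (0:ℝ) 1)) := ⟨by simp⟩
    have := eLpNorm'_le_eLpNorm'_of_exponent_le (μ := volume.restrict (Ioc (0:ℝ) 1)) (f := h)
      (p := r / 2) (q := 1) (by positivity) (by linarith) hmeas.aestronglyMeasurable
    have := ENNReal.rpow_le_rpow this (by positivity : 0 ≤ r / 2)
    simpa [eLpNorm', ← ENNReal.rpow_mul, hr0.ne'] using this
  have e3 : ∫⁻ y in Ioc (0:ℝ) 1, h y =
      eLpNorm (perFun φ ψ θa θb m) 2 ((volume.prod volume).restrict (Icc 0 1 ×ˢ Icc 0 1)) ^ 2 := by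
    rw [eLpNorm_eq_lintegral_rpow_enorm_toReal two_ne_zero ENNReal.ofNat_ne_top, ENNReal.toReal_ofNat,
      ← Measure.prod_restrict, ← restrict_Ioc_eq_restrict_Icc, lintegral_prod _ hmm.aemeasurable,
      ← ENNReal.rpow_ofNat, ← ENNReal.rpow_mul]
    norm_num [hh]
  refine e1.trans (e2.trans (le_of_eq ?_))
  rw [e3, ← ENNReal.rpow_ofNat, ← ENNReal.rpow_mul]
  congr 1
  ring

end

/-- The estimate at unit scale. -/
lemma eLpNorm_sqFun_le {p q r : ℝ} (hp : 2 < p) (hq : 2 < q) (hr : 1 / r = 1 / p + 1 / q)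
    (hr1 : 1 < r) (hr2 : r < 2) : ∃ C : ℝ, 0 < C ∧ ∀ (φ ψ : ℝ → ℂ) (A B : ℝ), Continuous φ →
      Continuous ψ → (∀ x, ‖φ x‖ ≤ A * dcy x) → (∀ x, ‖ψ x‖ ≤ B * dcy x) → ∀ θa θb : ℝ,
      θa ≤ θb → θb ≤ θa + 1 →
      eLpNorm (sqFun φ ψ θa θb) (ENNReal.ofReal r) ≤ ENNReal.ofReal C *
        eLpNorm φ (ENNReal.ofReal p) * eLpNorm ψ (ENNReal.ofReal q) := by
  obtain ⟨C, hC, key⟩ := summed_bound hp hq hr hr1 hr2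
  refine ⟨16 * C, by positivity, ?_⟩
  intro φ ψ A B hφ hψ hA hB θa θb h0 h1
  have hr0 : 0 < r := by linarith
  have hA0 : 0 ≤ A := nonneg_of_mul_nonneg_left ((norm_nonneg _).trans (hA 0)) (dcy_pos _)
  have hB0 : 0 ≤ B := nonneg_of_mul_nonneg_left ((norm_nonneg _).trans (hB 0)) (dcy_pos _)
  have fin : ∀ {f : ℝ → ℂ} {D t : ℝ}, Continuous f → (∀ x, ‖f x‖ ≤ D * dcy x) → 2 < t →
      eLpNorm f (ENNReal.ofReal t) ≠ ⊤ := by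
    intro f D t hf hD ht
    have ht0 : 0 < t := by linarith
    have hD0 : 0 ≤ D := nonneg_of_mul_nonneg_left ((norm_nonneg _).trans (hD 0)) (dcy_pos _)
    refine ((integrable_norm_rpow_iff hf.aestronglyMeasurable (by simpa using ht0)
      ENNReal.ofReal_ne_top).1 ?_).2.ne
    rw [ENNReal.toReal_ofReal ht0.le]
    refine (integrable_dcy.const_mul (D ^ t)).mono' (hf.norm.rpow_const fun _ =>
      Or.inr ht0.le).aestronglyMeasurable (Filter.Eventually.of_forall fun x => ?_)
    have hd := dcy_pos x
    rw [norm_of_nonneg (by positivity)]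
    calc ‖f x‖ ^ t ≤ (D * dcy x) ^ t := rpow_le_rpow (norm_nonneg _) (hD x) ht0.le
      _ = D ^ t * dcy x ^ t := mul_rpow hD0 hd.le
      _ ≤ D ^ t * dcy x := by
        gcongr
        exact rpow_le_self_of_le_one hd.le (dcy_le_one x) (by linarith)
  have zero : ∀ {f : ℝ → ℂ} {t : ℝ}, Continuous f → 2 < t → eLpNorm f (ENNReal.ofReal t) = 0 →
      f = 0 := by
    intro f t hf ht h
    rw [eLpNorm_eq_zero_iff hf.aestronglyMeasurable (by simpa using by linarith)] at h
    exact (hf.ae_eq_iff_eq volume continuous_const).1 h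
  by_cases hφ0 : eLpNorm φ (ENNReal.ofReal p) = 0
  · have := zero hφ hp hφ0
    subst this
    have : sqFun 0 ψ θa θb = 0 := by ext u; simp [sqFun]
    simp [this]
  by_cases hψ0 : eLpNorm ψ (ENNReal.ofReal q) = 0
  · have := zero hψ hq hψ0
    subst this
    have : sqFun φ 0 θa θb = 0 := by ext u; simp [sqFun]
    simp [this]
  have fφ := fin hφ hA hp
  have fψ := fin hψ hB hq
  set U := (eLpNorm φ (ENNReal.ofReal p)).toReal with hU
  set V := (eLpNorm ψ (ENNReal.ofReal q)).toReal with hV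
  have hU0 : 0 < U := ENNReal.toReal_pos hφ0 fφ
  have hV0 : 0 < V := ENNReal.toReal_pos hψ0 fψ
  have mF := memLp_unitPiece hφ (a := -1) le_rfl (by norm_num) hA
  have mG := memLp_unitPiece hψ (a := 0) (by norm_num) le_rfl hB
  have main := key (unitPiece (-1) φ) (unitPiece 0 ψ) mF mG (18 * A) (18 * B)
    (fun x u => (norm_unitPiece_le le_rfl (by norm_num) hA x u).trans (by
      have := dcy_pos x
      gcongr; norm_num))
    (fun x u => (norm_unitPiece_le (by norm_num) le_rfl hB x u).trans
      ((mul_le_of_le_one_right (by positivity) (dcy_le_one _)).trans (by gcongr; norm_num)))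
    (fun x => by
      rw [Lp.norm_toLp]
      exact ENNReal.toReal_le_of_le_ofReal (mul_nonneg (by positivity) (dcy_pos _).le)
        (eLpNorm_unitPiece_le_ofReal le_rfl (by norm_num) hA x))
    (fun x => by
      rw [Lp.norm_toLp]
      exact (ENNReal.toReal_le_of_le_ofReal (mul_nonneg (by positivity) (dcy_pos _).le)
        (eLpNorm_unitPiece_le_ofReal (by norm_num) le_rfl hB x)).trans
        (mul_le_of_le_one_right (by positivity) (dcy_le_one _)))
    θa θb h0 h1 (4 * U) (4 * V) (by positivity) (by positivity)
    (sum_norm_toLp_unitPiece_rpow_le hφ mF hp fφ) (sum_norm_toLp_unitPiece_rpow_le hψ mG hq fψ)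
  have tot : ∫⁻ u, ‖sqFun φ ψ θa θb u‖ₑ ^ r ≤ ENNReal.ofReal ((C * (4 * U) * (4 * V)) ^ r) := by
    rw [lintegral_eq_tsum_Ioc 0, ENNReal.tsum_eq_iSup_sum]
    refine iSup_le fun s => le_trans (Finset.sum_le_sum fun m _ => ?_) (main s)
    rw [zero_add]
    exact lintegral_sqFun_rpow_le hφ hψ hA hB h0 h1 m hr0 hr2.le
  rw [eLpNorm_eq_lintegral_rpow_enorm_toReal (by simpa using hr0) ENNReal.ofReal_ne_top,
    ENNReal.toReal_ofReal hr0.le]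
  calc _ ≤ (ENNReal.ofReal ((C * (4 * U) * (4 * V)) ^ r)) ^ (1 / r) :=
        ENNReal.rpow_le_rpow tot (by positivity)
    _ = ENNReal.ofReal (16 * C * U * V) := by
      rw [ENNReal.ofReal_rpow_of_nonneg (by positivity) (by positivity), ← rpow_mul (by positivity),
        mul_one_div_cancel hr0.ne', rpow_one]
      congr 1; ring
    _ = _ := by
      rw [ENNReal.ofReal_mul (by positivity), ENNReal.ofReal_mul (by positivity),
        ENNReal.ofReal_toReal fφ, ENNReal.ofReal_toReal fψ]

lemma eLpNorm_comp_mul_left {E : Type*} [NormedAddCommGroup E] (f : ℝ → E) {δ p : ℝ} (hδ : 0 < δ)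
    (hp : 0 < p) : eLpNorm (fun x => f (δ * x)) (ENNReal.ofReal p) =
      ENNReal.ofReal (δ⁻¹ ^ (1 / p)) * eLpNorm f (ENNReal.ofReal p) := by
  have h := (Homeomorph.mulLeft₀ δ hδ.ne').measurableEmbedding.eLpNorm_map_measure
    (p := ENNReal.ofReal p) (μ := volume) (g := f)
  have e : (⇑(Homeomorph.mulLeft₀ δ hδ.ne') : ℝ → ℝ) = (δ * ·) := rfl
  rw [e, Real.map_volume_mul_left hδ.ne', abs_of_pos (inv_pos.2 hδ),
    eLpNorm_smul_measure_of_ne_zero (by simpa using hδ)] at h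
  rw [show (fun x => f (δ * x)) = f ∘ (δ * ·) from rfl, ← h, ENNReal.toReal_div,
    ENNReal.toReal_one, ENNReal.toReal_ofReal hp.le,
    ENNReal.ofReal_rpow_of_nonneg (inv_nonneg.2 hδ.le) (by positivity), smul_eq_mul]

lemma exists_norm_comp_mul_le (f : SchwartzMap ℝ ℂ) {δ : ℝ} (hδ : 0 < δ) :
    ∃ A : ℝ, ∀ x, ‖f (δ * x)‖ ≤ A * dcy x := by
  obtain ⟨C0, h0⟩ := f.decay 0 0
  obtain ⟨C2, h2⟩ := f.decay 2 0
  refine ⟨2 * C0 + 2 * (C2 * (δ ^ 2)⁻¹), fun x => ?_⟩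
  have e0 := h0.2 (δ * x)
  have e2 := h2.2 (δ * x)
  simp only [pow_zero, one_mul, norm_iteratedFDeriv_zero, norm_mul, norm_of_nonneg hδ.le] at e0 e2
  unfold dcy
  rw [← div_eq_mul_inv, le_div_iff₀ (by positivity)]
  have e3 : |x| ^ 2 * ‖f (δ * x)‖ ≤ C2 * (δ ^ 2)⁻¹ := by
    rw [← div_eq_mul_inv, le_div_iff₀ (by positivity)]
    calc _ = (δ * ‖x‖) ^ 2 * ‖f (δ * x)‖ := by rw [norm_eq_abs]; ring
      _ ≤ _ := e2
  have e4 : (1 + |x|) ^ 2 ≤ 2 + 2 * |x| ^ 2 := by nlinarith [sq_nonneg (1 - |x|)]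
  nlinarith [norm_nonneg (f (δ * x))]

lemma arith_seq {a : ℤ → ℝ} {D : ℝ} (h : ∀ n, a (n + 1) = a n + D) (n : ℤ) : a n = a 0 + n * D := by
  induction n using Int.induction_on with
  | zero => simp
  | succ n ih => rw [h, ih]; push_cast; ring
  | pred n ih =>
    have := h (-n - 1)
    rw [sub_add_cancel, ih] at this
    push_cast at this ⊢
    linarith

end TF

/-- **main theorem.** For `2 < p, q, r' < ∞` with `1/r = 1/p + 1/q`, the
square function associated to equally-spaced, equal-length disjoint intervals
`[a_n, b_n]` maps `L^p × L^q` into `L^r`, uniformly over such families of intervals. -/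
theorem bilinear_square_function_equal_strips
    (p q r : ℝ) (hp : 2 < p) (hq : 2 < q)
    (hr : 1 / r = 1 / p + 1 / q) (hr' : 2 < r / (r - 1)) :
    ∃ C : ℝ, 0 < C ∧ ∀ a b : ℤ → ℝ,
      (∀ n : ℤ, a n < b n) → (∀ n : ℤ, b n ≤ a (n + 1)) →
      (∀ n : ℤ, b n - a n = b 0 - a 0) →
      (∀ n : ℤ, a (n + 1) - b n = a 1 - b 0) →
      ∀ f g : SchwartzMap ℝ ℂ,
        eLpNorm (fun x : ℝ =>
            Real.sqrt (∑' n : ℤ, ‖biMul (Set.Icc (a n) (b n)) (⇑f) (⇑g) x‖ ^ 2))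
            (ENNReal.ofReal r) volume ≤
          ENNReal.ofReal C * eLpNorm (⇑f) (ENNReal.ofReal p) volume *
            eLpNorm (⇑g) (ENNReal.ofReal q) volume := by
  have hr0 : 0 < r := by
    have : 0 < 1 / r := by rw [hr]; positivity
    exact one_div_pos.1 this
  have hr1 : 1 < r := by
    by_contra! h
    have := div_nonpos_of_nonneg_of_nonpos hr0.le (by linarith : r - 1 ≤ 0)
    linarith
  have hr2 : r < 2 := by
    rw [lt_div_iff₀ (by linarith)] at hr'
    linarith
  obtain ⟨C, hC, key⟩ := TF.eLpNorm_sqFun_le hp hq hr hr1 hr2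
  refine ⟨C, hC, fun a b hab hba hlen hgap f g => ?_⟩
  set D := a 1 - a 0 with hD
  have ea : ∀ n : ℤ, a n = a 0 + n * D := TF.arith_seq fun n => by
    linarith [hlen n, hgap n]
  have eb : ∀ n : ℤ, b n = b 0 + n * D := fun n => by linarith [hlen n, ea n]
  have hD0 : 0 < D := by
    have h0 := hab 0
    have h1 := hba 0
    rw [zero_add] at h1
    linarith
  set δ := D⁻¹ with hδ
  have hδ0 : 0 < δ := inv_pos.2 hD0
  have hδD : δ * D = 1 := inv_mul_cancel₀ hD0.ne'
  obtain ⟨A, hA⟩ := TF.exists_norm_comp_mul_le f hδ0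
  obtain ⟨B, hB⟩ := TF.exists_norm_comp_mul_le g hδ0
  have h0 : δ * a 0 ≤ δ * b 0 := mul_le_mul_of_nonneg_left (hab 0).le hδ0.le
  have h1 : δ * b 0 ≤ δ * a 0 + 1 := by
    have := hba 0
    rw [zero_add] at this
    calc δ * b 0 ≤ δ * (a 0 + D) := mul_le_mul_of_nonneg_left (by linarith) hδ0.le
      _ = _ := by rw [mul_add, hδD]
  have main := key (fun u => f (δ * u)) (fun u => g (δ * u)) A B (by fun_prop) (by fun_prop)
    hA hB (δ * a 0) (δ * b 0) h0 h1
  have es : TF.sqFun (fun u => f (δ * u)) (fun u => g (δ * u)) (δ * a 0) (δ * b 0) = fun u =>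
      Real.sqrt (∑' n : ℤ, ‖biMul (Set.Icc (a n) (b n)) (⇑f) (⇑g) (δ * u)‖ ^ 2) := by
    funext u
    rw [TF.sqFun]
    congr 1
    refine tsum_congr fun n => ?_
    rw [TF.biMul_scaled f g hδ0 (θa := δ * a 0) (θb := δ * b 0) (hab n).le n
      (by rw [ea n, mul_add, mul_left_comm, hδD, mul_one])
      (by rw [eb n, mul_add, mul_left_comm, hδD, mul_one])]
    rfl
  rw [es, TF.eLpNorm_comp_mul_left (fun x => Real.sqrt
      (∑' n : ℤ, ‖biMul (Set.Icc (a n) (b n)) (⇑f) (⇑g) x‖ ^ 2)) hδ0 hr0,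
    TF.eLpNorm_comp_mul_left (⇑f) hδ0 (by linarith),
    TF.eLpNorm_comp_mul_left (⇑g) hδ0 (by linarith)] at main
  have hc : ENNReal.ofReal (δ⁻¹ ^ (1 / r)) =
      ENNReal.ofReal (δ⁻¹ ^ (1 / p)) * ENNReal.ofReal (δ⁻¹ ^ (1 / q)) := by
    rw [← ENNReal.ofReal_mul (by positivity), ← rpow_add (by positivity), hr]
  have hne : ENNReal.ofReal (δ⁻¹ ^ (1 / r)) ≠ 0 := by
    simpa using rpow_pos_of_pos (inv_pos.2 hδ0) _
  refine (ENNReal.mul_le_mul_iff_right hne ENNReal.ofReal_ne_top).1 (main.trans (le_of_eq ?_))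
  rw [hc]
  ring
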